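/- Let (X_n)_{n≥1} be stationary and ergodic with X_1 ~ P and let ℚ be the law of a stationary process (Y_n)_{n≥1} with Y_1 ~ Q and n-dimensional marginals Q_n, satisfying the mixing condition C^{−1}ℚ(A)ℚ(B) ≤ ℚ(A∩B) ≤ Cℚ(A)ℚ(B) for some 1 ≤ C < ∞, all n, all A ∈ σ(Y_1^n) and B ∈ σ(Y_{n+1}^∞). Then the limit R_∞(ℙ,ℚ,D) := lim_{n→∞} R_n(P_n, Q_n, D) exists, and for every D, almost surely liminf_{n→∞} L_n(X_1^n, Q_n, D) = R_∞(ℙ,ℚ,D). -/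

import Mathlib

open MeasureTheory Filter Set Topology Classical
open scoped ENNReal NNReal

noncomputable section

/-- `-log t` as a value in `ℝ≥0∞` (equal to `∞` when `t = 0`); intended for `t ≤ 1`. -/
def negLog (t : ℝ≥0∞) : ℝ≥0∞ :=
  if t = 0 then ∞ else ENNReal.ofReal (-Real.log t.toReal)

/-- `log t` as a value in `ℝ≥0∞` (equal to `∞` when `t = ∞`); intended for `t ≥ 1`. -/
def posLog (t : ℝ≥0∞) : ℝ≥0∞ :=
  if t = ∞ then ∞ else ENNReal.ofReal (Real.log t.toReal)

/-- The extended-real-valued logarithm of an `ℝ≥0∞` number. -/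
def eLog (t : ℝ≥0∞) : EReal :=
  if t = 0 then ⊥ else if t = ∞ then ⊤ else ((Real.log t.toReal : ℝ) : EReal)

/-- Relative entropy `H(μ‖ν)` (in nats), valued in `ℝ≥0∞`: it equals
`∫ log (dμ/dν) dμ` when `μ ≪ ν` (and `+∞` when this integral is not defined,
which for probability measures can only mean `+∞`), and `+∞` when `¬ μ ≪ ν`. -/
def relEnt {α : Type*} [MeasurableSpace α] (μ ν : Measure α) : ℝ≥0∞ :=
  if μ ≪ ν ∧ Integrable (llr μ ν) μ then ENNReal.ofReal (∫ x, llr μ ν x ∂μ) else ∞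

/-- The set `W(P,D)` of couplings: probability measures on `S × T` with first
marginal `P` and expected distortion at most `D`. -/
def distSet {S T : Type*} [MeasurableSpace S] [MeasurableSpace T]
    (ρ : S × T → ℝ) (P : Measure S) (D : ℝ) : Set (Measure (S × T)) :=
  {W | IsProbabilityMeasure W ∧ W.map Prod.fst = P ∧
    ((∫⁻ z, ENNReal.ofReal (ρ z) ∂W : ℝ≥0∞) : EReal) ≤ ((D : ℝ) : EReal)}

/-- The rate function `R(P,Q,D) = inf_{W ∈ W(P,D)} H(W‖P×Q)` (equal to `+∞`
when `W(P,D)` is empty). -/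
def Rrate {S T : Type*} [MeasurableSpace S] [MeasurableSpace T]
    (ρ : S × T → ℝ) (P : Measure S) (Q : Measure T) (D : ℝ) : ℝ≥0∞ :=
  ⨅ W ∈ distSet ρ P D, relEnt W (P.prod Q)

/-- `Λ(P,Q,λ) = E_X[log E_Y e^{λρ(X,Y)}]`, valued in `EReal`.
For `λ ≥ 0` the integrand lies in `[0,∞]`; for `λ < 0` it lies in `[-∞,0]`. -/
def Lam {S T : Type*} [MeasurableSpace S] [MeasurableSpace T]
    (ρ : S × T → ℝ) (P : Measure S) (Q : Measure T) (l : ℝ) : EReal :=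
  if 0 ≤ l then
    ((∫⁻ x, posLog (∫⁻ y, ENNReal.ofReal (Real.exp (l * ρ (x, y))) ∂Q) ∂P : ℝ≥0∞) : EReal)
  else
    -(((∫⁻ x, negLog (∫⁻ y, ENNReal.ofReal (Real.exp (l * ρ (x, y))) ∂Q) ∂P : ℝ≥0∞) : EReal))

/-- The Fenchel–Legendre transform `Λ*(P,Q,D) = sup_{λ ≤ 0} [λD - Λ(P,Q,λ)]`. -/
def LamStar {S T : Type*} [MeasurableSpace S] [MeasurableSpace T]
    (ρ : S × T → ℝ) (P : Measure S) (Q : Measure T) (D : ℝ) : EReal :=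
  ⨆ l ∈ Iic (0 : ℝ), (((l * D : ℝ) : EReal) - Lam ρ P Q l)

/-- `ρ_Q(x) := essinf_{Y ∼ Q} ρ(x,Y)`. -/
def rhoQ {S T : Type*} [MeasurableSpace T]
    (ρ : S × T → ℝ) (Q : Measure T) (x : S) : ℝ :=
  essInf (fun y => ρ (x, y)) Q

/-- `D_min(P,Q) := inf {D : Λ*(P,Q,D) < ∞}`. -/
def DminPQ {S T : Type*} [MeasurableSpace S] [MeasurableSpace T]
    (ρ : S × T → ℝ) (P : Measure S) (Q : Measure T) : ℝ :=
  sInf {D : ℝ | LamStar ρ P Q D ≠ ⊤}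

/-- `D_ave(P,Q) := E ρ(X,Y)` for independent `X ∼ P`, `Y ∼ Q`, valued in `ℝ≥0∞`. -/
def DavePQ {S T : Type*} [MeasurableSpace S] [MeasurableSpace T]
    (ρ : S × T → ℝ) (P : Measure S) (Q : Measure T) : ℝ≥0∞ :=
  ∫⁻ z, ENNReal.ofReal (ρ z) ∂(P.prod Q)

/-- The candidate derivative `Λ'(λ)` of `Λ(P,Q,·)`. -/
def LamD {S T : Type*} [MeasurableSpace S] [MeasurableSpace T]
    (ρ : S × T → ℝ) (P : Measure S) (Q : Measure T) (l : ℝ) : ℝ :=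
  ∫ x, (∫ y, ρ (x, y) * Real.exp (l * ρ (x, y)) ∂Q) /
    (∫ y, Real.exp (l * ρ (x, y)) ∂Q) ∂P

/-- The left shift on sequences. -/
def shiftSeq {α : Type*} (x : ℕ → α) (n : ℕ) : α := x (n + 1)

/-- The single-letter distortion measure `ρ_n` on `n`-strings. -/
def rhoFin {S T : Type*} (ρ : S × T → ℝ) (n : ℕ) (x : Fin n → S) (y : Fin n → T) : ℝ :=
  (n : ℝ)⁻¹ * ∑ k, ρ (x k, y k)

/-- `L_n(x_1^n, Q^n, D) = -(1/n) log Q^n(B_n(x_1^n,D))`, valued in `ℝ≥0∞`,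
for a memoryless (product) codebook distribution `Q^n`. -/
def LnIID {S T : Type*} [MeasurableSpace T]
    (ρ : S × T → ℝ) (Q : Measure T) (D : ℝ) (n : ℕ) (x : ℕ → S) : ℝ≥0∞ :=
  (n : ℝ≥0∞)⁻¹ *
    negLog ((Measure.pi fun _ : Fin n => Q) {y | rhoFin ρ n (fun k => x k) y ≤ D})

/-- The empirical distribution `P_{x_1^n} = (1/n) ∑_{k=1}^n δ_{x_k}`. -/
def empMeas {S : Type*} [MeasurableSpace S] (n : ℕ) (x : ℕ → S) : Measure S :=
  (n : ℝ≥0∞)⁻¹ • ∑ k ∈ Finset.range n, Measure.dirac (x k)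

/-- The `n`-dimensional marginal of a measure on sequences. -/
def margN {α : Type*} [MeasurableSpace α] (μ : Measure (ℕ → α)) (n : ℕ) :
    Measure (Fin n → α) :=
  μ.map fun x (k : Fin n) => x (k : ℕ)

/-- The strong mixing condition `C⁻¹ 𝒬(A) 𝒬(B) ≤ 𝒬(A ∩ B) ≤ C 𝒬(A) 𝒬(B)` for all
`A ∈ σ(Y_1^n)`, `B ∈ σ(Y_{n+1}^∞)` and all `n`. -/
def Mixing {T : Type*} [MeasurableSpace T] (𝒬 : Measure (ℕ → T)) (C : ℝ) : Prop :=
  ∀ (n : ℕ) (A B : Set (ℕ → T)),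
    MeasurableSet[MeasurableSpace.comap (fun y (k : Fin n) => y (k : ℕ)) inferInstance] A →
    MeasurableSet[MeasurableSpace.comap (fun y (k : ℕ) => y (k + n)) inferInstance] B →
    (ENNReal.ofReal C)⁻¹ * (𝒬 A * 𝒬 B) ≤ 𝒬 (A ∩ B) ∧
      𝒬 (A ∩ B) ≤ ENNReal.ofReal C * (𝒬 A * 𝒬 B)

/-- `L_n(x_1^n, Q_n, D) = -(1/n) log Q_n(B_n(x_1^n,D))` where `Q_n` is the
`n`-dimensional marginal of the codebook process law `𝒬`. -/
def LnMem {S T : Type*} [MeasurableSpace T]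
    (ρ : S × T → ℝ) (𝒬 : Measure (ℕ → T)) (D : ℝ) (n : ℕ) (x : ℕ → S) : ℝ≥0∞ :=
  (n : ℝ≥0∞)⁻¹ * negLog (margN 𝒬 n {y | rhoFin ρ n (fun k => x k) y ≤ D})

/-- The set `W_n(P_n,D)` of couplings on `S^n × T^n`. -/
def distSetN {S T : Type*} [MeasurableSpace S] [MeasurableSpace T]
    (ρ : S × T → ℝ) (n : ℕ) (Pn : Measure (Fin n → S)) (D : ℝ) :
    Set (Measure ((Fin n → S) × (Fin n → T))) :=
  {W | IsProbabilityMeasure W ∧ W.map Prod.fst = Pn ∧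
    ((∫⁻ z, ENNReal.ofReal (rhoFin ρ n z.1 z.2) ∂W : ℝ≥0∞) : EReal) ≤ ((D : ℝ) : EReal)}

/-- `R_n(P_n,Q_n,D) = (1/n) inf_{W_n ∈ W_n(P_n,D)} H(W_n‖P_n×Q_n)`. -/
def RnMem {S T : Type*} [MeasurableSpace S] [MeasurableSpace T]
    (ρ : S × T → ℝ) (n : ℕ) (Pn : Measure (Fin n → S)) (Qn : Measure (Fin n → T))
    (D : ℝ) : ℝ≥0∞ :=
  (n : ℝ≥0∞)⁻¹ * ⨅ W ∈ distSetN ρ n Pn D, relEnt W (Pn.prod Qn)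

/-- `Λ_n(P_n,Q_n,λ) = E_{X_1^n}[log E_{Y_1^n} e^{λ ρ_n(X_1^n,Y_1^n)}]`. -/
def LamN {S T : Type*} [MeasurableSpace S] [MeasurableSpace T]
    (ρ : S × T → ℝ) (n : ℕ) (Pn : Measure (Fin n → S)) (Qn : Measure (Fin n → T))
    (l : ℝ) : EReal :=
  Lam (fun z => rhoFin ρ n z.1 z.2) Pn Qn l

/-- `Λ_n*(P_n,Q_n,D) = (1/n) sup_{λ ≤ 0} [λD - Λ_n(P_n,Q_n,λ)]`. -/
def LamStarN {S T : Type*} [MeasurableSpace S] [MeasurableSpace T]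
    (ρ : S × T → ℝ) (n : ℕ) (Pn : Measure (Fin n → S)) (Qn : Measure (Fin n → T))
    (D : ℝ) : EReal :=
  (((n : ℝ)⁻¹ : ℝ) : EReal) *
    ⨆ l ∈ Iic (0 : ℝ), (((l * D : ℝ) : EReal) - LamN ρ n Pn Qn l)

/-- One-sided Fenchel–Legendre transform `D ↦ sup_{λ ≤ 0} [λD - Λ(λ)]` of a
function `Λ : ℝ → EReal`. -/
def FLT (L : ℝ → EReal) (D : ℝ) : EReal :=
  ⨆ l ∈ Iic (0 : ℝ), (((l * D : ℝ) : EReal) - L l)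

/-- Running maximum of Birkhoff sums (including the empty sum). -/
def maxBS {Ω : Type*} (F : Ω → Ω) (Z : Ω → ℝ) : ℕ → Ω → ℝ
  | 0 => fun _ => 0
  | N + 1 => fun ω => max 0 (Z ω + maxBS F Z N (F ω))

lemma maxBS_nonneg {Ω : Type*} (F : Ω → Ω) (Z : Ω → ℝ) (N : ℕ) (ω : Ω) :
    0 ≤ maxBS F Z N ω := by
  cases N <;> simp [maxBS]

lemma maxBS_mono {Ω : Type*} (F : Ω → Ω) (Z : Ω → ℝ) (N : ℕ) : ∀ ω : Ω,
    maxBS F Z N ω ≤ maxBS F Z (N + 1) ω := by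
  induction N with
  | zero => intro ω; exact maxBS_nonneg _ _ _ _
  | succ N ih =>
    intro ω
    show max 0 (Z ω + maxBS F Z N (F ω)) ≤ max 0 (Z ω + maxBS F Z (N+1) (F ω))
    gcongr
    exact ih _

lemma birkhoffSum_le_maxBS {Ω : Type*} (F : Ω → Ω) (Z : Ω → ℝ) (N : ℕ) : ∀ (n : ℕ), n ≤ N →
    ∀ ω : Ω, birkhoffSum F Z n ω ≤ maxBS F Z N ω := by
  induction N with
  | zero => intro n hn ω; obtain rfl : n = 0 := by omega
            simp [maxBS]
  | succ N ih =>
    intro n hn ω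
    cases n with
    | zero => simpa using maxBS_nonneg F Z (N+1) ω
    | succ n =>
      rw [birkhoffSum_succ']
      refine le_trans ?_ (le_max_right _ _)
      gcongr
      exact ih n (by omega) _

lemma exists_birkhoffSum_eq_maxBS {Ω : Type*} (F : Ω → Ω) (Z : Ω → ℝ) (N : ℕ) :
    ∀ ω : Ω, ∃ n ≤ N, maxBS F Z N ω = birkhoffSum F Z n ω := by
  induction N with
  | zero => intro ω; exact ⟨0, le_rfl, by simp [maxBS]⟩
  | succ N ih =>
    intro ω
    obtain ⟨n, hn, h⟩ := ih (F ω)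
    rcases le_total 0 (Z ω + maxBS F Z N (F ω)) with h0 | h0
    · refine ⟨n + 1, by omega, ?_⟩
      rw [birkhoffSum_succ', ← h]
      exact max_eq_right h0
    · exact ⟨0, by omega, by rw [birkhoffSum_zero]; exact max_eq_left h0⟩

section erg
variable {Ω : Type*} [MeasurableSpace Ω] {μ : Measure Ω} {F : Ω → Ω}
  {Z : Ω → ℝ}

lemma measurable_birkhoffSum' (hF : Measurable F) (hZ : Measurable Z) (N : ℕ) :
    Measurable (birkhoffSum F Z N) := by
  unfold birkhoffSum
  exact Finset.measurable_sum _ fun i _ => hZ.comp (hF.iterate i)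

lemma measurable_maxBS (hF : Measurable F) (hZ : Measurable Z) (N : ℕ) :
    Measurable (maxBS F Z N) := by
  induction N with
  | zero => exact measurable_const
  | succ N ih => exact measurable_const.max (hZ.add (ih.comp hF))

lemma integrable_maxBS [IsProbabilityMeasure μ] (hF : MeasurePreserving F μ μ)
    (hZi : Integrable Z μ) (N : ℕ) : Integrable (maxBS F Z N) μ := by
  induction N with
  | zero => exact integrable_const _
  | succ N ih =>
    exact (integrable_zero _ _ _).sup (hZi.add (hF.integrable_comp_of_integrable ih))

lemma maximal_ineq [IsProbabilityMeasure μ] (hF : MeasurePreserving F μ μ) (hZ : Measurable Z)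
    (hZi : Integrable Z μ) (N : ℕ) :
    0 ≤ ∫ ω, {ω | 0 < maxBS F Z (N+1) ω}.indicator Z ω ∂μ := by
  have hm : MeasurableSet {ω | 0 < maxBS F Z (N+1) ω} :=
    measurableSet_lt measurable_const (measurable_maxBS hF.measurable hZ _)
  have h1 : ∀ ω, maxBS F Z (N+1) ω - maxBS F Z N (F ω) ≤
      {ω | 0 < maxBS F Z (N+1) ω}.indicator Z ω := by
    intro ω
    by_cases h : 0 < maxBS F Z (N+1) ω
    · rw [indicator_of_mem (by exact h)]
      have : maxBS F Z (N+1) ω = Z ω + maxBS F Z N (F ω) := by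
        have h' : 0 < max 0 (Z ω + maxBS F Z N (F ω)) := h
        show max 0 (Z ω + maxBS F Z N (F ω)) = _
        rcases lt_max_iff.1 h' with h2 | h2
        · exact absurd h2 (lt_irrefl _)
        · exact max_eq_right h2.le
      linarith
    · rw [indicator_of_notMem (by exact h)]
      have := maxBS_nonneg F Z N (F ω)
      linarith
  have hi1 := integrable_maxBS hF hZi (N+1)
  have hi0 := integrable_maxBS hF hZi N
  have hi2 : Integrable (fun ω => maxBS F Z N (F ω)) μ := hF.integrable_comp_of_integrable hi0
  have h2 := integral_mono (hi1.sub hi2) (hZi.indicator hm) h1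
  refine le_trans ?_ h2
  have h3 : ∫ ω, (maxBS F Z (N+1) - fun ω => maxBS F Z N (F ω)) ω ∂μ
      = ∫ ω, maxBS F Z (N+1) ω ∂μ - ∫ ω, maxBS F Z N ω ∂μ := by
    have : ∫ ω, maxBS F Z N (F ω) ∂μ = ∫ ω, maxBS F Z N ω ∂μ := by
      conv_rhs => rw [← hF.map_eq]
      rw [integral_map hF.measurable.aemeasurable]
      rw [hF.map_eq]; exact hi0.aestronglyMeasurable
    rw [← this]
    exact integral_sub hi1 hi2
  have h4 := integral_mono hi0 hi1 (maxBS_mono F Z N)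
  have : 0 ≤ ∫ ω, (maxBS F Z (N+1) - fun ω => maxBS F Z N (F ω)) ω ∂μ := by
    rw [h3]; linarith
  exact this

lemma ae_bdd_birkhoffSum [IsProbabilityMeasure μ] (hF : Ergodic F μ) (hZ : Measurable Z)
    (hZi : Integrable Z μ) (hneg : ∫ ω, Z ω ∂μ < 0) :
    ∀ᵐ ω ∂μ, ∃ K : ℕ, ∀ N, birkhoffSum F Z N ω ≤ K := by
  set A : Set Ω := {ω | ∃ K : ℕ, ∀ N, birkhoffSum F Z N ω ≤ K} with hA
  have hAm : MeasurableSet A := by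
    have : A = ⋃ K : ℕ, ⋂ N, {ω | birkhoffSum F Z N ω ≤ K} := by
      ext; simp [hA]
    rw [this]
    exact MeasurableSet.iUnion fun K => MeasurableSet.iInter fun N =>
      measurableSet_le (measurable_birkhoffSum' hF.measurable hZ N) measurable_const
  have hinv : F ⁻¹' A = A := by
    ext ω
    simp only [hA, mem_preimage, mem_ofPred_eq]
    constructor
    · rintro ⟨K, hK⟩
      obtain ⟨K', hK'⟩ := exists_nat_ge (|Z ω| + K)
      refine ⟨K', fun N => ?_⟩
      cases N with
      | zero => simp
      | succ N =>
        rw [birkhoffSum_succ']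
        have := hK N
        have := le_abs_self (Z ω)
        linarith
    · rintro ⟨K, hK⟩
      obtain ⟨K', hK'⟩ := exists_nat_ge (|Z ω| + K)
      refine ⟨K', fun N => ?_⟩
      have := hK (N+1)
      rw [birkhoffSum_succ'] at this
      have := neg_abs_le (Z ω)
      linarith
  rcases hF.toPreErgodic.ae_mem_or_ae_notMem hAm hinv with h | h
  · exact h
  · exfalso
    have hlim : Tendsto (fun N => ∫ ω, {ω | 0 < maxBS F Z (N+1) ω}.indicator Z ω ∂μ) atTop
        (𝓝 (∫ ω, Z ω ∂μ)) := by
      refine tendsto_integral_of_dominated_convergence (fun ω => |Z ω|) ?_ hZi.abs ?_ ?_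
      · intro N
        exact (hZ.indicator (measurableSet_lt measurable_const
          (measurable_maxBS hF.measurable hZ _))).aestronglyMeasurable
      · intro N
        refine ae_of_all _ fun ω => ?_
        rw [Real.norm_eq_abs]
        by_cases h : ω ∈ {ω | 0 < maxBS F Z (N+1) ω}
        · rw [indicator_of_mem h]
        · rw [indicator_of_notMem h]; simp
      · filter_upwards [h] with ω hω
        simp only [hA, mem_ofPred_eq, not_exists, not_forall, not_le] at hω
        obtain ⟨N, hN⟩ := hω 0
        refine tendsto_const_nhds.congr' ?_
        filter_upwards [eventually_ge_atTop N] with n hn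
        rw [indicator_of_mem]
        have := birkhoffSum_le_maxBS F Z (n+1) N (by omega) ω
        simp only [mem_ofPred_eq]
        push_cast at hN
        linarith
    have := ge_of_tendsto' hlim fun N => maximal_ineq hF.toMeasurePreserving hZ hZi N
    linarith

/-- If the mean is negative, Birkhoff sums drift to `-∞` linearly. -/
lemma ae_eventually_birkhoffSum [IsProbabilityMeasure μ] (hF : Ergodic F μ) (hZ : Measurable Z)
    (hZi : Integrable Z μ) (hneg : ∫ ω, Z ω ∂μ < 0) :
    ∃ c > 0, ∀ᵐ ω ∂μ, ∀ᶠ N : ℕ in atTop, birkhoffSum F Z N ω ≤ - c * N := by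
  set c := -(∫ ω, Z ω ∂μ) / 4 with hc
  refine ⟨c, by simp only [hc]; linarith, ?_⟩
  have := ae_bdd_birkhoffSum (Z := fun ω => Z ω + 2 * c) hF (hZ.add_const _)
    (hZi.add (integrable_const _)) (by
      rw [integral_add hZi (integrable_const _)]; simp [hc]; linarith)
  filter_upwards [this] with ω ⟨K, hK⟩
  have hcpos : 0 < c := by simp only [hc]; linarith
  obtain ⟨N0, hN0⟩ := exists_nat_ge (K / c)
  filter_upwards [eventually_ge_atTop N0] with N hN
  have h1 := hK N
  have h2 : birkhoffSum F (fun ω => Z ω + 2 * c) N ω = birkhoffSum F Z N ω + N * (2 * c) := by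
    simp [birkhoffSum, Finset.sum_add_distrib]
  rw [h2] at h1
  have h3 : (K : ℝ) ≤ N * c := by
    have : (N0 : ℝ) ≤ N := by exact_mod_cast hN
    rw [div_le_iff₀ hcpos] at hN0
    nlinarith
  linarith

/-- If the mean is nonpositive, Birkhoff sums are nonpositive infinitely often. -/
lemma ae_frequently_birkhoffSum [IsProbabilityMeasure μ] (hF : Ergodic F μ) (hZ : Measurable Z)
    (hZi : Integrable Z μ) (hneg : ∫ ω, Z ω ∂μ ≤ 0) :
    ∀ᵐ ω ∂μ, ∃ᶠ N : ℕ in atTop, birkhoffSum F Z N ω ≤ 0 := by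
  set A : Set Ω := {ω | ∃ K : ℕ, ∀ N, - birkhoffSum F Z N ω ≤ K} with hA
  have hAm : MeasurableSet A := by
    have : A = ⋃ K : ℕ, ⋂ N, {ω | - birkhoffSum F Z N ω ≤ K} := by
      ext; simp [hA]
    rw [this]
    exact MeasurableSet.iUnion fun K => MeasurableSet.iInter fun N =>
      measurableSet_le (measurable_birkhoffSum' hF.measurable hZ N).neg measurable_const
  have hinv : F ⁻¹' A = A := by
    ext ω
    simp only [hA, mem_preimage, mem_ofPred_eq]
    constructor
    · rintro ⟨K, hK⟩
      obtain ⟨K', hK'⟩ := exists_nat_ge (|Z ω| + K)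
      refine ⟨K', fun N => ?_⟩
      cases N with
      | zero => simp
      | succ N =>
        rw [birkhoffSum_succ']
        have := hK N
        have := neg_abs_le (Z ω)
        linarith
    · rintro ⟨K, hK⟩
      obtain ⟨K', hK'⟩ := exists_nat_ge (|Z ω| + K)
      refine ⟨K', fun N => ?_⟩
      have := hK (N+1)
      rw [birkhoffSum_succ'] at this
      have := le_abs_self (Z ω)
      linarith
  rcases hF.toPreErgodic.ae_mem_or_ae_notMem hAm hinv with h | h
  swap
  · filter_upwards [h] with ω hω
    simp only [hA, mem_ofPred_eq, not_exists, not_forall, not_le] at hω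
    rw [frequently_atTop]
    intro N0
    by_contra hcon
    push Not at hcon
    obtain ⟨K, hK⟩ := exists_nat_ge (∑ j ∈ Finset.range N0, |birkhoffSum F Z j ω|)
    obtain ⟨N, hN⟩ := hω K
    have hNlt : N < N0 := by
      by_contra hge
      have := hcon N (by omega)
      have : (0:ℝ) ≤ K := by positivity
      linarith
    have := Finset.single_le_sum (f := fun j => |birkhoffSum F Z j ω|) (fun _ _ => abs_nonneg _)
      (Finset.mem_range.2 hNlt)
    have := neg_abs_le (birkhoffSum F Z N ω)
    linarith
  -- bounded below case
  set G : ℕ → Ω → ℝ := maxBS F (fun ω => - Z ω) with hG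
  have hnegsum : ∀ n ω, birkhoffSum F (fun ω => - Z ω) n ω = - birkhoffSum F Z n ω := by
    intro n ω; simp [birkhoffSum]
  have hGbdd : ∀ ω ∈ A, BddAbove (range fun L => G L ω) := by
    rintro ω ⟨K, hK⟩
    refine ⟨K, ?_⟩
    rintro _ ⟨L, rfl⟩
    obtain ⟨n, _, hn⟩ := exists_birkhoffSum_eq_maxBS F (fun ω => - Z ω) L ω
    simp only [hG]
    rw [hn, hnegsum]; exact hK n
  set g : Ω → ℝ := fun ω => ⨆ L, G L ω with hg
  have hgm : Measurable g := Measurable.iSup fun L => measurable_maxBS hF.measurable hZ.neg L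
  have hg0 : ∀ ω, 0 ≤ g ω := fun ω => Real.iSup_nonneg fun L => maxBS_nonneg _ _ _ _
  have hFA : ∀ ω ∈ A, F ω ∈ A := fun ω hω => by rw [← hinv] at hω; exact hω
  have hrec : ∀ ω ∈ A, g ω = max 0 (- Z ω + g (F ω)) := by
    intro ω hω
    apply le_antisymm
    · refine ciSup_le fun L => ?_
      cases L with
      | zero => exact le_max_left _ _
      | succ L =>
        show max 0 (- Z ω + G L (F ω)) ≤ _
        gcongr
        exact le_ciSup (hGbdd _ (hFA ω hω)) L
    · refine max_le (hg0 ω) ?_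
      have : g (F ω) ≤ g ω + Z ω := by
        refine ciSup_le fun L => ?_
        have h1 : G (L+1) ω ≤ g ω := le_ciSup (hGbdd _ hω) (L+1)
        have h2 : - Z ω + G L (F ω) ≤ G (L+1) ω := le_max_right _ _
        linarith
      linarith
  -- Fatou
  have key : ∀ᵐ ω ∂μ, Z ω ≤ g (F ω) := by
    set gk : ℕ → Ω → ℝ := fun k ω => min (g ω) k with hgk
    have hgkm : ∀ k, Measurable (gk k) := fun k => hgm.min measurable_const
    have hgki : ∀ k, Integrable (gk k) μ := by
      intro k
      refine Integrable.of_bound (hgkm k).aestronglyMeasurable k (ae_of_all _ fun ω => ?_)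
      rw [Real.norm_eq_abs, abs_of_nonneg (le_min (hg0 ω) (by positivity))]
      exact min_le_right _ _
    have hgkiF : ∀ k, Integrable (fun ω => gk k (F ω)) μ := fun k =>
      hF.toMeasurePreserving.integrable_comp_of_integrable (hgki k)
    have hgkint : ∀ k, ∫ ω, gk k (F ω) ∂μ = ∫ ω, gk k ω ∂μ := by
      intro k
      conv_rhs => rw [← hF.map_eq]
      rw [integral_map hF.measurable.aemeasurable]
      exact (hgkm k).aestronglyMeasurable
    have hZp : Integrable (fun ω => max (Z ω) 0) μ := hZi.pos_part
    have hZn : Integrable (fun ω => max (- Z ω) 0) μ := hZi.neg_part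
    set u : ℕ → Ω → ℝ := fun k ω => max (Z ω) 0 - (gk k (F ω) - gk k ω) with hu
    have hui : ∀ k, Integrable (u k) μ := fun k => hZp.sub ((hgkiF k).sub (hgki k))
    have huint : ∀ k, ∫ ω, u k ω ∂μ = ∫ ω, max (Z ω) 0 ∂μ := by
      intro k
      have e1 : ∫ ω, u k ω ∂μ = ∫ ω, max (Z ω) 0 ∂μ - ∫ ω, (gk k (F ω) - gk k ω) ∂μ :=
        integral_sub hZp ((hgkiF k).sub (hgki k))
      rw [e1, integral_sub (hgkiF k) (hgki k), hgkint]; ring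
    have hu0 : ∀ k, ∀ᵐ ω ∂μ, 0 ≤ u k ω := by
      intro k
      filter_upwards [h] with ω hω
      have hr := hrec ω hω
      simp only [hu, hgk]
      have h1 : - Z ω + g (F ω) ≤ g ω := by rw [hr]; exact le_max_right _ _
      have := le_max_left (Z ω) 0
      have := le_max_right (Z ω) 0
      rcases le_total (g ω) k with h2 | h2
      · rw [min_eq_left h2]
        have := min_le_left (g (F ω)) (k:ℝ)
        linarith
      · rw [min_eq_right h2]
        have := min_le_right (g (F ω)) (k:ℝ)
        linarith
    have hulim : ∀ ω, Tendsto (fun k => ENNReal.ofReal (u k ω)) atTop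
        (𝓝 (ENNReal.ofReal (max (Z ω) 0 - (g (F ω) - g ω)))) := by
      intro ω
      refine tendsto_const_nhds.congr' ?_
      obtain ⟨K, hK⟩ := exists_nat_ge (max (g ω) (g (F ω)))
      filter_upwards [eventually_ge_atTop K] with k hk
      have hk' : (K:ℝ) ≤ k := by exact_mod_cast hk
      have a1 := le_max_left (g ω) (g (F ω))
      have a2 := le_max_right (g ω) (g (F ω))
      simp only [hu, hgk]
      rw [min_eq_left (by linarith), min_eq_left (by linarith)]
    have hfat := lintegral_liminf_le (μ := μ) (u := atTop) (f := fun k ω => ENNReal.ofReal (u k ω))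
      (fun k => ((hZ.max measurable_const).sub
        (((hgkm k).comp hF.measurable).sub (hgkm k))).ennreal_ofReal)
    have e2 : ∀ k, ∫⁻ ω, ENNReal.ofReal (u k ω) ∂μ = ENNReal.ofReal (∫ ω, max (Z ω) 0 ∂μ) := by
      intro k
      rw [← huint k, ofReal_integral_eq_lintegral_ofReal (hui k) (hu0 k)]
    simp only [e2, liminf_const, (hulim _).liminf_eq] at hfat
    -- rewrite the integrand
    have e3 : ∫⁻ ω, ENNReal.ofReal (max (Z ω) 0 - (g (F ω) - g ω)) ∂μ =
        ∫⁻ ω, (ENNReal.ofReal (max (Z ω - g (F ω)) 0) + ENNReal.ofReal (max (- Z ω) 0)) ∂μ := by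
      refine lintegral_congr_ae ?_
      filter_upwards [h] with ω hω
      rw [← ENNReal.ofReal_add (le_max_right _ _) (le_max_right _ _)]
      congr 1
      rw [hrec ω hω]
      rcases le_total (Z ω) 0 with h1 | h1 <;> rcases le_total (Z ω - g (F ω)) 0 with h2 | h2
      all_goals
        first
        | rw [max_eq_right h1, max_eq_left (a := - Z ω) (by linarith)]
        | rw [max_eq_left h1, max_eq_right (a := - Z ω) (by linarith)]
        first
        | rw [max_eq_right h2, max_eq_right (a := (0:ℝ)) (by linarith)]; ring
        | rw [max_eq_left h2, max_eq_left (a := (0:ℝ)) (by linarith)]; ring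
    have hm' : Measurable (fun ω => ENNReal.ofReal (max (- Z ω) 0)) :=
      (hZ.neg.max measurable_const).ennreal_ofReal
    rw [e3, lintegral_add_right _ hm',
      ← ofReal_integral_eq_lintegral_ofReal hZn (ae_of_all _ fun _ => le_max_right _ _)] at hfat
    have e4 : ∫ ω, max (Z ω) 0 ∂μ ≤ ∫ ω, max (- Z ω) 0 ∂μ := by
      have : ∫ ω, Z ω ∂μ = ∫ ω, max (Z ω) 0 ∂μ - ∫ ω, max (- Z ω) 0 ∂μ := by
        rw [← integral_sub hZp hZn]
        refine integral_congr_ae (ae_of_all _ fun ω => ?_)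
        rcases le_total (Z ω) 0 with h1 | h1
        · simp [h1]
        · simp [h1]
      linarith
    have e5 := hfat.trans (ENNReal.ofReal_le_ofReal e4)
    have e6 : ∫⁻ ω, ENNReal.ofReal (max (Z ω - g (F ω)) 0) ∂μ = 0 := by
      by_contra hne
      have := ENNReal.lt_add_right (a := ENNReal.ofReal (∫ ω, max (- Z ω) 0 ∂μ))
        ENNReal.ofReal_ne_top hne
      rw [add_comm] at this
      exact absurd e5 (not_le.2 this)
    have hm2 : Measurable (fun ω => ENNReal.ofReal (max (Z ω - g (F ω)) 0)) :=
      ((hZ.sub (hgm.comp hF.measurable)).max measurable_const).ennreal_ofReal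
    rw [lintegral_eq_zero_iff hm2] at e6
    filter_upwards [e6] with ω hω
    have : max (Z ω - g (F ω)) 0 ≤ 0 := by simpa using hω
    have := (le_max_left _ _).trans this
    linarith
  set B : Set Ω := {ω | ∀ N, 0 < birkhoffSum F Z (N+1) ω} with hB
  have hBm : MeasurableSet B := by
    have : B = ⋂ N, {ω | 0 < birkhoffSum F Z (N+1) ω} := by ext; simp [hB]
    rw [this]
    exact MeasurableSet.iInter fun N =>
      measurableSet_lt measurable_const (measurable_birkhoffSum' hF.measurable hZ _)
  have hBnull : ∀ᵐ ω ∂μ, ω ∉ B := by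
    have hrecu := (hF.toMeasurePreserving.conservative).ae_mem_imp_frequently_image_mem
      hBm.nullMeasurableSet
    filter_upwards [hrecu, key, h] with ω h1 h2 h3 h4
    have h5 := h1 h4
    rw [frequently_atTop] at h5
    obtain ⟨n1, hn1, hn1B⟩ := h5 1
    obtain ⟨ε, hε, hεle⟩ : ∃ ε > 0, ∀ j < n1, ε ≤ birkhoffSum F Z (j+1) ω := by
      have hne : (Finset.range n1).Nonempty := ⟨0, Finset.mem_range.2 (by omega)⟩
      refine ⟨(Finset.range n1).inf' hne (fun j => birkhoffSum F Z (j+1) ω), ?_, ?_⟩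
      · rw [gt_iff_lt, Finset.lt_inf'_iff]
        intro j _; exact h4 j
      · intro j hj
        exact Finset.inf'_le (fun j => birkhoffSum F Z (j+1) ω) (Finset.mem_range.2 hj)
    have hall : ∀ n, ε ≤ birkhoffSum F Z (n+1) ω := by
      intro n
      by_cases hn : n < n1
      · exact hεle n hn
      · obtain ⟨k, rfl⟩ : ∃ k, n = n1 + k := ⟨n - n1, by omega⟩
        rw [add_assoc, birkhoffSum_add]
        have a1 := hεle (n1 - 1) (by omega)
        rw [Nat.sub_add_cancel hn1] at a1
        have a2 := hn1B k
        linarith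
    have : g (F ω) ≤ Z ω - ε := by
      refine ciSup_le fun L => ?_
      obtain ⟨n, _, hn⟩ := exists_birkhoffSum_eq_maxBS F (fun ω => - Z ω) L (F ω)
      simp only [hG]
      rw [hn, hnegsum]
      have := hall n
      rw [birkhoffSum_succ'] at this
      linarith
    linarith
  have hall : ∀ᵐ ω ∂μ, ∀ k, F^[k] ω ∉ B := by
    rw [ae_all_iff]
    intro k
    exact (hF.toMeasurePreserving.iterate k).quasiMeasurePreserving.ae hBnull
  filter_upwards [hall] with ω hω
  rw [frequently_atTop]
  intro N0
  induction N0 with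
  | zero => exact ⟨0, le_rfl, by simp⟩
  | succ N0 ih =>
    obtain ⟨N, hN, hS⟩ := ih
    have := hω N
    simp only [hB, mem_ofPred_eq, not_forall, not_lt] at this
    obtain ⟨n, hn⟩ := this
    refine ⟨N + (n+1), by omega, ?_⟩
    rw [birkhoffSum_add]
    linarith

/-- One-sided Birkhoff theorem for nonnegative functions. -/
lemma ae_eventually_birkhoffSum_ge [IsProbabilityMeasure μ] (hF : Ergodic F μ) (hZ : Measurable Z)
    (hZ0 : ∀ ω, 0 ≤ Z ω) (a : ℝ)
    (ha : ¬ (0 ≤ a ∧ ∫⁻ ω, ENNReal.ofReal (Z ω) ∂μ ≤ ENNReal.ofReal a)) :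
    ∀ᵐ ω ∂μ, ∀ᶠ N : ℕ in atTop, a * N ≤ birkhoffSum F Z N ω := by
  by_cases ha0 : 0 ≤ a
  swap
  · refine ae_of_all _ fun ω => Eventually.of_forall fun N => ?_
    have h1 : 0 ≤ birkhoffSum F Z N ω := Finset.sum_nonneg fun i _ => hZ0 _
    have h2 : (0:ℝ) ≤ N := by positivity
    nlinarith
  have ha1 : ENNReal.ofReal a < ∫⁻ ω, ENNReal.ofReal (Z ω) ∂μ := by
    by_contra hcon; exact ha ⟨ha0, not_lt.1 hcon⟩
  have hlim : Tendsto (fun K : ℕ => ∫⁻ ω, ENNReal.ofReal (min (Z ω) K) ∂μ) atTop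
      (𝓝 (∫⁻ ω, ENNReal.ofReal (Z ω) ∂μ)) := by
    refine lintegral_tendsto_of_tendsto_of_monotone
      (fun K => (hZ.min measurable_const).ennreal_ofReal.aemeasurable) ?_ ?_
    · refine ae_of_all _ fun ω K K' h => ENNReal.ofReal_le_ofReal ?_
      have : (K:ℝ) ≤ K' := by exact_mod_cast h
      gcongr
    · refine ae_of_all _ fun ω => tendsto_const_nhds.congr' ?_
      obtain ⟨K, hK⟩ := exists_nat_ge (Z ω)
      filter_upwards [eventually_ge_atTop K] with k hk
      have : (K:ℝ) ≤ k := by exact_mod_cast hk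
      rw [min_eq_left (by linarith)]
  obtain ⟨K, hK⟩ := (hlim.eventually (lt_mem_nhds ha1)).exists
  have hmi : Integrable (fun ω => min (Z ω) (K:ℝ)) μ := by
    refine Integrable.of_bound (hZ.min measurable_const).aestronglyMeasurable K
      (ae_of_all _ fun ω => ?_)
    rw [Real.norm_eq_abs, abs_of_nonneg (le_min (hZ0 ω) (by positivity))]
    exact min_le_right _ _
  rw [← ofReal_integral_eq_lintegral_ofReal hmi
    (ae_of_all _ fun ω => le_min (hZ0 ω) (by positivity)), ENNReal.ofReal_lt_ofReal_iff'] at hK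
  obtain ⟨c, hc, hae⟩ := ae_eventually_birkhoffSum (Z := fun ω => a - min (Z ω) (K:ℝ)) hF
    (measurable_const.sub (hZ.min measurable_const)) ((integrable_const _).sub hmi) (by
      rw [integral_sub (integrable_const _) hmi]; simp; linarith [hK.1])
  filter_upwards [hae] with ω hω
  filter_upwards [hω] with N hN
  have h1 : birkhoffSum F (fun ω => a - min (Z ω) (K:ℝ)) N ω =
      a * N - birkhoffSum F (fun ω => min (Z ω) (K:ℝ)) N ω := by
    simp [birkhoffSum, Finset.sum_sub_distrib, mul_comm]
  have h2 : birkhoffSum F (fun ω => min (Z ω) (K:ℝ)) N ω ≤ birkhoffSum F Z N ω :=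
    Finset.sum_le_sum fun i _ => min_le_left _ _
  have : (0:ℝ) ≤ N := by positivity
  rw [h1] at hN
  nlinarith
end erg

section dual
variable {X Y : Type*} [MeasurableSpace X] [MeasurableSpace Y]

lemma distSet_of_le {c : X × Y → ℝ} {P : Measure X} {D : ℝ} (hD : 0 ≤ D) {W : Measure (X × Y)}
    (h1 : IsProbabilityMeasure W) (h2 : W.map Prod.fst = P)
    (h3 : ∫⁻ z, ENNReal.ofReal (c z) ∂W ≤ ENNReal.ofReal D) : W ∈ distSet c P D := by
  refine ⟨h1, h2, ?_⟩
  have : ((ENNReal.ofReal D : ℝ≥0∞) : EReal) = (D : EReal) := by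
    rw [EReal.coe_ennreal_ofReal, max_eq_left hD]
  rw [← this]
  exact_mod_cast h3

/-- Helper: a density on the product whose fibre integrals are one. -/
lemma density_helper (P : Measure X) [IsProbabilityMeasure P] (Q : Measure Y)
    [IsProbabilityMeasure Q] {p : X × Y → ℝ} (hp : Measurable p)
    (h1 : ∀ᵐ x ∂P, ∫⁻ y, ENNReal.ofReal (p (x, y)) ∂Q = 1) :
    IsProbabilityMeasure ((P.prod Q).withDensity fun z => ENNReal.ofReal (p z)) ∧
    ((P.prod Q).withDensity fun z => ENNReal.ofReal (p z)).map Prod.fst = P ∧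
    (∀ f : X × Y → ℝ≥0∞, Measurable f →
      ∫⁻ z, f z ∂((P.prod Q).withDensity fun z => ENNReal.ofReal (p z)) =
        ∫⁻ x, ∫⁻ y, ENNReal.ofReal (p (x, y)) * f (x, y) ∂Q ∂P) ∧
    (∀ f : X → ℝ≥0∞, Measurable f →
      ∫⁻ z, f z.1 ∂((P.prod Q).withDensity fun z => ENNReal.ofReal (p z)) =
        ∫⁻ x, f x ∂P) := by
  have hpm : Measurable fun z => ENNReal.ofReal (p z) := hp.ennreal_ofReal
  have h3 : (∀ f : X × Y → ℝ≥0∞, Measurable f →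
      ∫⁻ z, f z ∂((P.prod Q).withDensity fun z => ENNReal.ofReal (p z)) =
        ∫⁻ x, ∫⁻ y, ENNReal.ofReal (p (x, y)) * f (x, y) ∂Q ∂P) := by
    intro f hf
    rw [lintegral_withDensity_eq_lintegral_mul _ hpm hf, lintegral_prod _ (hpm.mul hf).aemeasurable]
    rfl
  have h4 : (∀ f : X → ℝ≥0∞, Measurable f →
      ∫⁻ z, f z.1 ∂((P.prod Q).withDensity fun z => ENNReal.ofReal (p z)) =
        ∫⁻ x, f x ∂P) := by
    intro f hf
    rw [h3 (fun z => f z.1) (hf.comp measurable_fst)]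
    refine lintegral_congr_ae ?_
    filter_upwards [h1] with x hx
    have hm2 : Measurable fun y => ENNReal.ofReal (p (x, y)) := hpm.comp measurable_prodMk_left
    rw [lintegral_mul_const _ hm2, hx, one_mul]
  refine ⟨⟨?_⟩, ?_, h3, h4⟩
  · have := h4 (fun _ => 1) measurable_const
    simpa using this
  · ext s hs
    rw [Measure.map_apply measurable_fst hs]
    have := h4 (s.indicator 1) (measurable_one.indicator hs)
    rw [lintegral_indicator_one hs] at this
    rw [← this, ← lintegral_indicator_one (measurable_fst hs)]
    rfl

lemma relEnt_density (P : Measure X) [IsProbabilityMeasure P] (Q : Measure Y)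
    [IsProbabilityMeasure Q] {p : X × Y → ℝ} (hp : Measurable p) (hp0 : ∀ z, 0 ≤ p z)
    {L : X × Y → ℝ} 
    (hpL : ∀ᵐ z ∂((P.prod Q).withDensity fun z => ENNReal.ofReal (p z)), Real.log (p z) = L z)
    (hL : Integrable L ((P.prod Q).withDensity fun z => ENNReal.ofReal (p z))) :
    relEnt ((P.prod Q).withDensity fun z => ENNReal.ofReal (p z)) (P.prod Q) =
      ENNReal.ofReal (∫ z, L z ∂((P.prod Q).withDensity fun z => ENNReal.ofReal (p z))) := by
  have hpm : Measurable fun z => ENNReal.ofReal (p z) := hp.ennreal_ofReal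
  set W := (P.prod Q).withDensity fun z => ENNReal.ofReal (p z) with hW
  have hac : W ≪ P.prod Q := withDensity_absolutelyContinuous _ _
  have hl : llr W (P.prod Q) =ᵐ[W] L := by
    have := hac.ae_le (Measure.rnDeriv_withDensity (P.prod Q) hpm)
    filter_upwards [this, hpL] with z hz hz2
    rw [llr_def]; dsimp only
    rw [hW, hz, ENNReal.toReal_ofReal (hp0 z), hz2]
  rw [relEnt, if_pos ⟨hac, hL.congr hl.symm⟩, integral_congr_ae hl]

/-- Partition function. -/
def dE (c : X × Y → ℝ) (Q : Measure Y) (l : ℝ) (x : X) : ℝ := ∫ y, Real.exp (-(l * c (x, y))) ∂Q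
/-- Minus log partition function. -/
def dpsi (c : X × Y → ℝ) (Q : Measure Y) (l : ℝ) (x : X) : ℝ := - Real.log (dE c Q l x)
/-- Tilted mean. -/
def dm (c : X × Y → ℝ) (Q : Measure Y) (l : ℝ) (x : X) : ℝ :=
  (∫ y, c (x, y) * Real.exp (-(l * c (x, y))) ∂Q) / dE c Q l x

variable {c : X × Y → ℝ} (hc : Measurable c) (hc0 : ∀ z, 0 ≤ c z)
  {P : Measure X} [IsProbabilityMeasure P] {Q : Measure Y} [IsProbabilityMeasure Q]

include hc hc0

lemma dint_exp {l : ℝ} (hl : 0 ≤ l) (x : X) :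
    Integrable (fun y => Real.exp (-(l * c (x, y)))) Q := by
  refine Integrable.of_bound (C := 1) ?_ (ae_of_all _ fun y => ?_)
  · exact (((hc.comp measurable_prodMk_left).const_mul l).neg.exp).aestronglyMeasurable
  · rw [Real.norm_eq_abs, abs_of_pos (Real.exp_pos _), Real.exp_le_one_iff]
    have := mul_nonneg hl (hc0 (x, y)); linarith

omit [IsProbabilityMeasure Q] hc in
lemma c_exp_le {l : ℝ} (hl : 0 < l) (z : X × Y) : c z * Real.exp (-(l * c z)) ≤ 1 / l := by
  rw [le_div_iff₀ hl]
  have h1 := Real.add_one_le_exp (l * c z)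
  rw [Real.exp_neg, mul_right_comm, ← div_eq_mul_inv, div_le_one (Real.exp_pos _)]
  linarith

lemma dint_cexp {l : ℝ} (hl : 0 < l) (x : X) :
    Integrable (fun y => c (x, y) * Real.exp (-(l * c (x, y)))) Q := by
  refine Integrable.of_bound (C := 1 / l) ?_ (ae_of_all _ fun y => ?_)
  · have h := (hc.comp (measurable_prodMk_left (x := x)))
    exact (h.mul ((h.const_mul l).neg.exp)).aestronglyMeasurable
  · rw [Real.norm_eq_abs, abs_of_nonneg (mul_nonneg (hc0 _) (Real.exp_pos _).le)]
    exact c_exp_le hc0 hl (x, y)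

lemma dE_pos {l : ℝ} (hl : 0 ≤ l) (x : X) : 0 < dE c Q l x :=
  integral_exp_pos (dint_exp hc hc0 hl x)

lemma dE_le_one {l : ℝ} (hl : 0 ≤ l) (x : X) : dE c Q l x ≤ 1 := by
  have := integral_mono (dint_exp (Q := Q) hc hc0 hl x) (integrable_const 1) (fun y => by
    show Real.exp _ ≤ 1
    rw [Real.exp_le_one_iff]
    have := mul_nonneg hl (hc0 (x, y)); linarith)
  simpa [dE] using this

lemma dpsi_nonneg {l : ℝ} (hl : 0 ≤ l) (x : X) : 0 ≤ dpsi c Q l x := by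
  rw [dpsi, Left.nonneg_neg_iff]
  exact Real.log_nonpos (dE_pos hc hc0 hl x).le (dE_le_one hc hc0 hl x)

lemma exp_dpsi {l : ℝ} (hl : 0 ≤ l) (x : X) : Real.exp (dpsi c Q l x) = (dE c Q l x)⁻¹ := by
  rw [dpsi, Real.exp_neg, Real.exp_log (dE_pos hc hc0 hl x)]

omit [IsProbabilityMeasure Q] hc in
lemma dm_nonneg (l : ℝ) (x : X) : 0 ≤ dm c Q l x := by
  refine div_nonneg (integral_nonneg fun y => mul_nonneg (hc0 _) (Real.exp_pos _).le)
    (integral_nonneg fun y => (Real.exp_pos _).le)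

omit hc0 in
lemma measurable_dE (l : ℝ) : Measurable (dE c Q l) := by
  have : Measurable fun z : X × Y => Real.exp (-(l * c z)) := (hc.const_mul l).neg.exp
  exact this.stronglyMeasurable.integral_prod_right'.measurable

omit hc0 in
lemma measurable_dpsi (l : ℝ) : Measurable (dpsi c Q l) := (measurable_dE hc l).log.neg

omit hc0 in
lemma measurable_dm (l : ℝ) : Measurable (dm c Q l) := by
  have : Measurable fun z : X × Y => c z * Real.exp (-(l * c z)) :=
    hc.mul (hc.const_mul l).neg.exp
  exact this.stronglyMeasurable.integral_prod_right'.measurable.div (measurable_dE hc l)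

/-- Gradient inequality. -/
lemma dpsi_le {l l' : ℝ} (hl : 0 < l) (hl' : 0 ≤ l') (x : X) :
    dpsi c Q l' x ≤ dpsi c Q l x + (l' - l) * dm c Q l x := by
  have hE := dE_pos (Q := Q) hc hc0 hl.le x
  have hE' := dE_pos (Q := Q) hc hc0 hl' x
  set m := dm c Q l x with hm
  have key : Real.exp (-((l' - l) * m)) * dE c Q l x ≤ dE c Q l' x := by
    have h1 : ∀ y, Real.exp (-((l' - l) * m)) * (Real.exp (-(l * c (x, y))) * (1 + (l' - l) * m)
        - (l' - l) * (c (x, y) * Real.exp (-(l * c (x, y))))) ≤ Real.exp (-(l' * c (x, y))) := by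
      intro y
      have e := Real.add_one_le_exp (-((l' - l) * (c (x, y) - m)))
      have e2 : Real.exp (-(l' * c (x, y))) = Real.exp (-((l' - l) * m)) *
          Real.exp (-(l * c (x, y))) * Real.exp (-((l' - l) * (c (x, y) - m))) := by
        rw [← Real.exp_add, ← Real.exp_add]; congr 1; ring
      rw [e2]
      have : 0 ≤ Real.exp (-((l' - l) * m)) * Real.exp (-(l * c (x, y))) := by positivity
      have := mul_le_mul_of_nonneg_left e this
      refine le_trans (le_of_eq ?_) this
      ring
    have i1 := dint_exp (Q := Q) hc hc0 hl.le x
    have i2 := dint_cexp (Q := Q) hc hc0 hl x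
    have := integral_mono ((((i1.mul_const (1 + (l' - l) * m)).sub
      (i2.const_mul (l' - l))).const_mul (Real.exp (-((l' - l) * m))))) (dint_exp (Q := Q) hc hc0 hl' x) h1
    simp only [Pi.sub_apply] at this
    rw [integral_const_mul, integral_sub (i1.mul_const _) (i2.const_mul _), integral_mul_const,
      integral_const_mul] at this
    have hnum : ∫ y, c (x, y) * Real.exp (-(l * c (x, y))) ∂Q = m * dE c Q l x := by
      rw [hm, dm, div_mul_cancel₀ _ hE.ne']
    rw [hnum] at this
    refine le_trans (le_of_eq ?_) this
    simp only [dE]; ring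
  have := Real.log_le_log (by positivity) key
  rw [Real.log_mul (Real.exp_pos _).ne' hE.ne', Real.log_exp] at this
  simp only [dpsi]; linarith

omit hc hc0 in
lemma dpsi_zero (x : X) : dpsi c Q 0 x = 0 := by simp [dpsi, dE]

lemma l_mul_dm_le {l : ℝ} (hl : 0 < l) (x : X) : l * dm c Q l x ≤ dpsi c Q l x := by
  have := dpsi_le (Q := Q) hc hc0 hl le_rfl x
  rw [dpsi_zero] at this; linarith

lemma dpsi_div_anti {l l' : ℝ} (hl : 0 < l) (hll : l ≤ l') (x : X) :
    dpsi c Q l' x / l' ≤ dpsi c Q l x / l := by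
  have h1 := dpsi_le (Q := Q) hc hc0 hl (hl.le.trans hll) x
  have h2 := l_mul_dm_le (Q := Q) hc hc0 hl x
  have hl'' : 0 < l' := hl.trans_le hll
  rw [div_le_div_iff₀ hl'' hl]
  nlinarith [mul_le_mul_of_nonneg_left h2 (sub_nonneg.2 hll)]

lemma continuousOn_dm (x : X) {l1 : ℝ} (hl1 : 0 < l1) :
    ContinuousOn (fun l => dm c Q l x) (Ici l1) := by
  have hcm : Measurable fun y => c (x, y) := hc.comp measurable_prodMk_left
  have hnum : ContinuousOn (fun l => ∫ y, c (x, y) * Real.exp (-(l * c (x, y))) ∂Q) (Ici l1) := by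
    refine continuousOn_of_dominated (bound := fun _ => 1 / l1) ?_ ?_ (integrable_const _) ?_
    · intro l _
      exact (hcm.mul ((hcm.const_mul l).neg.exp)).aestronglyMeasurable
    · intro l hl
      refine ae_of_all _ fun y => ?_
      rw [Real.norm_eq_abs, abs_of_nonneg (mul_nonneg (hc0 _) (Real.exp_pos _).le)]
      refine le_trans ?_ (c_exp_le hc0 hl1 (x, y))
      have := hc0 (x, y)
      have hl' : l1 ≤ l := hl
      gcongr
    · refine ae_of_all _ fun y => ?_
      fun_prop
  have hden : ContinuousOn (fun l => dE c Q l x) (Ici l1) := by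
    refine continuousOn_of_dominated (bound := fun _ => 1) ?_ ?_ (integrable_const _) ?_
    · intro l _
      exact (((hcm.const_mul l).neg.exp)).aestronglyMeasurable
    · intro l hl
      refine ae_of_all _ fun y => ?_
      rw [Real.norm_eq_abs, abs_of_pos (Real.exp_pos _), Real.exp_le_one_iff]
      have hl' : l1 ≤ l := hl
      have := mul_nonneg (hl1.le.trans hl') (hc0 (x, y)); linarith
    · refine ae_of_all _ fun y => ?_
      fun_prop
  refine hnum.div hden fun l hl => ?_
  have hl' : l1 ≤ l := hl
  exact (dE_pos hc hc0 (hl1.le.trans hl') x).ne'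

end dual

section dual2
variable {X Y : Type*} [MeasurableSpace X] [MeasurableSpace Y]
variable {c : X × Y → ℝ} (hc : Measurable c) (hc0 : ∀ z, 0 ≤ c z)
  {P : Measure X} [IsProbabilityMeasure P] {Q : Measure Y} [IsProbabilityMeasure Q]

include hc hc0

set_option maxHeartbeats 1000000 in
/-- The Gibbs coupling. -/
lemma gibbs {D : ℝ} (hD : 0 ≤ D) {l : ℝ} (hl : 0 < l) (hi : Integrable (dpsi c Q l) P)
    (hh : ∫ x, dm c Q l x ∂P ≤ D) :
    ⨅ W ∈ distSet c P D, relEnt W (P.prod Q) ≤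
      ENNReal.ofReal (∫ x, dpsi c Q l x ∂P - l * ∫ x, dm c Q l x ∂P) := by
  set p : X × Y → ℝ := fun z => Real.exp (-(l * c z)) * (dE c Q l z.1)⁻¹ with hp
  have hpm : Measurable p := (hc.const_mul l).neg.exp.mul ((measurable_dE hc l).comp measurable_fst).inv
  have hp0 : ∀ z, 0 < p z := fun z =>
    mul_pos (Real.exp_pos _) (inv_pos.2 (dE_pos hc hc0 hl.le _))
  have hone : ∀ x, ∫⁻ y, ENNReal.ofReal (p (x, y)) ∂Q = 1 := by
    intro x
    have hi1 : Integrable (fun y => p (x, y)) Q := (dint_exp hc hc0 hl.le x).mul_const (dE c Q l x)⁻¹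
    rw [← ofReal_integral_eq_lintegral_ofReal hi1 (ae_of_all _ fun y => (hp0 _).le)]
    simp only [hp]
    rw [integral_mul_const]
    have : (∫ y, Real.exp (-(l * c (x, y))) ∂Q) = dE c Q l x := rfl
    rw [this, mul_inv_cancel₀ (dE_pos hc hc0 hl.le _).ne', ENNReal.ofReal_one]
  obtain ⟨w1, w2, w3, w4⟩ := density_helper P Q hpm (ae_of_all _ hone)
  set W := (P.prod Q).withDensity fun z => ENNReal.ofReal (p z) with hW
  have hmi : Integrable (dm c Q l) P := by
    refine (hi.const_mul l⁻¹).mono' (measurable_dm hc l).aestronglyMeasurable (ae_of_all _ fun x => ?_)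
    rw [Real.norm_eq_abs, abs_of_nonneg (dm_nonneg hc0 l x), ← div_eq_inv_mul, le_div_iff₀ hl]
    have := l_mul_dm_le (Q := Q) hc hc0 hl x; linarith
  have hcW : ∫⁻ z, ENNReal.ofReal (c z) ∂W = ENNReal.ofReal (∫ x, dm c Q l x ∂P) := by
    rw [w3 _ hc.ennreal_ofReal, ofReal_integral_eq_lintegral_ofReal hmi
      (ae_of_all _ fun x => dm_nonneg hc0 l x)]
    refine lintegral_congr fun x => ?_
    rw [dm, div_eq_mul_inv, ← integral_mul_const, ofReal_integral_eq_lintegral_ofReal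
      ((dint_cexp hc hc0 hl x).mul_const _)]
    · refine lintegral_congr fun y => ?_
      rw [← ENNReal.ofReal_mul (hp0 _).le]
      congr 1; simp only [hp]; ring
    · exact ae_of_all _ fun y => mul_nonneg (mul_nonneg (hc0 _) (Real.exp_pos _).le)
        (inv_pos.2 (dE_pos hc hc0 hl.le _)).le
  have hcWi : Integrable c W := by
    refine ⟨hc.aestronglyMeasurable, ?_⟩
    rw [hasFiniteIntegral_iff_ofReal (ae_of_all _ hc0), hcW]; exact ENNReal.ofReal_lt_top
  have hcWint : ∫ z, c z ∂W = ∫ x, dm c Q l x ∂P := by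
    rw [integral_eq_lintegral_of_nonneg_ae (ae_of_all _ hc0) hc.aestronglyMeasurable, hcW,
      ENNReal.toReal_ofReal (integral_nonneg fun x => dm_nonneg hc0 l x)]
  have hmp : MeasurePreserving Prod.fst W P := ⟨measurable_fst, w2⟩
  have hpsiW : Integrable (fun z : X × Y => dpsi c Q l z.1) W :=
    hmp.integrable_comp_of_integrable hi
  have hpsiWint : ∫ z, dpsi c Q l z.1 ∂W = ∫ x, dpsi c Q l x ∂P := by
    rw [← w2, integral_map measurable_fst.aemeasurable]
    rw [w2]; exact (measurable_dpsi hc l).aestronglyMeasurable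
  have hre := relEnt_density P Q hpm (fun z => (hp0 z).le) (L := fun z => dpsi c Q l z.1 - l * c z)
    (ae_of_all _ fun z => by
      simp only [hp]
      rw [Real.log_mul (Real.exp_pos _).ne' (inv_pos.2 (dE_pos hc hc0 hl.le _)).ne', Real.log_exp,
        Real.log_inv, dpsi]; ring) (hpsiW.sub (hcWi.const_mul l))
  rw [integral_sub hpsiW (hcWi.const_mul l), integral_const_mul, hpsiWint, hcWint] at hre
  refine iInf₂_le_of_le W (distSet_of_le hD w1 w2 ?_) hre.le
  rw [hcW]; exact ENNReal.ofReal_le_ofReal hh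

set_option maxHeartbeats 1000000 in
/-- Strong duality. -/
theorem duality {D M : ℝ} (hyp : ∀ l : ℝ, 0 ≤ l → 0 ≤ M + l * D ∧
      ∫⁻ x, ENNReal.ofReal (dpsi c Q l x) ∂P ≤ ENNReal.ofReal (M + l * D)) :
    ⨅ W ∈ distSet c P D, relEnt W (P.prod Q) ≤ ENNReal.ofReal M := by
  have hM : 0 ≤ M := by simpa using (hyp 0 le_rfl).1
  have hD : 0 ≤ D := by
    by_contra h
    push Not at h
    have := (hyp ((M + 1) / (-D)) (by apply div_nonneg <;> linarith)).1
    have e : (M + 1) / (-D) * D = -(M+1) := by rw [div_neg, neg_mul, div_mul_cancel₀ _ h.ne]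
    linarith
  set g : ℝ → ℝ := fun l => ∫ x, dpsi c Q l x ∂P with hg
  set h : ℝ → ℝ := fun l => ∫ x, dm c Q l x ∂P with hh
  have hpi : ∀ l, 0 ≤ l → Integrable (dpsi c Q l) P := by
    intro l hl
    refine ⟨(measurable_dpsi hc l).aestronglyMeasurable, ?_⟩
    rw [hasFiniteIntegral_iff_ofReal (ae_of_all _ (dpsi_nonneg hc hc0 hl))]
    exact (hyp l hl).2.trans_lt ENNReal.ofReal_lt_top
  have hgle : ∀ l, 0 ≤ l → g l ≤ M + l * D := by
    intro l hl
    have := (hyp l hl).2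
    rw [← ofReal_integral_eq_lintegral_ofReal (hpi l hl) (ae_of_all _ (dpsi_nonneg hc hc0 hl))] at this
    exact (ENNReal.ofReal_le_ofReal_iff (hyp l hl).1).1 this
  have hmi : ∀ l, 0 < l → Integrable (dm c Q l) P := by
    intro l hl
    refine ((hpi l hl.le).const_mul l⁻¹).mono' (measurable_dm hc l).aestronglyMeasurable
      (ae_of_all _ fun x => ?_)
    rw [Real.norm_eq_abs, abs_of_nonneg (dm_nonneg hc0 l x), ← div_eq_inv_mul, le_div_iff₀ hl]
    have := l_mul_dm_le (Q := Q) hc hc0 hl x; linarith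
  -- the limit slope
  set f : ℕ → X → ℝ := fun n x => dpsi c Q (n + 1) x / (n + 1) with hf
  have hf0 : ∀ n x, 0 ≤ f n x := fun n x => div_nonneg (dpsi_nonneg hc hc0 (by positivity) x) (by positivity)
  have hfanti : ∀ x, Antitone fun n => f n x := by
    intro x n k hnk
    refine dpsi_div_anti hc hc0 (by positivity) ?_ x
    have : (n:ℝ) ≤ k := by exact_mod_cast hnk
    linarith
  set b : X → ℝ := fun x => ⨅ n, f n x with hb
  have hbdd : ∀ x, BddBelow (range fun n => f n x) := fun x => ⟨0, by rintro _ ⟨n, rfl⟩; exact hf0 n x⟩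
  have hblim : ∀ x, Tendsto (fun n => f n x) atTop (𝓝 (b x)) := fun x =>
    tendsto_atTop_ciInf (hfanti x) (hbdd x)
  have hb0 : ∀ x, 0 ≤ b x := fun x => le_ciInf fun n => hf0 n x
  have hfm : ∀ n, Measurable (f n) := fun n => (measurable_dpsi hc _).div_const _
  have hbm : Measurable b := Measurable.iInf hfm
  have hble : ∀ n x, b x ≤ f n x := fun n x => ciInf_le (hbdd x) n
  have hf0i : Integrable (f 0) P := by
    have := (hpi ((0:ℕ)+1) (by positivity)).div_const ((0:ℕ)+1)
    exact this
  have hflim : Tendsto (fun n => ∫ x, f n x ∂P) atTop (𝓝 (∫ x, b x ∂P)) := by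
    refine tendsto_integral_of_dominated_convergence (f 0) (fun n => (hfm n).aestronglyMeasurable)
      hf0i ?_ (ae_of_all _ hblim)
    intro n
    refine ae_of_all _ fun x => ?_
    rw [Real.norm_eq_abs, abs_of_nonneg (hf0 n x)]
    exact hfanti x (Nat.zero_le n)
  have hbi : Integrable b P := by
    refine hf0i.mono' hbm.aestronglyMeasurable (ae_of_all _ fun x => ?_)
    rw [Real.norm_eq_abs, abs_of_nonneg (hb0 x)]; exact hble 0 x
  have hfg : ∀ n : ℕ, ∫ x, f n x ∂P = g (n+1) / (n+1) := by
    intro n; simp only [hf, hg, integral_div]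
  have hbD : ∫ x, b x ∂P ≤ D := by
    have l1 : Tendsto (fun n : ℕ => M * (1 / ((n:ℝ) + 1)) + D) atTop (𝓝 (M * 0 + D)) :=
      (tendsto_one_div_add_atTop_nhds_zero_nat.const_mul M).add_const D
    rw [mul_zero, zero_add] at l1
    refine le_of_tendsto_of_tendsto' hflim l1 fun n => ?_
    rw [hfg, div_le_iff₀ (by positivity)]
    have := hgle (n+1) (by positivity)
    refine this.trans (le_of_eq ?_)
    field_simp
  rcases hbD.lt_or_eq with hlt | heq
  · -- interior case
    have hbar : ∃ l2 : ℝ, 0 < l2 ∧ h l2 ≤ D := by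
      have t1 : Tendsto (fun n : ℕ => 2 * ∫ x, f (2 * n + 1) x ∂P - ∫ x, f n x ∂P) atTop
          (𝓝 (2 * (∫ x, b x ∂P) - ∫ x, b x ∂P)) := by
        refine ((hflim.comp ?_).const_mul 2).sub hflim
        refine tendsto_atTop_mono (fun n => ?_) tendsto_id
        simp only [id]; omega
      have t2 : 2 * (∫ x, b x ∂P) - ∫ x, b x ∂P < D := by linarith
      obtain ⟨n, hn⟩ := (t1.eventually (gt_mem_nhds t2)).exists
      refine ⟨2 * (n + 1), by positivity, le_trans ?_ hn.le⟩
      have e : ∀ x, dm c Q (2 * (n+1)) x ≤ 2 * f (2 * n + 1) x - f n x := by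
        intro x
        have := dpsi_le (Q := Q) hc hc0 (l := 2 * ((n:ℝ)+1)) (l' := (n:ℝ)+1) (by positivity) (by positivity) x
        simp only [hf]
        push_cast
        have e1 : (2 * (n:ℝ) + 1 + 1) = 2 * (n+1) := by ring
        rw [e1]
        have hn1 : (0:ℝ) < n + 1 := by positivity
        have e2 : 2 * (dpsi c Q (2 * (n + 1)) x / (2 * ((n:ℝ) + 1))) - dpsi c Q (n + 1) x / (n + 1)
          = (dpsi c Q (2 * (n + 1)) x - dpsi c Q (n + 1) x) / (n+1) := by field_simp
        rw [e2, le_div_iff₀ hn1]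
        linarith
      have i1 : ∀ n, Integrable (f n) P := fun n => (hpi (n+1) (by positivity)).div_const _
      have := integral_mono (hmi (2 * (n+1)) (by positivity)) (((i1 (2*n+1)).const_mul 2).sub (i1 n)) e
      simp only [Pi.sub_apply] at this
      rwa [integral_sub ((i1 (2*n+1)).const_mul 2) (i1 n), integral_const_mul] at this
    obtain ⟨l2, hl2, hhl2⟩ := hbar
    refine ENNReal.le_of_forall_pos_le_add fun ε hε _ => ?_
    have hε' : (0:ℝ) < ε := hε
    set l1 : ℝ := min l2 (ε / (D + 1)) with hl1
    have hl1p : 0 < l1 := lt_min hl2 (by positivity)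
    have hl1D : l1 * D ≤ ε := by
      have : l1 ≤ ε / (D+1) := min_le_right _ _
      rw [le_div_iff₀ (by positivity)] at this
      nlinarith
    have hfin : ENNReal.ofReal (M + ε) = ENNReal.ofReal M + ε := by
      rw [ENNReal.ofReal_add hM hε'.le]; simp
    rw [← hfin]
    by_cases hc1 : h l1 ≤ D
    · refine (gibbs hc hc0 hD hl1p (hpi _ hl1p.le) hc1).trans (ENNReal.ofReal_le_ofReal ?_)
      have a1 := hgle l1 hl1p.le
      have a2 : 0 ≤ l1 * h l1 := mul_nonneg hl1p.le (integral_nonneg fun x => dm_nonneg hc0 _ _)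
      simp only [hg, hh] at a1 a2
      linarith
    · push Not at hc1
      have hcont : ContinuousOn h (Icc l1 l2) := by
        refine continuousOn_of_dominated (bound := fun x => dpsi c Q l1 x / l1) ?_ ?_
          ((hpi l1 hl1p.le).div_const _) ?_
        · intro l _; exact (measurable_dm hc l).aestronglyMeasurable
        · intro l hl
          refine ae_of_all _ fun x => ?_
          have hlp : 0 < l := hl1p.trans_le hl.1
          rw [Real.norm_eq_abs, abs_of_nonneg (dm_nonneg hc0 _ _)]
          refine le_trans ?_ (dpsi_div_anti hc hc0 hl1p hl.1 x)
          rw [le_div_iff₀ hlp]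
          have := l_mul_dm_le (Q := Q) hc hc0 hlp x; linarith
        · exact ae_of_all _ fun x => (continuousOn_dm hc hc0 x hl1p).mono Icc_subset_Ici_self
      obtain ⟨l, hl, hlD⟩ := intermediate_value_Icc' (min_le_left _ _) hcont ⟨hhl2, hc1.le⟩
      have hlp : 0 < l := hl1p.trans_le hl.1
      refine (gibbs hc hc0 hD hlp (hpi _ hlp.le) hlD.le).trans (ENNReal.ofReal_le_ofReal ?_)
      have a1 := hgle l hlp.le
      simp only [hg, hh] at a1 hlD
      rw [hlD]; linarith
  · -- boundary case
    have hnb : ∀ (n : ℕ) x, (n + 1) * b x ≤ dpsi c Q (n+1) x := by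
      intro n x
      have := hble n x
      simp only [hf] at this
      rw [le_div_iff₀ (by positivity)] at this; linarith
    -- tilted integrals
    set J : ℕ → X → ℝ := fun n x => ∫ y, Real.exp (-((n + 1) * (c (x, y) - b x))) ∂Q with hJ
    have hJi : ∀ (n : ℕ) x, Integrable (fun y => Real.exp (-(((n:ℝ) + 1) * (c (x, y) - b x)))) Q := by
      intro n x
      have := (dint_exp (Q := Q) hc hc0 (l := (n:ℝ)+1) (by positivity) x).const_mul (Real.exp ((n+1) * b x))
      refine this.congr (ae_of_all _ fun y => ?_)
      dsimp only
      rw [← Real.exp_add]; congr 1; ring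
    have hJE : ∀ n x, J n x = Real.exp ((n+1) * b x) * dE c Q (n+1) x := by
      intro n x
      simp only [hJ, dE]
      rw [← integral_const_mul]
      refine integral_congr_ae (ae_of_all _ fun y => ?_)
      dsimp only
      rw [← Real.exp_add]; congr 1; ring
    have hJlog : ∀ n x, - Real.log (J n x) = dpsi c Q (n+1) x - (n+1) * b x := by
      intro n x
      rw [hJE, Real.log_mul (Real.exp_pos _).ne' (dE_pos hc hc0 (by positivity) _).ne', Real.log_exp, dpsi]
      ring
    have hJpos : ∀ n x, 0 < J n x := fun n x => by
      rw [hJE]; exact mul_pos (Real.exp_pos _) (dE_pos hc hc0 (by positivity) _)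
    have hJ1 : ∀ n x, J n x ≤ 1 := by
      intro n x
      by_contra hcon
      push Not at hcon
      have := Real.log_pos hcon
      have h2 := hJlog n x
      have h3 := hnb n x
      linarith
    have hcb : ∀ x, ∀ᵐ y ∂Q, b x ≤ c (x, y) := by
      intro x
      have hcm : Measurable fun y => c (x, y) := hc.comp measurable_prodMk_left
      have : ∀ k : ℕ, ∀ᵐ y ∂Q, b x - 1 / (k + 1) ≤ c (x, y) := by
        intro k
        rw [ae_iff]
        by_contra hne
        set B := {y | ¬ b x - 1 / (k + 1) ≤ c (x, y)} with hB
        have hBm : MeasurableSet B := (measurableSet_le measurable_const hcm).compl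
        have hQB : 0 < Q.real B := by
          rw [measureReal_def]; exact ENNReal.toReal_pos hne (measure_ne_top _ _)
        have hle : ∀ n : ℕ, ((n:ℝ)+1) * (1 / (k+1)) * Q.real B ≤ 1 := by
          intro n
          refine le_trans ?_ (hJ1 n x)
          have : ∫ y, B.indicator (fun _ => ((n:ℝ)+1) * (1 / (k+1))) y ∂Q ≤ J n x := by
            refine integral_mono ((integrable_const _).indicator hBm) (hJi n x) fun y => ?_
            by_cases hy : y ∈ B
            · rw [indicator_of_mem hy]
              simp only [hB, mem_ofPred_eq, not_le] at hy
              have e := Real.add_one_le_exp (-(((n:ℝ) + 1) * (c (x, y) - b x)))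
              have : ((n:ℝ)+1) * (1 / (k+1)) ≤ ((n:ℝ)+1) * (b x - c (x, y)) := by
                gcongr; linarith
              dsimp only
              linarith
            · rw [indicator_of_notMem hy]; exact (Real.exp_pos _).le
          rw [integral_indicator_const _ hBm, smul_eq_mul] at this
          linarith
        have hd : 0 < (1 / ((k:ℝ)+1)) * Q.real B := by positivity
        obtain ⟨n, hn⟩ := exists_nat_gt (1 / ((1 / ((k:ℝ)+1)) * Q.real B))
        rw [div_lt_iff₀ hd] at hn
        have := hle n
        nlinarith
      filter_upwards [ae_all_iff.2 this] with y hy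
      refine le_of_tendsto' (x := atTop) (f := fun k : ℕ => b x - 1 / ((k:ℝ)+1)) ?_ hy
      have := (tendsto_one_div_add_atTop_nhds_zero_nat (𝕜 := ℝ)).const_sub (b x)
      simpa using this
    set A : Set (X × Y) := {z | c z = b z.1} with hA
    have hAm : MeasurableSet A := measurableSet_eq_fun hc (hbm.comp measurable_fst)
    set q : X → ℝ := fun x => ∫ y, A.indicator (fun _ => (1:ℝ)) (x, y) ∂Q with hq
    have hind : Measurable (A.indicator (fun _ => (1:ℝ))) := measurable_const.indicator hAm
    have hqm : Measurable q := hind.stronglyMeasurable.integral_prod_right'.measurable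
    have hq0 : ∀ x, 0 ≤ q x := fun x => integral_nonneg fun y => indicator_nonneg (fun _ _ => zero_le_one) _
    have hJq : ∀ x, Tendsto (fun n => J n x) atTop (𝓝 (q x)) := by
      intro x
      refine tendsto_integral_of_dominated_convergence (fun _ => 1) (fun n => (hJi n x).aestronglyMeasurable)
        (integrable_const _) ?_ ?_
      · intro n
        filter_upwards [hcb x] with y hy
        rw [Real.norm_eq_abs, abs_of_pos (Real.exp_pos _), Real.exp_le_one_iff]
        have : 0 ≤ ((n:ℝ)+1) * (c (x, y) - b x) := mul_nonneg (by positivity) (by linarith)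
        linarith
      · filter_upwards [hcb x] with y hy
        by_cases hy2 : (x, y) ∈ A
        · rw [indicator_of_mem hy2]
          have hy3 : c (x, y) = b x := hy2
          simp [hy3]
        · rw [indicator_of_notMem hy2]
          have hy3 : c (x, y) ≠ b x := hy2
          have hlt : 0 < c (x, y) - b x := by
            rcases hy.lt_or_eq with h' | h'
            · linarith
            · exact absurd h'.symm hy3
          refine Real.tendsto_exp_atBot.comp (tendsto_neg_atTop_atBot.comp ?_)
          exact (tendsto_atTop_add_const_right _ 1 tendsto_natCast_atTop_atTop).atTop_mul_const hlt
    have hfat := lintegral_liminf_le (μ := P) (u := atTop)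
      (f := fun n x => ENNReal.ofReal (- Real.log (J n x))) (fun n => by
        have : Measurable fun x => dpsi c Q ((n:ℝ)+1) x - (n+1) * b x :=
          (measurable_dpsi hc _).sub (hbm.const_mul _)
        simp only [hJlog]
        exact this.ennreal_ofReal)
    have hbound : ∀ n : ℕ, ∫⁻ x, ENNReal.ofReal (- Real.log (J n x)) ∂P ≤ ENNReal.ofReal M := by
      intro n
      simp only [hJlog]
      have i1 := hpi ((n:ℝ)+1) (by positivity)
      have i2 : Integrable (fun x => dpsi c Q ((n:ℝ)+1) x - (n+1) * b x) P := i1.sub (hbi.const_mul _)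
      rw [← ofReal_integral_eq_lintegral_ofReal i2
        (ae_of_all _ fun x => sub_nonneg.2 (hnb n x))]
      apply ENNReal.ofReal_le_ofReal
      rw [integral_sub i1 (hbi.const_mul _), integral_const_mul, heq]
      have := hgle ((n:ℝ)+1) (by positivity)
      simp only [hg] at this
      linarith
    have hfat2 : ∫⁻ x, liminf (fun n => ENNReal.ofReal (- Real.log (J n x))) atTop ∂P ≤ ENNReal.ofReal M := by
      refine hfat.trans ?_
      refine (liminf_le_liminf (Eventually.of_forall hbound)).trans ?_
      simp
    have hmeasL : Measurable fun x => liminf (fun n => ENNReal.ofReal (- Real.log (J n x))) atTop := by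
      refine Measurable.liminf fun n => ?_
      have : Measurable fun x => dpsi c Q ((n:ℝ)+1) x - (n+1) * b x :=
          (measurable_dpsi hc _).sub (hbm.const_mul _)
      simp only [hJlog]
      exact this.ennreal_ofReal
    have hqpos : ∀ᵐ x ∂P, 0 < q x := by
      filter_upwards [ae_lt_top hmeasL (hfat2.trans_lt ENNReal.ofReal_lt_top).ne] with x hx
      by_contra hcon
      have hq00 : q x = 0 := le_antisymm (not_lt.1 hcon) (hq0 x)
      have t1 : Tendsto (fun n => J n x) atTop (𝓝[>] 0) :=
        tendsto_nhdsWithin_iff.2 ⟨hq00 ▸ hJq x, Eventually.of_forall fun n => hJpos n x⟩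
      have t2 : Tendsto (fun n => ENNReal.ofReal (- Real.log (J n x))) atTop (𝓝 ∞) :=
        ENNReal.tendsto_ofReal_atTop.comp
          (tendsto_neg_atBot_atTop.comp (Real.tendsto_log_nhdsGT_zero.comp t1))
      rw [t2.liminf_eq] at hx
      exact lt_irrefl _ hx
    have hlogq : ∫⁻ x, ENNReal.ofReal (- Real.log (q x)) ∂P ≤ ENNReal.ofReal M := by
      refine le_trans (le_of_eq (lintegral_congr_ae ?_)) hfat2
      filter_upwards [hqpos] with x hx
      have : Tendsto (fun n => ENNReal.ofReal (- Real.log (J n x))) atTop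
          (𝓝 (ENNReal.ofReal (- Real.log (q x)))) :=
        ENNReal.tendsto_ofReal (((Real.continuousAt_log hx.ne').tendsto.comp (hJq x)).neg)
      exact this.liminf_eq.symm
    have hq1 : ∀ x, q x ≤ 1 := fun x => le_of_tendsto' (hJq x) fun n => hJ1 n x
    -- the coupling
    set p : X × Y → ℝ := fun z => A.indicator (fun _ => (1:ℝ)) z * (q z.1)⁻¹ with hp
    have hpm : Measurable p := hind.mul (hqm.comp measurable_fst).inv
    have hp0 : ∀ z, 0 ≤ p z := fun z =>
      mul_nonneg (indicator_nonneg (fun _ _ => zero_le_one) _) (inv_nonneg.2 (hq0 _))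
    have hindi : ∀ x, Integrable (fun y => A.indicator (fun _ => (1:ℝ)) (x, y)) Q := by
      intro x
      refine Integrable.of_bound (C := 1) (hind.comp measurable_prodMk_left).aestronglyMeasurable
        (ae_of_all _ fun y => ?_)
      by_cases hy : (x, y) ∈ A
      · rw [indicator_of_mem hy]; simp
      · rw [indicator_of_notMem hy]; simp
    have hone : ∀ᵐ x ∂P, ∫⁻ y, ENNReal.ofReal (p (x, y)) ∂Q = 1 := by
      filter_upwards [hqpos] with x hx
      have hi1 : Integrable (fun y => p (x, y)) Q := (hindi x).mul_const (q x)⁻¹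
      rw [← ofReal_integral_eq_lintegral_ofReal hi1 (ae_of_all _ fun y => hp0 (x, y))]
      simp only [hp]
      rw [integral_mul_const]
      have : (∫ y, A.indicator (fun _ => (1:ℝ)) (x, y) ∂Q) = q x := rfl
      rw [this, mul_inv_cancel₀ hx.ne', ENNReal.ofReal_one]
    obtain ⟨w1, w2, w3, w4⟩ := density_helper P Q hpm hone
    set W := (P.prod Q).withDensity fun z => ENNReal.ofReal (p z) with hW
    have hWA : ∀ᵐ z ∂W, z ∈ A := by
      rw [ae_iff]
      have : {z | z ∉ A} = Aᶜ := rfl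
      rw [this, hW, withDensity_apply _ hAm.compl, setLIntegral_eq_zero_iff hAm.compl hpm.ennreal_ofReal]
      refine ae_of_all _ fun z hz => ?_
      simp only [hp]
      rw [indicator_of_notMem hz]; simp
    have hcW : ∫⁻ z, ENNReal.ofReal (c z) ∂W ≤ ENNReal.ofReal D := by
      have e1 : ∫⁻ z, ENNReal.ofReal (c z) ∂W = ∫⁻ z, ENNReal.ofReal (b z.1) ∂W := by
        refine lintegral_congr_ae ?_
        filter_upwards [hWA] with z hz
        have : c z = b z.1 := hz
        rw [this]
      rw [e1, w4 (fun x => ENNReal.ofReal (b x)) hbm.ennreal_ofReal,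
        ← ofReal_integral_eq_lintegral_ofReal hbi (ae_of_all _ hb0), heq]
    have hlq0 : ∀ x, 0 ≤ - Real.log (q x) := fun x => by
      have := Real.log_nonpos (hq0 x) (hq1 x); linarith
    have hlqi : Integrable (fun x => - Real.log (q x)) P := by
      refine ⟨hqm.log.neg.aestronglyMeasurable, ?_⟩
      rw [hasFiniteIntegral_iff_ofReal (ae_of_all _ hlq0)]
      exact hlogq.trans_lt ENNReal.ofReal_lt_top
    have hmp : MeasurePreserving Prod.fst W P := ⟨measurable_fst, w2⟩
    have hLW : Integrable (fun z : X × Y => - Real.log (q z.1)) W :=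
      hmp.integrable_comp_of_integrable hlqi
    have hre := relEnt_density P Q hpm hp0 (L := fun z => - Real.log (q z.1)) (by
      filter_upwards [hWA] with z hz
      simp only [hp]
      rw [indicator_of_mem hz, one_mul, Real.log_inv]) hLW
    refine iInf₂_le_of_le W (distSet_of_le hD w1 w2 hcW) ?_
    rw [hre, ofReal_integral_eq_lintegral_ofReal hLW (ae_of_all _ fun z => hlq0 _),
      w4 (fun x => ENNReal.ofReal (- Real.log (q x))) hqm.log.neg.ennreal_ofReal]
    exact hlogq

end dual2

lemma shiftSeq_iter {α : Type*} (n : ℕ) (x : ℕ → α) : shiftSeq^[n] x = fun k => x (k + n) := by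
  induction n generalizing x with
  | zero => rfl
  | succ n ih =>
    rw [Function.iterate_succ_apply, ih]
    funext k
    show x (k + n + 1) = _
    congr 1

lemma measurable_shiftSeq {α : Type*} [MeasurableSpace α] :
    Measurable (shiftSeq : (ℕ → α) → ℕ → α) :=
  measurable_pi_lambda _ fun n => measurable_pi_apply (n + 1)

/-- Restriction to the first `n` coordinates. -/
def rst {α : Type*} (n : ℕ) (x : ℕ → α) : Fin n → α := fun k => x (k : ℕ)

lemma measurable_rst {α : Type*} [MeasurableSpace α] (n : ℕ) :
    Measurable (rst n : (ℕ → α) → Fin n → α) :=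
  measurable_pi_lambda _ fun k => measurable_pi_apply (k : ℕ)

lemma margN_eq {α : Type*} [MeasurableSpace α] (μ : Measure (ℕ → α)) (n : ℕ) :
    margN μ n = μ.map (rst n) := rfl

instance {α : Type*} [MeasurableSpace α] (μ : Measure (ℕ → α)) [IsProbabilityMeasure μ] (n : ℕ) :
    IsProbabilityMeasure (margN μ n) :=
  Measure.isProbabilityMeasure_map (measurable_rst n).aemeasurable

/-- Total distortion of the first `n` letters. -/
def sdist {S T : Type*} (ρ : S × T → ℝ) (n : ℕ) (x : ℕ → S) (y : ℕ → T) : ℝ :=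
  ∑ k ∈ Finset.range n, ρ (x k, y k)

/-- Total distortion on finite strings. -/
def fdist {S T : Type*} (ρ : S × T → ℝ) (n : ℕ) (x : Fin n → S) (y : Fin n → T) : ℝ :=
  ∑ k, ρ (x k, y k)

lemma fdist_rst {S T : Type*} (ρ : S × T → ℝ) (n : ℕ) (x : ℕ → S) (y : ℕ → T) :
    fdist ρ n (rst n x) (rst n y) = sdist ρ n x y := by
  simp only [fdist, sdist, rst]
  exact Fin.sum_univ_eq_sum_range (fun k => ρ (x k, y k)) n

lemma sdist_add {S T : Type*} (ρ : S × T → ℝ) (m n : ℕ) (x : ℕ → S) (y : ℕ → T) :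
    sdist ρ (m + n) x y = sdist ρ m x y + sdist ρ n (shiftSeq^[m] x) (shiftSeq^[m] y) := by
  simp only [sdist, shiftSeq_iter, Finset.sum_range_add]
  simp only [add_comm]

section low
variable {S T : Type*} [MeasurableSpace S] [MeasurableSpace T]
  {ρ : S × T → ℝ} {𝒬 : Measure (ℕ → T)} [IsProbabilityMeasure 𝒬] {C : ℝ}

lemma measurable_fdist (hρm : Measurable ρ) (n : ℕ) :
    Measurable fun z : (Fin n → S) × (Fin n → T) => fdist ρ n z.1 z.2 := by
  unfold fdist
  refine Finset.measurable_sum _ fun k _ => hρm.comp ?_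
  exact ((measurable_pi_apply k).comp measurable_fst).prodMk ((measurable_pi_apply k).comp measurable_snd)

lemma measurable_sdist (hρm : Measurable ρ) (n : ℕ) :
    Measurable fun z : (ℕ → S) × (ℕ → T) => sdist ρ n z.1 z.2 := by
  unfold sdist
  refine Finset.measurable_sum _ fun k _ => hρm.comp ?_
  exact ((measurable_pi_apply k).comp measurable_fst).prodMk ((measurable_pi_apply k).comp measurable_snd)

lemma measurable_sdist_right (hρm : Measurable ρ) (n : ℕ) (x : ℕ → S) :
    Measurable fun y : (ℕ → T) => sdist ρ n x y :=
  (measurable_sdist hρm n).comp measurable_prodMk_left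

lemma sdist_nonneg (hρ0 : ∀ z, 0 ≤ ρ z) (n : ℕ) (x : ℕ → S) (y : ℕ → T) : 0 ≤ sdist ρ n x y :=
  Finset.sum_nonneg fun _ _ => hρ0 _

/-- Probability of the (unnormalised) distortion ball. -/
def sQ (ρ : S × T → ℝ) (𝒬 : Measure (ℕ → T)) (x : ℕ → S) (n : ℕ) (t : ℝ) : ℝ≥0∞ :=
  𝒬 {y | sdist ρ n x y ≤ t}

omit [IsProbabilityMeasure 𝒬] in
lemma LnMem_eq (hρm : Measurable ρ) (D : ℝ) {n : ℕ} (hn : 1 ≤ n) (x : ℕ → S) :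
    LnMem ρ 𝒬 D n x = (n : ℝ≥0∞)⁻¹ * negLog (sQ ρ 𝒬 x n (n * D)) := by
  rw [LnMem, sQ, margN_eq, Measure.map_apply (measurable_rst n)]
  · congr 3
    ext y
    have hn0 : (0:ℝ) < n := by exact_mod_cast hn
    have : rhoFin ρ n (fun k => x k) (rst n y) = (n:ℝ)⁻¹ * sdist ρ n x y := by
      rw [← fdist_rst]; rfl
    simp only [mem_preimage, mem_ofPred_eq, this]
    rw [inv_mul_le_iff₀ hn0]
  · have h : Measurable fun y : Fin n → T => rhoFin ρ n (fun k => x k) y :=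
      ((measurable_fdist hρm n).comp (measurable_prodMk_left (x := (fun k => x k : Fin n → S)))).const_mul _
    exact measurableSet_le h measurable_const

omit [IsProbabilityMeasure 𝒬] in
lemma mix_rect (hQ : MeasurePreserving shiftSeq 𝒬 𝒬) (hmix : Mixing 𝒬 C) (n : ℕ)
    {A : Set (Fin n → T)} {B : Set (ℕ → T)} (hA : MeasurableSet A) (hB : MeasurableSet B) :
    (ENNReal.ofReal C)⁻¹ * (𝒬 (rst n ⁻¹' A) * 𝒬 B) ≤ 𝒬 (rst n ⁻¹' A ∩ shiftSeq^[n] ⁻¹' B) ∧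
      𝒬 (rst n ⁻¹' A ∩ shiftSeq^[n] ⁻¹' B) ≤ ENNReal.ofReal C * (𝒬 (rst n ⁻¹' A) * 𝒬 B) := by
  have h := hmix n (rst n ⁻¹' A) (shiftSeq^[n] ⁻¹' B) ⟨A, hA, rfl⟩
    ⟨B, hB, by rw [funext (shiftSeq_iter (α := T) n)]⟩
  rwa [(hQ.iterate n).measure_preimage hB.nullMeasurableSet] at h

lemma mix_upper (hQ : MeasurePreserving shiftSeq 𝒬 𝒬) (hmix : Mixing 𝒬 C) (n : ℕ)
    {f : (Fin n → T) → ℝ≥0∞} {g : (ℕ → T) → ℝ≥0∞} (hf : Measurable f) (hg : Measurable g)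
    : ∫⁻ y, f (rst n y) * g (shiftSeq^[n] y) ∂𝒬 ≤
      ENNReal.ofReal C * ((∫⁻ y, f (rst n y) ∂𝒬) * ∫⁻ y, g y ∂𝒬) := by
  have hθ := (hQ.iterate n).measurable
  have hr := measurable_rst (α := T) n
  have s1 : ∀ A : Set (Fin n → T), MeasurableSet A →
      ∫⁻ y in rst n ⁻¹' A, g (shiftSeq^[n] y) ∂𝒬 ≤ (ENNReal.ofReal C * ∫⁻ y, g y ∂𝒬) * 𝒬 (rst n ⁻¹' A) := by
    intro A hA
    have hle : (𝒬.restrict (rst n ⁻¹' A)).map (shiftSeq^[n]) ≤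
        (ENNReal.ofReal C * 𝒬 (rst n ⁻¹' A)) • 𝒬 := by
      refine Measure.le_iff.2 fun B hB => ?_
      rw [Measure.map_apply hθ hB, Measure.restrict_apply (hθ hB), inter_comm]
      refine (mix_rect hQ hmix n hA hB).2.trans (le_of_eq ?_)
      simp [mul_assoc]
    have := lintegral_mono' hle (le_refl g)
    rw [lintegral_map hg hθ, lintegral_smul_measure, smul_eq_mul] at this
    refine this.trans (le_of_eq ?_); ring
  have hle : (𝒬.withDensity fun y => g (shiftSeq^[n] y)).map (rst n) ≤
      (ENNReal.ofReal C * ∫⁻ y, g y ∂𝒬) • (𝒬.map (rst n)) := by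
    refine Measure.le_iff.2 fun A hA => ?_
    rw [Measure.map_apply hr hA, withDensity_apply _ (hr hA)]
    refine (s1 A hA).trans (le_of_eq ?_)
    simp [Measure.map_apply hr hA]
  have := lintegral_mono' hle (le_refl f)
  have hg2 : Measurable fun y => g (shiftSeq^[n] y) := hg.comp hθ
  have hf2 : Measurable fun y => f (rst n y) := hf.comp hr
  rw [lintegral_map hf hr, lintegral_smul_measure, smul_eq_mul, lintegral_map hf hr,
    lintegral_withDensity_eq_lintegral_mul _ hg2 hf2] at this
  refine le_trans (le_of_eq ?_) (this.trans (le_of_eq ?_))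
  · refine lintegral_congr fun y => ?_
    simp [mul_comm]
  · ring

/-- Laplace transform of the distortion. -/
def rE (ρ : S × T → ℝ) (𝒬 : Measure (ℕ → T)) (l : ℝ) (n : ℕ) (x : ℕ → S) : ℝ :=
  ∫ y, Real.exp (-(l * sdist ρ n x y)) ∂𝒬

lemma rE_int (hρm : Measurable ρ) (hρ0 : ∀ z, 0 ≤ ρ z) {l : ℝ} (hl : 0 ≤ l) (n : ℕ) (x : ℕ → S) :
    Integrable (fun y => Real.exp (-(l * sdist ρ n x y))) 𝒬 :=
  dint_exp (measurable_sdist hρm n) (fun z => sdist_nonneg hρ0 n z.1 z.2) hl x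

lemma rE_pos (hρm : Measurable ρ) (hρ0 : ∀ z, 0 ≤ ρ z) {l : ℝ} (hl : 0 ≤ l) (n : ℕ) (x : ℕ → S) :
    0 < rE ρ 𝒬 l n x :=
  dE_pos (measurable_sdist hρm n) (fun z => sdist_nonneg hρ0 n z.1 z.2) hl x

lemma ofReal_rE (hρm : Measurable ρ) (hρ0 : ∀ z, 0 ≤ ρ z) {l : ℝ} (hl : 0 ≤ l) (n : ℕ) (x : ℕ → S) :
    ENNReal.ofReal (rE ρ 𝒬 l n x) = ∫⁻ y, ENNReal.ofReal (Real.exp (-(l * sdist ρ n x y))) ∂𝒬 :=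
  ofReal_integral_eq_lintegral_ofReal (rE_int hρm hρ0 hl n x) (ae_of_all _ fun _ => (Real.exp_pos _).le)

lemma rE_add (hρm : Measurable ρ) (hρ0 : ∀ z, 0 ≤ ρ z) (hC : 1 ≤ C)
    (hQ : MeasurePreserving shiftSeq 𝒬 𝒬) (hmix : Mixing 𝒬 C)
    {l : ℝ} (hl : 0 ≤ l) (m n : ℕ) (x : ℕ → S) :
    rE ρ 𝒬 l (m + n) x ≤ C * (rE ρ 𝒬 l m x * rE ρ 𝒬 l n (shiftSeq^[m] x)) := by
  have p1 := rE_pos (𝒬 := 𝒬) hρm hρ0 hl m x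
  have p2 := rE_pos (𝒬 := 𝒬) hρm hρ0 hl n (shiftSeq^[m] x)
  rw [← ENNReal.ofReal_le_ofReal_iff (by positivity), ENNReal.ofReal_mul (by positivity),
    ENNReal.ofReal_mul p1.le, ofReal_rE hρm hρ0 hl, ofReal_rE hρm hρ0 hl, ofReal_rE hρm hρ0 hl]
  have h1 : Measurable fun y : Fin m → T => fdist ρ m (rst m x) y :=
    (measurable_fdist hρm m).comp measurable_prodMk_left
  have := mix_upper hQ hmix m
    (f := fun y => ENNReal.ofReal (Real.exp (-(l * fdist ρ m (rst m x) y))))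
    (g := fun y => ENNReal.ofReal (Real.exp (-(l * sdist ρ n (shiftSeq^[m] x) y))))
    (h1.const_mul l).neg.exp.ennreal_ofReal
    ((measurable_sdist_right hρm n _).const_mul l).neg.exp.ennreal_ofReal
  simp only [fdist_rst] at this
  refine le_trans (le_of_eq ?_) this
  refine lintegral_congr fun y => ?_
  rw [← ENNReal.ofReal_mul (Real.exp_pos _).le, ← Real.exp_add, sdist_add]
  congr 2; ring

lemma rE_shift (hρm : Measurable ρ) (hρ0 : ∀ z, 0 ≤ ρ z)
    (hQ : MeasurePreserving shiftSeq 𝒬 𝒬)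
    {l : ℝ} (hl : 0 ≤ l) (m n : ℕ) (x : ℕ → S) :
    rE ρ 𝒬 l (m + n) x ≤ rE ρ 𝒬 l n (shiftSeq^[m] x) := by
  have hθ := hQ.iterate m
  have e : rE ρ 𝒬 l n (shiftSeq^[m] x) =
      ∫ y, Real.exp (-(l * sdist ρ n (shiftSeq^[m] x) (shiftSeq^[m] y))) ∂𝒬 := by
    have hmm : Measurable fun y => Real.exp (-(l * sdist ρ n (shiftSeq^[m] x) y)) :=
      ((measurable_sdist_right hρm n _).const_mul l).neg.exp
    conv_lhs => rw [rE, ← hθ.map_eq]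
    rw [integral_map hθ.measurable.aemeasurable hmm.aestronglyMeasurable]
  rw [e]
  refine integral_mono (rE_int hρm hρ0 hl _ _) ?_ fun y => ?_
  · exact hθ.integrable_comp_of_integrable (rE_int hρm hρ0 hl _ _)
  · dsimp only
    rw [Real.exp_le_exp, sdist_add]
    have := mul_nonneg hl (sdist_nonneg hρ0 m x y)
    linarith

lemma rE_mono (hρm : Measurable ρ) (hρ0 : ∀ z, 0 ≤ ρ z)
    {l : ℝ} (hl : 0 ≤ l) {m n : ℕ} (hmn : m ≤ n) (x : ℕ → S) :
    rE ρ 𝒬 l n x ≤ rE ρ 𝒬 l m x := by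
  refine integral_mono (rE_int hρm hρ0 hl _ _) (rE_int hρm hρ0 hl _ _) fun y => ?_
  obtain ⟨k, rfl⟩ := Nat.exists_eq_add_of_le hmn
  dsimp only
  rw [Real.exp_le_exp, sdist_add]
  have := mul_nonneg hl (sdist_nonneg hρ0 k (shiftSeq^[m] x) (shiftSeq^[m] y))
  linarith

lemma rE_blocks (hρm : Measurable ρ) (hρ0 : ∀ z, 0 ≤ ρ z) (hC : 1 ≤ C)
    (hQ : MeasurePreserving shiftSeq 𝒬 𝒬) (hmix : Mixing 𝒬 C)
    {l : ℝ} (hl : 0 ≤ l) (m I : ℕ) : ∀ (x : ℕ → S),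
    (∑ i ∈ Finset.range I, - Real.log (rE ρ 𝒬 l m (shiftSeq^[i * m] x))) - I * Real.log C ≤
      - Real.log (rE ρ 𝒬 l (I * m) x) := by
  induction I with
  | zero => intro x; simp [rE, sdist]
  | succ I ih =>
    intro x
    have h1 := rE_add hρm hρ0 hC hQ hmix hl m (I * m) x
    have p0 := rE_pos (𝒬 := 𝒬) hρm hρ0 hl (m + I * m) x
    have p1 := rE_pos (𝒬 := 𝒬) hρm hρ0 hl m x
    have p2 := rE_pos (𝒬 := 𝒬) hρm hρ0 hl (I * m) (shiftSeq^[m] x)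
    have h2 := Real.log_le_log p0 h1
    rw [Real.log_mul (by positivity) (by positivity), Real.log_mul p1.ne' p2.ne'] at h2
    have h3 := ih (shiftSeq^[m] x)
    rw [Finset.sum_range_succ']
    have e : (I + 1) * m = m + I * m := by ring
    rw [e]
    simp only [← Function.iterate_add_apply] at h3
    have e2 : ∀ i, (i + 1) * m = i * m + m := fun i => by ring
    simp only [e2, zero_mul, Function.iterate_zero, id]
    push_cast
    linarith

lemma sum_blocks (f : ℕ → ℝ) (m I : ℕ) :
    ∑ j ∈ Finset.range m, ∑ i ∈ Finset.range I, f (i * m + j) = ∑ k ∈ Finset.range (I * m), f k := by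
  rw [Finset.sum_comm]
  induction I with
  | zero => simp
  | succ I ih => rw [Finset.sum_range_succ, ih, Nat.succ_mul, Finset.sum_range_add]

lemma rE_avg (hρm : Measurable ρ) (hρ0 : ∀ z, 0 ≤ ρ z) (hC : 1 ≤ C)
    (hQ : MeasurePreserving shiftSeq 𝒬 𝒬) (hmix : Mixing 𝒬 C)
    {l : ℝ} (hl : 0 ≤ l) (m I n : ℕ) (hn : (I + 1) * m ≤ n) (x : ℕ → S) :
    birkhoffSum shiftSeq (fun x => - Real.log (rE ρ 𝒬 l m x)) (I * m) x - m * (I * Real.log C) ≤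
      m * (- Real.log (rE ρ 𝒬 l n x)) := by
  have h : ∀ j ∈ Finset.range m,
      (∑ i ∈ Finset.range I, - Real.log (rE ρ 𝒬 l m (shiftSeq^[i * m + j] x))) - I * Real.log C ≤
      - Real.log (rE ρ 𝒬 l n x) := by
    intro j hj
    have h1 := rE_blocks hρm hρ0 hC hQ hmix hl m I (shiftSeq^[j] x)
    simp only [← Function.iterate_add_apply] at h1
    refine h1.trans ?_
    rw [neg_le_neg_iff]
    refine Real.log_le_log (rE_pos hρm hρ0 hl n x) ?_
    refine le_trans ?_ (rE_shift hρm hρ0 hQ hl j (I * m) x)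
    refine rE_mono hρm hρ0 hl ?_ x
    rw [Finset.mem_range] at hj
    have : (I + 1) * m = I * m + m := by ring
    omega
  have := Finset.sum_le_sum h
  rw [Finset.sum_sub_distrib, sum_blocks (fun k => - Real.log (rE ρ 𝒬 l m (shiftSeq^[k] x)))] at this
  simp only [Finset.sum_const, Finset.card_range, nsmul_eq_mul] at this
  exact this

lemma chernoff (hρm : Measurable ρ) (hρ0 : ∀ z, 0 ≤ ρ z)
    {l : ℝ} (hl : 0 ≤ l) (n : ℕ) (x : ℕ → S) (t : ℝ) :
    sQ ρ 𝒬 x n t ≤ ENNReal.ofReal (Real.exp (l * t) * rE ρ 𝒬 l n x) := by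
  have hme : Measurable fun y => ENNReal.ofReal (Real.exp (-(l * sdist ρ n x y))) :=
    ((measurable_sdist_right hρm n x).const_mul l).neg.exp.ennreal_ofReal
  rw [ENNReal.ofReal_mul (Real.exp_pos _).le, ofReal_rE hρm hρ0 hl, sQ,
    ← lintegral_const_mul _ hme]
  have hm : MeasurableSet {y | sdist ρ n x y ≤ t} :=
    measurableSet_le (measurable_sdist_right hρm n x) measurable_const
  rw [← lintegral_indicator_one hm]
  refine lintegral_mono fun y => ?_
  by_cases hy : y ∈ {y | sdist ρ n x y ≤ t}
  · rw [indicator_of_mem hy, ← ENNReal.ofReal_mul (Real.exp_pos _).le, ← Real.exp_add]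
    simp only [Pi.one_apply, ENNReal.one_le_ofReal, Real.one_le_exp_iff]
    have hy' : sdist ρ n x y ≤ t := hy
    have := mul_le_mul_of_nonneg_left hy' hl
    linarith
  · rw [indicator_of_notMem hy]; exact bot_le

lemma negLog_sq_ge (hρm : Measurable ρ) (hρ0 : ∀ z, 0 ≤ ρ z)
    {l : ℝ} (hl : 0 ≤ l) (n : ℕ) (x : ℕ → S) (t : ℝ) :
    ENNReal.ofReal (- (l * t) - Real.log (rE ρ 𝒬 l n x)) ≤ negLog (sQ ρ 𝒬 x n t) := by
  rw [negLog]
  split_ifs with h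
  · exact le_top
  · apply ENNReal.ofReal_le_ofReal
    have h1 := chernoff (𝒬 := 𝒬) hρm hρ0 hl n x t
    have hp := rE_pos (𝒬 := 𝒬) hρm hρ0 hl n x
    have h2 := ENNReal.toReal_mono ENNReal.ofReal_ne_top h1
    rw [ENNReal.toReal_ofReal (by positivity)] at h2
    have h3 : 0 < (sQ ρ 𝒬 x n t).toReal := ENNReal.toReal_pos h (measure_ne_top _ _)
    have h4 := Real.log_le_log h3 h2
    rw [Real.log_mul (Real.exp_pos _).ne' hp.ne', Real.log_exp] at h4
    linarith

lemma lower_a {Psrc : Measure (ℕ → S)} [IsProbabilityMeasure Psrc] (hErg : Ergodic shiftSeq Psrc)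
    (hρm : Measurable ρ) (hρ0 : ∀ z, 0 ≤ ρ z) (hC : 1 ≤ C)
    (hQ : MeasurePreserving shiftSeq 𝒬 𝒬) (hmix : Mixing 𝒬 C) (D : ℝ)
    {l : ℝ} (hl : 0 ≤ l) {m : ℕ} (hm : 1 ≤ m) (a : ℝ)
    (ha : ¬ (0 ≤ a ∧ ∫⁻ x, ENNReal.ofReal (- Real.log (rE ρ 𝒬 l m x)) ∂Psrc ≤ ENNReal.ofReal a)) :
    ∀ᵐ x ∂Psrc, ENNReal.ofReal (- (l * D) + (a - Real.log C) / m) ≤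
      liminf (fun n => LnMem ρ 𝒬 D n x) atTop := by
  have hφm : Measurable fun x => - Real.log (rE ρ 𝒬 l m x) :=
    measurable_dpsi (measurable_sdist hρm m) l
  have hφ0 : ∀ x, 0 ≤ - Real.log (rE ρ 𝒬 l m x) :=
    dpsi_nonneg (measurable_sdist hρm m) (fun z => sdist_nonneg hρ0 m z.1 z.2) hl
  filter_upwards [ae_eventually_birkhoffSum_ge hErg hφm hφ0 a ha] with x hx
  have hm0 : (0:ℝ) < m := by exact_mod_cast hm
  set v : ℕ → ℝ := fun n => - (l * D) + (((n / m - 1 : ℕ) : ℝ) / n) * (a - Real.log C) with hv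
  have hvlim : Tendsto v atTop (𝓝 (- (l * D) + (a - Real.log C) / m)) := by
    have h1 : Tendsto (fun n : ℕ => (((n / m - 1 : ℕ) : ℝ) / n)) atTop (𝓝 (1 / m)) := by
      have hu : Tendsto (fun n : ℕ => 1 / (m:ℝ)) atTop (𝓝 (1 / m)) := tendsto_const_nhds
      have hlo : Tendsto (fun n : ℕ => 1 / (m:ℝ) - 2 * (1 / (n:ℝ))) atTop (𝓝 (1 / m - 2 * 0)) :=
        (tendsto_one_div_atTop_nhds_zero_nat.const_mul 2).const_sub _
      rw [mul_zero, sub_zero] at hlo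
      refine tendsto_of_tendsto_of_tendsto_of_le_of_le' hlo hu ?_ ?_
      · filter_upwards [eventually_ge_atTop 1] with n hn
        have hn0 : (0:ℝ) < n := by exact_mod_cast hn
        rw [le_div_iff₀ hn0]
        have hd := Nat.lt_div_mul_add (a := n) (b := m) (by omega)
        have h3 : n / m ≤ (n / m - 1) + 1 := by omega
        have h4 : n < (n / m - 1 + 2) * m := by
          calc n < n / m * m + m := hd
            _ ≤ ((n / m - 1) + 1) * m + m := by gcongr
            _ = _ := by ring
        have h5 : (n:ℝ) < (((n / m - 1 : ℕ) : ℝ) + 2) * m := by exact_mod_cast h4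
        have h6 : (n:ℝ) / m < (((n / m - 1 : ℕ) : ℝ) + 2) := by rwa [div_lt_iff₀ hm0]
        have e : (1 / (m:ℝ) - 2 * (1 / n)) * n = n / m - 2 := by field_simp
        rw [e]; linarith
      · filter_upwards [eventually_ge_atTop 1] with n hn
        have hn0 : (0:ℝ) < n := by exact_mod_cast hn
        rw [div_le_div_iff₀ hn0 hm0]
        have h3 : (n / m - 1) * m ≤ n :=
          (Nat.mul_le_mul_right m (Nat.sub_le _ 1)).trans (Nat.div_mul_le_self n m)
        have h4 : (((n / m - 1 : ℕ) : ℝ)) * m ≤ n := by exact_mod_cast h3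
        linarith
    have := (h1.mul_const (a - Real.log C)).const_add (- (l * D))
    rw [one_div_mul_eq_div] at this
    exact this
  have hle : ∀ᶠ n : ℕ in atTop, ENNReal.ofReal (v n) ≤ LnMem ρ 𝒬 D n x := by
    have ht : Tendsto (fun n : ℕ => (n / m - 1) * m) atTop atTop := by
      refine Tendsto.atTop_mul_const' (by omega) ?_
      exact (tendsto_sub_atTop_nat 1).comp (Nat.tendsto_div_const_atTop (by omega))
    filter_upwards [ht.eventually hx, eventually_ge_atTop m] with n hn hnm
    have hn1 : 1 ≤ n := hm.trans hnm
    have hn0 : (0:ℝ) < n := by exact_mod_cast hn1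
    have h1 : 1 ≤ n / m := (Nat.one_le_div_iff (by omega)).2 hnm
    set I := n / m - 1 with hI
    have hIn : (I + 1) * m ≤ n := by
      have : I + 1 = n / m := by omega
      rw [this]; exact Nat.div_mul_le_self n m
    have h2 := rE_avg hρm hρ0 hC hQ hmix hl m I n hIn x
    have h3 : I * (a - Real.log C) ≤ - Real.log (rE ρ 𝒬 l n x) := by
      push_cast at hn
      have : m * (I * (a - Real.log C)) ≤ m * (- Real.log (rE ρ 𝒬 l n x)) := by
        refine le_trans ?_ h2
        linarith
      exact le_of_mul_le_mul_left this hm0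
    have h4 := negLog_sq_ge (𝒬 := 𝒬) hρm hρ0 hl n x (n * D)
    rw [LnMem_eq hρm D hn1]
    have e : v n = (n:ℝ)⁻¹ * (- (l * (n * D)) + I * (a - Real.log C)) := by
      simp only [hv, ← hI]; field_simp
    rw [e, ENNReal.ofReal_mul (by positivity), ENNReal.ofReal_inv_of_pos hn0, ENNReal.ofReal_natCast]
    gcongr
    refine le_trans (ENNReal.ofReal_le_ofReal ?_) h4
    linarith
  rw [← (ENNReal.tendsto_ofReal hvlim).liminf_eq]
  exact liminf_le_liminf hle

/-- Lower bound from a finite block. -/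
theorem lower_bound {Psrc : Measure (ℕ → S)} [IsProbabilityMeasure Psrc] (hErg : Ergodic shiftSeq Psrc)
    (hρm : Measurable ρ) (hρ0 : ∀ z, 0 ≤ ρ z) (hC : 1 ≤ C)
    (hQ : MeasurePreserving shiftSeq 𝒬 𝒬) (hmix : Mixing 𝒬 C) (D : ℝ)
    {m : ℕ} (hm : 1 ≤ m) (M : ℝ)
    (hM : ENNReal.ofReal M < ⨅ W ∈ distSetN ρ m (margN Psrc m) D,
      relEnt W ((margN Psrc m).prod (margN 𝒬 m))) :
    ∀ᵐ x ∂Psrc, ENNReal.ofReal ((M - Real.log C) / m) ≤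
      liminf (fun n => LnMem ρ 𝒬 D n x) atTop := by
  have hm0 : (0:ℝ) < m := by exact_mod_cast hm
  have hcm : Measurable fun z : (Fin m → S) × (Fin m → T) => rhoFin ρ m z.1 z.2 :=
    (measurable_fdist hρm m).const_mul _
  have hc0 : ∀ z : (Fin m → S) × (Fin m → T), 0 ≤ rhoFin ρ m z.1 z.2 := fun z =>
    mul_nonneg (by positivity) (Finset.sum_nonneg fun _ _ => hρ0 _)
  have hnot : ¬ ∀ l : ℝ, 0 ≤ l → 0 ≤ M + l * D ∧
      ∫⁻ x, ENNReal.ofReal (dpsi (fun z : (Fin m → S) × (Fin m → T) => rhoFin ρ m z.1 z.2)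
        (margN 𝒬 m) l x) ∂(margN Psrc m) ≤ ENNReal.ofReal (M + l * D) := by
    intro hyp
    exact absurd (duality hcm hc0 hyp) (not_le.2 hM)
  push Not at hnot
  obtain ⟨l, hl, hl2⟩ := hnot
  have hφ : ∀ x : ℕ → S, dpsi (fun z : (Fin m → S) × (Fin m → T) => rhoFin ρ m z.1 z.2)
        (margN 𝒬 m) l (rst m x) = - Real.log (rE ρ 𝒬 (l / m) m x) := by
    intro x
    rw [dpsi, dE, rE, margN_eq, integral_map (measurable_rst m).aemeasurable]
    · congr 3
      funext y
      have : rhoFin ρ m (rst m x) (rst m y) = (m:ℝ)⁻¹ * sdist ρ m x y := by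
        rw [← fdist_rst]; rfl
      rw [this]; congr 2; field_simp
    · exact ((hcm.comp measurable_prodMk_left).const_mul l).neg.exp.aestronglyMeasurable
  have hIntg : ∫⁻ x, ENNReal.ofReal (dpsi (fun z : (Fin m → S) × (Fin m → T) => rhoFin ρ m z.1 z.2)
        (margN 𝒬 m) l x) ∂(margN Psrc m) =
        ∫⁻ x, ENNReal.ofReal (- Real.log (rE ρ 𝒬 (l / m) m x)) ∂Psrc := by
    rw [margN_eq Psrc, lintegral_map (measurable_dpsi hcm l).ennreal_ofReal (measurable_rst m)]
    simp only [hφ]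
  rw [hIntg] at hl2
  have := lower_a hErg hρm hρ0 hC hQ hmix D (l := l / m) (by positivity) hm (M + l * D) (by
    rintro ⟨h1, h2⟩
    exact absurd h2 (not_le.2 (hl2 h1)))
  filter_upwards [this] with x hx
  refine le_trans (le_of_eq ?_) hx
  congr 1
  field_simp; ring

end low

section skew
variable {U : Type*} [MeasurableSpace U] (ν : Measure U) [IsProbabilityMeasure ν]

lemma eq_infinitePi_range {μ : Measure (ℕ → U)}
    (h : ∀ (N : ℕ) (t : ℕ → Set U), (∀ i, MeasurableSet (t i)) →
      μ {u | ∀ i < N, u i ∈ t i} = ∏ i ∈ Finset.range N, ν (t i)) :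
    μ = Measure.infinitePi (fun _ : ℕ => ν) := by
  refine Measure.eq_infinitePi (fun _ : ℕ => ν) fun s t ht => ?_
  obtain ⟨N, hN⟩ := s.exists_nat_subset_range
  have h1 := h N (fun i => if i ∈ s then t i else univ) (fun i => by
    by_cases hi : i ∈ s
    · simpa [hi] using ht i
    · simp [hi])
  have e1 : {u : ℕ → U | ∀ i < N, u i ∈ (if i ∈ s then t i else univ)} = Set.pi s t := by
    ext u
    simp only [mem_ofPred_eq, Set.mem_pi, Finset.mem_coe]
    constructor
    · intro hu i hi
      have := hu i (Finset.mem_range.1 (hN hi))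
      simpa [hi] using this
    · intro hu i _
      by_cases hi : i ∈ s
      · simpa [hi] using hu i hi
      · simp [hi]
  rw [e1] at h1
  rw [h1, ← Finset.prod_subset hN]
  · exact Finset.prod_congr rfl fun i hi => by simp [hi]
  · intro i _ hi
    simp [hi]

/-- Put a letter in front of a sequence. -/
def ccons {U : Type*} (p : U × (ℕ → U)) : ℕ → U
  | 0 => p.1
  | n + 1 => p.2 n

lemma measurable_ccons : Measurable (ccons : U × (ℕ → U) → ℕ → U) := by
  refine measurable_pi_lambda _ fun n => ?_
  cases n with
  | zero => exact measurable_fst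
  | succ n => exact (measurable_pi_apply n).comp measurable_snd

lemma pi_range_apply (N : ℕ) (t : ℕ → Set U) (ht : ∀ i, MeasurableSet (t i)) :
    Measure.infinitePi (fun _ : ℕ => ν) {u | ∀ i < N, u i ∈ t i} = ∏ i ∈ Finset.range N, ν (t i) := by
  rw [← Measure.infinitePi_pi (fun _ : ℕ => ν) (fun i _ => ht i)]
  congr 1
  ext u; simp

lemma measurableSet_cyl (N : ℕ) (t : ℕ → Set U) (ht : ∀ i, MeasurableSet (t i)) :
    MeasurableSet {u : ℕ → U | ∀ i < N, u i ∈ t i} := by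
  have : {u : ℕ → U | ∀ i < N, u i ∈ t i} = ⋂ i ∈ Finset.range N, (fun u => u i) ⁻¹' (t i) := by
    ext u; simp
  rw [this]
  exact Finset.measurableSet_biInter _ fun i _ => measurable_pi_apply i (ht i)

lemma map_ccons : (ν.prod (Measure.infinitePi (fun _ : ℕ => ν))).map ccons =
    Measure.infinitePi (fun _ : ℕ => ν) := by
  refine eq_infinitePi_range ν fun N t ht => ?_
  rw [Measure.map_apply measurable_ccons (measurableSet_cyl N t ht)]
  cases N with
  | zero => simp
  | succ N =>
    have e : ccons ⁻¹' {u : ℕ → U | ∀ i < N + 1, u i ∈ t i} =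
        t 0 ×ˢ {u : ℕ → U | ∀ i < N, u i ∈ t (i + 1)} := by
      ext ⟨w, u⟩
      simp only [mem_preimage, mem_ofPred_eq, Set.mem_prod]
      constructor
      · intro h
        exact ⟨h 0 (by omega), fun i hi => h (i + 1) (by omega)⟩
      · rintro ⟨h0, h1⟩ i hi
        cases i with
        | zero => exact h0
        | succ i => exact h1 i (by omega)
    rw [e, Measure.prod_prod, pi_range_apply ν N (fun i => t (i + 1)) (fun i => ht _),
      Finset.prod_range_succ', mul_comm]

lemma lintegral_cons {h : U × (ℕ → U) → ℝ≥0∞} (hh : Measurable h) :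
    ∫⁻ u, h (u 0, shiftSeq u) ∂(Measure.infinitePi (fun _ : ℕ => ν)) =
      ∫⁻ w, ∫⁻ u, h (w, u) ∂(Measure.infinitePi (fun _ : ℕ => ν)) ∂ν := by
  have hm : Measurable fun u : ℕ → U => h (u 0, shiftSeq u) :=
    hh.comp ((measurable_pi_apply 0).prodMk measurable_shiftSeq)
  conv_lhs => rw [← map_ccons ν]
  rw [lintegral_map hm measurable_ccons, ← lintegral_prod _ hh.aemeasurable]
  rfl

variable {X : Type*} [MeasurableSpace X] {P : Measure X} [IsProbabilityMeasure P] {θ : X → X}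
  {len : U → ℕ}

lemma measurable_iter (hθ : Measurable θ) (hlen : Measurable len) :
    Measurable fun p : X × U => θ^[len p.2] p.1 := by
  have h : Measurable fun p : X × ℕ => θ^[p.2] p.1 :=
    measurable_from_prod_countable_left fun n => hθ.iterate n
  exact h.comp (measurable_fst.prodMk (hlen.comp measurable_snd))

/-- The skew product map. -/
def skew (θ : X → X) (len : U → ℕ) (p : X × (ℕ → U)) : X × (ℕ → U) :=
  (θ^[len (p.2 0)] p.1, shiftSeq p.2)

omit [MeasurableSpace U] [MeasurableSpace X] in
lemma skew_def (θ : X → X) (len : U → ℕ) (x : X) (u : ℕ → U) :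
    skew θ len (x, u) = (θ^[len (u 0)] x, shiftSeq u) := rfl

lemma measurable_skew (hθ : Measurable θ) (hlen : Measurable len) : Measurable (skew θ len) := by
  refine Measurable.prodMk ?_ (measurable_shiftSeq.comp measurable_snd)
  exact (measurable_iter hθ hlen).comp
    (measurable_fst.prodMk ((measurable_pi_apply 0).comp measurable_snd))

lemma skew_mp (hθ : MeasurePreserving θ P P) (hlen : Measurable len) :
    MeasurePreserving (skew θ len) (P.prod (Measure.infinitePi (fun _ : ℕ => ν)))
      (P.prod (Measure.infinitePi (fun _ : ℕ => ν))) := by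
  set η := Measure.infinitePi (fun _ : ℕ => ν)
  have hm := measurable_skew hθ.measurable hlen
  refine ⟨hm, ?_⟩
  refine Measure.ext_of_lintegral _ fun f hf => ?_
  have hfm : Measurable fun p => f (skew θ len p) := hf.comp hm
  rw [lintegral_map hf hm, lintegral_prod _ hfm.aemeasurable, lintegral_prod _ hf.aemeasurable]
  have hg : Measurable fun x => ∫⁻ u, f (x, u) ∂η := hf.lintegral_prod_right'
  have e1 : ∀ x, ∫⁻ u, f (skew θ len (x, u)) ∂η = ∫⁻ w, ∫⁻ u, f (θ^[len w] x, u) ∂η ∂ν := by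
    intro x
    have hh : Measurable fun q : U × (ℕ → U) => f (θ^[len q.1] x, q.2) := by
      refine hf.comp (Measurable.prodMk ?_ measurable_snd)
      exact (measurable_iter hθ.measurable hlen).comp (measurable_const.prodMk measurable_fst)
    exact lintegral_cons ν hh
  simp_rw [e1]
  have hm2 : Measurable fun p : X × U => ∫⁻ u, f (θ^[len p.2] p.1, u) ∂η :=
    hg.comp (measurable_iter hθ.measurable hlen)
  rw [lintegral_lintegral_swap hm2.aemeasurable]
  have e2 : ∀ w, ∫⁻ x, ∫⁻ u, f (θ^[len w] x, u) ∂η ∂P = ∫⁻ x, ∫⁻ u, f (x, u) ∂η ∂P := fun w =>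
    (hθ.iterate (len w)).lintegral_comp hg
  simp_rw [e2]
  simp

lemma skew_sec (hθ : Measurable θ) (hlen : Measurable len) {A : Set (X × (ℕ → U))}
    (hA : MeasurableSet A) (hinv : skew θ len ⁻¹' A = A) {c : ℝ≥0∞} (N : ℕ) :
    ∀ (x : X), (∀ k, Measure.infinitePi (fun _ : ℕ => ν) (Prod.mk (θ^[k] x) ⁻¹' A) = c) →
      ∀ t : ℕ → Set U, (∀ i, MeasurableSet (t i)) →
      Measure.infinitePi (fun _ : ℕ => ν) ((Prod.mk x ⁻¹' A) ∩ {u | ∀ i < N, u i ∈ t i}) =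
        c * ∏ i ∈ Finset.range N, ν (t i) := by
  set η := Measure.infinitePi (fun _ : ℕ => ν)
  induction N with
  | zero => intro x hx t ht; simpa using hx 0
  | succ N ih =>
    intro x hx t ht
    have hB : MeasurableSet {q : U × (ℕ → U) | q.1 ∈ t 0 ∧ (θ^[len q.1] x, q.2) ∈ A ∧
        ∀ i < N, q.2 i ∈ t (i + 1)} := by
      refine (measurable_fst (ht 0)).inter (MeasurableSet.inter ?_ ?_)
      · refine Measurable.prodMk ?_ measurable_snd hA
        exact (measurable_iter hθ hlen).comp (measurable_const.prodMk measurable_fst)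
      · exact measurable_snd (measurableSet_cyl N (fun i => t (i + 1)) fun i => ht _)
    set B := {q : U × (ℕ → U) | q.1 ∈ t 0 ∧ (θ^[len q.1] x, q.2) ∈ A ∧
        ∀ i < N, q.2 i ∈ t (i + 1)} with hBdef
    have e1 : (Prod.mk x ⁻¹' A) ∩ {u | ∀ i < N + 1, u i ∈ t i} =
        (fun u : ℕ → U => (u 0, shiftSeq u)) ⁻¹' B := by
      ext u
      have hiff : (x, u) ∈ A ↔ (θ^[len (u 0)] x, shiftSeq u) ∈ A := by
        rw [← skew_def]; exact (Set.ext_iff.1 hinv (x, u)).symm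
      simp only [mem_inter_iff, mem_preimage, mem_ofPred_eq, hBdef, hiff]
      constructor
      · rintro ⟨h1, h2⟩
        exact ⟨h2 0 (by omega), h1, fun i hi => h2 (i + 1) (by omega)⟩
      · rintro ⟨h0, h1, h2⟩
        refine ⟨h1, fun i hi => ?_⟩
        cases i with
        | zero => exact h0
        | succ i => exact h2 i (by omega)
    have hpm : Measurable fun u : ℕ → U => (u 0, shiftSeq u) :=
      (measurable_pi_apply 0).prodMk measurable_shiftSeq
    rw [e1, ← lintegral_indicator_one (hpm hB)]
    have e2 := lintegral_cons ν (measurable_one.indicator hB : Measurable (B.indicator (1 : U × (ℕ → U) → ℝ≥0∞)))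
    have e3 : ∀ w, ∫⁻ u, B.indicator (1 : U × (ℕ → U) → ℝ≥0∞) (w, u) ∂η =
        (t 0).indicator (fun _ => c * ∏ i ∈ Finset.range N, ν (t (i + 1))) w := by
      intro w
      by_cases hw : w ∈ t 0
      · rw [indicator_of_mem hw]
        rw [← ih (θ^[len w] x) (fun k => by rw [← Function.iterate_add_apply]; exact hx _)
          (fun i => t (i + 1)) (fun i => ht _), ← lintegral_indicator_one]
        · refine lintegral_congr fun u => ?_
          by_cases hu : u ∈ (Prod.mk (θ^[len w] x) ⁻¹' A) ∩ {u | ∀ i < N, u i ∈ t (i + 1)}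
          · rw [indicator_of_mem hu, indicator_of_mem]; rfl
            exact ⟨hw, hu.1, hu.2⟩
          · rw [indicator_of_notMem hu, indicator_of_notMem]
            exact fun h => hu ⟨h.2.1, h.2.2⟩
        · exact (measurable_prodMk_left hA).inter (measurableSet_cyl N (fun i => t (i + 1)) fun i => ht _)
      · rw [indicator_of_notMem hw]
        have : ∀ u, B.indicator (1 : U × (ℕ → U) → ℝ≥0∞) (w, u) = 0 := fun u =>
          indicator_of_notMem (fun h => hw h.1) _
        simp [this]
    rw [lintegral_congr e3] at e2
    rw [lintegral_indicator (ht 0), lintegral_const, Measure.restrict_apply_univ] at e2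
    rw [Finset.prod_range_succ', ← mul_assoc, ← e2]
    rfl

lemma skew_ergodic (hθ : Ergodic θ P) (hlen : Measurable len) (h1 : ν {w | len w = 1} ≠ 0) :
    Ergodic (skew θ len) (P.prod (Measure.infinitePi (fun _ : ℕ => ν))) := by
  have hmp := skew_mp ν hθ.toMeasurePreserving hlen
  set η := Measure.infinitePi (fun _ : ℕ => ν) with hη
  refine { hmp with aeconst_set := ?_ }
  intro A hA hinv
  have hsecm : ∀ x, MeasurableSet (Prod.mk x ⁻¹' A) := fun x => measurable_prodMk_left hA
  have ham : Measurable fun x => η (Prod.mk x ⁻¹' A) := measurable_measure_prodMk_left hA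
  have hit := measurable_iter hθ.measurable hlen
  -- averaging
  have havg : ∀ x, ∫⁻ w, η (Prod.mk (θ^[len w] x) ⁻¹' A) ∂ν = η (Prod.mk x ⁻¹' A) := by
    intro x
    have hB : MeasurableSet {q : U × (ℕ → U) | (θ^[len q.1] x, q.2) ∈ A} := by
      refine Measurable.prodMk ?_ measurable_snd hA
      exact (measurable_iter hθ.measurable hlen).comp (measurable_const.prodMk measurable_fst)
    have e2 := lintegral_cons ν (measurable_one.indicator hB :
      Measurable (Set.indicator {q : U × (ℕ → U) | (θ^[len q.1] x, q.2) ∈ A} (1 : U × (ℕ → U) → ℝ≥0∞)))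
    rw [← lintegral_indicator_one (hsecm x)]
    have e3 : ∀ u, (Prod.mk x ⁻¹' A).indicator (1 : (ℕ → U) → ℝ≥0∞) u =
        Set.indicator {q : U × (ℕ → U) | (θ^[len q.1] x, q.2) ∈ A} (1 : U × (ℕ → U) → ℝ≥0∞) (u 0, shiftSeq u) := by
      intro u
      have hiff : (x, u) ∈ A ↔ (θ^[len (u 0)] x, shiftSeq u) ∈ A := by
        rw [← skew_def]; exact (Set.ext_iff.1 hinv (x, u)).symm
      by_cases hu : (x, u) ∈ A
      · rw [indicator_of_mem (show u ∈ Prod.mk x ⁻¹' A from hu), indicator_of_mem]; rfl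
        exact hiff.1 hu
      · rw [indicator_of_notMem (show u ∉ Prod.mk x ⁻¹' A from hu), indicator_of_notMem]
        exact fun h => hu (hiff.2 h)
    rw [lintegral_congr e3, e2]
    refine lintegral_congr fun w => ?_
    rw [← lintegral_indicator_one (hsecm _)]
    rfl
  set a : X → ℝ := fun x => (η (Prod.mk x ⁻¹' A)).toReal with ha
  have ham' : Measurable a := ham.ennreal_toReal
  have ha01 : ∀ x, |a x| ≤ 1 := fun x => by
    rw [abs_of_nonneg ENNReal.toReal_nonneg]
    exact ENNReal.toReal_le_of_le_ofReal zero_le_one (by simpa using prob_le_one)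
  have havg' : ∀ x, ∫ w, a (θ^[len w] x) ∂ν = a x := by
    intro x
    have hm : Measurable fun w => η (Prod.mk (θ^[len w] x) ⁻¹' A) :=
      ham.comp (hit.comp (measurable_prodMk_left (x := x)))
    simp only [ha]
    rw [integral_toReal hm.aemeasurable (ae_of_all _ fun w => measure_lt_top _ _), havg]
  set b : X × U → ℝ := fun p => a (θ^[len p.2] p.1) with hb
  have hbm : Measurable b := ham'.comp hit
  have hb01 : ∀ p, |b p| ≤ 1 := fun p => ha01 _
  have hbd : ∀ {Z : Type _} [MeasurableSpace Z] (μ : Measure Z) [IsProbabilityMeasure μ] (f g : Z → ℝ)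
      (_ : Measurable f) (_ : Measurable g) (_ : ∀ z, |f z| ≤ 1) (_ : ∀ z, |g z| ≤ 1),
      Integrable (fun z => f z * g z) μ := by
    intro Z _ μ _ f g hf hg hf1 hg1
    refine Integrable.of_bound (hf.mul hg).aestronglyMeasurable 1 (ae_of_all _ fun z => ?_)
    rw [Real.norm_eq_abs, abs_mul]
    exact mul_le_one₀ (hf1 z) (abs_nonneg _) (hg1 z)
  have ha1m : Measurable fun p : X × U => a p.1 := ham'.comp measurable_fst
  have ibb := hbd (P.prod ν) b b hbm hbm hb01 hb01
  have iab := hbd (P.prod ν) (fun p => a p.1) b ha1m hbm (fun p => ha01 _) hb01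
  have iaa := hbd (P.prod ν) (fun p => a p.1) (fun p => a p.1) ha1m ha1m (fun p => ha01 _) (fun p => ha01 _)
  have vaa : ∫ p, a p.1 * a p.1 ∂(P.prod ν) = ∫ x, a x * a x ∂P := by
    rw [integral_prod _ iaa]; simp
  have vab : ∫ p, a p.1 * b p ∂(P.prod ν) = ∫ x, a x * a x ∂P := by
    rw [integral_prod _ iab]
    refine integral_congr_ae (ae_of_all _ fun x => ?_)
    simp only [hb]
    rw [integral_const_mul, havg']
  have vbb : ∫ p, b p * b p ∂(P.prod ν) = ∫ x, a x * a x ∂P := by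
    rw [integral_prod_symm _ ibb]
    have : ∀ w, ∫ x, b (x, w) * b (x, w) ∂P = ∫ x, a x * a x ∂P := by
      intro w
      have hm : MeasurePreserving (θ^[len w]) P P := hθ.toMeasurePreserving.iterate _
      have hf : AEStronglyMeasurable (fun x => a x * a x) (P.map (θ^[len w])) :=
        (ham'.mul ham').aestronglyMeasurable
      have := integral_map hm.measurable.aemeasurable hf
      rw [hm.map_eq] at this
      exact this.symm
    simp [this]
  have hsq : ∫ p, (b p - a p.1) ^ 2 ∂(P.prod ν) = 0 := by
    have : (fun p : X × U => (b p - a p.1) ^ 2) =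
        fun p => b p * b p - 2 * (a p.1 * b p) + a p.1 * a p.1 := by
      funext p; ring
    have i2 : Integrable (fun p => 2 * (a p.1 * b p)) (P.prod ν) := iab.const_mul 2
    have i3 : Integrable (fun p => b p * b p - 2 * (a p.1 * b p)) (P.prod ν) := ibb.sub i2
    rw [this, integral_add i3 iaa, integral_sub ibb i2, integral_const_mul, vaa, vab, vbb]
    ring
  have isq : Integrable (fun p : X × U => (b p - a p.1) ^ 2) (P.prod ν) := by
    have : (fun p : X × U => (b p - a p.1) ^ 2) =
        fun p => b p * b p - 2 * (a p.1 * b p) + a p.1 * a p.1 := by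
      funext p; ring
    rw [this]
    exact (ibb.sub (iab.const_mul 2)).add iaa
  rw [integral_eq_zero_iff_of_nonneg (fun p => sq_nonneg _) isq] at hsq
  have hae : ∀ᵐ p ∂(P.prod ν), b p = a p.1 := by
    filter_upwards [hsq] with p hp
    have : b p - a p.1 = 0 := by simpa using hp
    linarith
  have hswap : ∀ᵐ w ∂ν, ∀ᵐ x ∂P, b (x, w) = a x := by
    have hs : MeasurableSet {p : X × U | b p = a p.1} := measurableSet_eq_fun hbm ha1m
    have := (Measure.ae_ae_comm (μ := P) (ν := ν) (p := fun x w => b (x, w) = a x) hs).1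
      (Measure.ae_ae_of_ae_prod hae)
    exact this
  have hex : ∃ w, len w = 1 ∧ ∀ᵐ x ∂P, b (x, w) = a x := by
    by_contra hcon
    apply h1
    refine measure_mono_null (fun w hw => ?_) hswap
    exact fun hh => hcon ⟨w, hw, hh⟩
  obtain ⟨w, hw1, hw⟩ := hex
  have hw' : ∀ᵐ x ∂P, a (θ x) = a x := by
    filter_upwards [hw] with x hx
    simpa [hb, hw1] using hx
  obtain ⟨c', hc'⟩ := hθ.ae_eq_const_of_ae_eq_comp₀ ham'.nullMeasurable hw'
  set c := ENNReal.ofReal c'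
  have hc : ∀ᵐ x ∂P, η (Prod.mk x ⁻¹' A) = c := by
    filter_upwards [hc'] with x hx
    simp only [Function.const] at hx
    rw [← ENNReal.ofReal_toReal (measure_ne_top η (Prod.mk x ⁻¹' A))]
    exact congrArg ENNReal.ofReal hx
  have hall : ∀ᵐ x ∂P, ∀ k, η (Prod.mk (θ^[k] x) ⁻¹' A) = c := by
    rw [ae_all_iff]
    intro k
    exact (hθ.toMeasurePreserving.iterate k).quasiMeasurePreserving.ae hc
  have hPA : (P.prod η) A = c := by
    rw [Measure.prod_apply hA, lintegral_congr_ae hc]; simp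
  obtain ⟨x, hx⟩ := hall.exists
  have hsec := fun N => skew_sec ν hθ.measurable hlen hA hinv N x hx
  have hcc : c = 0 ∨ c = 1 := by
    by_cases hc0 : c = 0
    · exact Or.inl hc0
    right
    have hct : c ≠ ∞ := ENNReal.ofReal_ne_top
    have heq : c⁻¹ • η.restrict (Prod.mk x ⁻¹' A) = η := by
      refine eq_infinitePi_range ν fun N t ht => ?_
      rw [Measure.smul_apply, Measure.restrict_apply (measurableSet_cyl N t ht), inter_comm,
        hsec N t ht, smul_eq_mul, ← mul_assoc, ENNReal.inv_mul_cancel hc0 hct, one_mul]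
    have h2 : η (Prod.mk x ⁻¹' A)ᶜ = 0 := by
      rw [← heq, Measure.smul_apply, Measure.restrict_apply (hsecm x).compl]
      simp
    have h3 := prob_compl_eq_zero_iff (hsecm x) |>.1 h2
    rw [← hx 0]; exact h3
  rw [eventuallyConst_set']
  rcases hcc with h | h
  · left
    rw [h] at hPA
    exact ae_eq_empty.2 hPA
  · right
    rw [h] at hPA
    rw [ae_eq_univ]
    exact (prob_compl_eq_zero_iff hA).2 hPA

end skew

section rect
variable {X Y : Type*} [MeasurableSpace X] [MeasurableSpace Y]

/-- Domination on rectangles gives domination on half-plane type sets. -/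
lemma rect_le {μ ν : Measure (X × Y)} [IsFiniteMeasure ν]
    (h : ∀ A B, MeasurableSet A → MeasurableSet B → μ (A ×ˢ B) ≤ ν (A ×ˢ B))
    {d : X → ℝ} {e : Y → ℝ} (hd : Measurable d) (he : Measurable e) (t : ℝ) :
    μ {z | d z.1 + e z.2 ≤ t} ≤ ν {z | d z.1 + e z.2 ≤ t} := by
  have hde : Measurable fun z : X × Y => d z.1 + e z.2 :=
    (hd.comp measurable_fst).add (he.comp measurable_snd)
  set F : ℕ → Set (X × Y) := fun k => {z | d z.1 + e z.2 ≤ t + 1 / ((k : ℝ) + 1)} with hF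
  have hstep : ∀ k, μ {z | d z.1 + e z.2 ≤ t} ≤ ν (F k) := by
    intro k
    have hk : (0 : ℝ) < (k : ℝ) + 1 := by positivity
    have hfl : Measurable fun x => ⌊((k : ℝ) + 1) * d x⌋ := (hd.const_mul ((k : ℝ) + 1)).floor
    set A : ℤ → Set X := fun j => {x | ⌊((k : ℝ) + 1) * d x⌋ = j} with hA
    set B : ℤ → Set Y := fun j => {y | e y ≤ t - j / ((k : ℝ) + 1)} with hB
    have hAm : ∀ j, MeasurableSet (A j) := fun j => hfl (measurableSet_singleton j)
    have hBm : ∀ j, MeasurableSet (B j) := fun j => measurableSet_le he measurable_const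
    have s1 : {z : X × Y | d z.1 + e z.2 ≤ t} ⊆ ⋃ j, A j ×ˢ B j := by
      rintro ⟨x, y⟩ hz
      simp only [mem_ofPred_eq] at hz
      refine mem_iUnion.2 ⟨⌊((k : ℝ) + 1) * d x⌋, rfl, ?_⟩
      show e y ≤ _
      have h1 := Int.floor_le (((k : ℝ) + 1) * d x)
      have h2 : (⌊((k : ℝ) + 1) * d x⌋ : ℝ) / ((k : ℝ) + 1) ≤ d x := by
        rw [div_le_iff₀ hk]; linarith
      linarith
    have s2 : (⋃ j, A j ×ˢ B j) ⊆ F k := by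
      rintro ⟨x, y⟩ hz
      obtain ⟨j, hx, hy⟩ := mem_iUnion.1 hz
      have hx' : ⌊((k : ℝ) + 1) * d x⌋ = j := hx
      have hy' : e y ≤ t - j / ((k : ℝ) + 1) := hy
      show d x + e y ≤ t + 1 / ((k : ℝ) + 1)
      have h1 := Int.lt_floor_add_one (((k : ℝ) + 1) * d x)
      rw [hx'] at h1
      have h2 : d x ≤ ((j : ℝ) + 1) / ((k : ℝ) + 1) := by
        rw [le_div_iff₀ hk]; linarith
      rw [add_div] at h2
      linarith
    have hdisj : Pairwise (Function.onFun Disjoint fun j => A j ×ˢ B j) := by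
      intro i j hij
      refine Set.disjoint_left.2 fun z hz hz' => hij ?_
      have a1 : ⌊((k : ℝ) + 1) * d z.1⌋ = i := hz.1
      have a2 : ⌊((k : ℝ) + 1) * d z.1⌋ = j := hz'.1
      rw [← a1, a2]
    calc μ {z | d z.1 + e z.2 ≤ t} ≤ μ (⋃ j, A j ×ˢ B j) := measure_mono s1
      _ ≤ ∑' j, μ (A j ×ˢ B j) := measure_iUnion_le _
      _ ≤ ∑' j, ν (A j ×ˢ B j) := ENNReal.tsum_le_tsum fun j => h _ _ (hAm j) (hBm j)
      _ = ν (⋃ j, A j ×ˢ B j) := (measure_iUnion hdisj fun j => (hAm j).prod (hBm j)).symm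
      _ ≤ ν (F k) := measure_mono s2
  have hanti : Antitone F := by
    intro i j hij z hz
    have hz' : d z.1 + e z.2 ≤ t + 1 / ((j : ℝ) + 1) := hz
    show d z.1 + e z.2 ≤ t + 1 / ((i : ℝ) + 1)
    have := Nat.one_div_le_one_div (α := ℝ) hij
    linarith
  have hlim := tendsto_measure_iInter_atTop (μ := ν) (s := F)
    (fun k => (measurableSet_le hde measurable_const).nullMeasurableSet) hanti ⟨0, measure_ne_top _ _⟩
  have hI : ⋂ k, F k = {z | d z.1 + e z.2 ≤ t} := by
    ext z
    simp only [mem_iInter, hF, mem_ofPred_eq]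
    constructor
    · intro hz
      have hl : Tendsto (fun k : ℕ => t + 1 / ((k : ℝ) + 1)) atTop (𝓝 (t + 0)) :=
        tendsto_const_nhds.add tendsto_one_div_add_atTop_nhds_zero_nat
      rw [add_zero] at hl
      exact ge_of_tendsto' hl hz
    · intro hz k
      have : (0 : ℝ) ≤ 1 / ((k : ℝ) + 1) := by positivity
      linarith
  rw [hI] at hlim
  exact ge_of_tendsto' hlim hstep

/-- Represent a coupling by a randomised map, with its density. -/
lemma coupling_rep [StandardBorelSpace Y] [Nonempty Y] (P : Measure X) [IsProbabilityMeasure P]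
    (Q : Measure Y) [IsProbabilityMeasure Q] (W : Measure (X × Y)) [IsProbabilityMeasure W]
    (hW : W.map Prod.fst = P) (hac : W ≪ P.prod Q) :
    ∃ G : X → unitInterval → Y, Measurable (Function.uncurry G) ∧
      (P.prod volume).map (fun p => (p.1, G p.1 p.2)) = W ∧
      ∀ᵐ x ∂P, ∀ g : Y → ℝ≥0∞, Measurable g →
        ∫⁻ v, ENNReal.ofReal (Real.exp (-(llr W (P.prod Q) (x, G x v)))) * g (G x v) ≤
          ∫⁻ y, g y ∂Q := by
  set f := W.rnDeriv (P.prod Q) with hf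
  have hfm : Measurable f := Measure.measurable_rnDeriv _ _
  have hWd : (P.prod Q).withDensity f = W := Measure.withDensity_rnDeriv_eq _ _ hac
  have hfs : ∀ x, Measurable fun y => f (x, y) := fun x => hfm.comp measurable_prodMk_left
  have hIntg : ∀ A, MeasurableSet A → ∫⁻ x, ∫⁻ y in Prod.mk x ⁻¹' A, f (x, y) ∂Q ∂P = W A := by
    intro A hA
    rw [← hWd, withDensity_apply _ hA, ← lintegral_indicator hA,
      lintegral_prod _ (hfm.indicator hA).aemeasurable]
    refine lintegral_congr fun x => ?_
    rw [← lintegral_indicator (measurable_prodMk_left hA)]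
    rfl
  have hm1 : Measurable fun x => ∫⁻ y, f (x, y) ∂Q := hfm.lintegral_prod_right'
  have hone : ∀ᵐ x ∂P, ∫⁻ y, f (x, y) ∂Q = 1 := by
    have := ae_eq_of_forall_setLIntegral_eq_of_sigmaFinite (μ := P) hm1
      (measurable_const : Measurable fun _ : X => (1 : ℝ≥0∞)) (fun B hB _ => by
        have h1 := hIntg (B ×ˢ univ) (hB.prod MeasurableSet.univ)
        have h2 : W (B ×ˢ univ) = P B := by
          rw [← hW, Measure.map_apply measurable_fst hB]
          congr 1
          ext z; simp
        rw [h2] at h1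
        rw [setLIntegral_one, ← h1, ← lintegral_indicator hB]
        refine lintegral_congr fun x => ?_
        by_cases hx : x ∈ B
        · rw [indicator_of_mem hx]
          have : Prod.mk x ⁻¹' (B ×ˢ (univ : Set Y)) = univ := by ext; simp [hx]
          rw [this, Measure.restrict_univ]
        · rw [indicator_of_notMem hx]
          have : Prod.mk x ⁻¹' (B ×ˢ (univ : Set Y)) = ∅ := by ext; simp [hx]
          rw [this]; simp)
    exact this
  set f' : X → Y → ℝ≥0∞ := fun x y => if ∫⁻ y, f (x, y) ∂Q = 1 then f (x, y) else 1 with hf'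
  have hf'm : Measurable (Function.uncurry f') := by
    have : MeasurableSet {z : X × Y | ∫⁻ y, f (z.1, y) ∂Q = 1} :=
      (hm1.comp measurable_fst) (measurableSet_singleton 1)
    exact Measurable.ite this hfm measurable_const
  have hf'1 : ∀ x, ∫⁻ y, f' x y ∂Q = 1 := by
    intro x
    by_cases hx : ∫⁻ y, f (x, y) ∂Q = 1
    · simp [hf', hx]
    · simp [hf', hx]
  set κ : ProbabilityTheory.Kernel X Y := (ProbabilityTheory.Kernel.const X Q).withDensity f' with hκ
  have hκa : ∀ x, κ x = Q.withDensity (f' x) := fun x => by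
    rw [hκ, ProbabilityTheory.Kernel.withDensity_apply _ hf'm]; rfl
  haveI : ProbabilityTheory.IsMarkovKernel κ := ⟨fun x => ⟨by
    rw [hκa, withDensity_apply _ MeasurableSet.univ, Measure.restrict_univ, hf'1]⟩⟩
  obtain ⟨G, hG, hGκ⟩ := ProbabilityTheory.Kernel.exists_measurable_map_eq_unitInterval κ
  have hGx : ∀ x, Measurable (G x) := fun x => hG.comp measurable_prodMk_left
  have hpm : Measurable fun p : X × unitInterval => (p.1, G p.1 p.2) := measurable_fst.prodMk hG
  refine ⟨G, hG, ?_, ?_⟩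
  · ext A hA
    rw [Measure.map_apply hpm hA, Measure.prod_apply (hpm hA), ← hIntg A hA]
    refine lintegral_congr_ae ?_
    filter_upwards [hone] with x hx
    have e1 : Prod.mk x ⁻¹' ((fun p : X × unitInterval => (p.1, G p.1 p.2)) ⁻¹' A) =
        G x ⁻¹' (Prod.mk x ⁻¹' A) := rfl
    have hAx : MeasurableSet (Prod.mk x ⁻¹' A) := measurable_prodMk_left hA
    rw [e1, ← Measure.map_apply (hGx x) hAx, hGκ, hκa, withDensity_apply _ hAx]
    simp [hf', hx]
  · filter_upwards [hone] with x hx g hg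
    have hllr : Measurable fun y => ENNReal.ofReal (Real.exp (-(llr W (P.prod Q) (x, y)))) * g y := by
      refine Measurable.mul (Measurable.ennreal_ofReal (Measurable.exp (Measurable.neg ?_))) hg
      exact (measurable_llr _ _).comp measurable_prodMk_left
    have e1 := lintegral_map (μ := volume) hllr (hGx x)
    rw [← e1, hGκ, hκa]
    have hf'x : Measurable (f' x) := hf'm.comp measurable_prodMk_left
    rw [lintegral_withDensity_eq_lintegral_mul _ hf'x hllr]
    have hlt : ∀ᵐ y ∂Q, f (x, y) < ∞ := ae_lt_top (hfs x) (by rw [hx]; simp)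
    refine lintegral_mono_ae ?_
    filter_upwards [hlt] with y hy
    have e2 : f' x y = f (x, y) := by simp [hf', hx]
    simp only [Pi.mul_apply, e2]
    rw [← mul_assoc]
    refine (mul_le_mul_left ?_ (g y)).trans (one_mul _).le
    rw [show llr W (P.prod Q) (x, y) = Real.log (f (x, y)).toReal from rfl]
    by_cases h0 : f (x, y) = 0
    · simp [h0]
    · have hp : 0 < (f (x, y)).toReal := ENNReal.toReal_pos h0 hy.ne
      rw [Real.exp_neg, Real.exp_log hp, ENNReal.ofReal_inv_of_pos hp, ENNReal.ofReal_toReal hy.ne,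
        ENNReal.mul_inv_cancel h0 hy.ne]

end rect

section gen
variable {S T U : Type*} [MeasurableSpace S] [MeasurableSpace T] [MeasurableSpace U]

/-- One-step domination property at a point. -/
def StepOK (ρ : S × T → ℝ) (𝒬 : Measure (ℕ → T)) (C : ℝ) (ν : Measure U) (len : U → ℕ)
    (δ l : (ℕ → S) × U → ℝ) (x : ℕ → S) : Prop :=
  ∀ (n : ℕ) (t : ℝ), ∫⁻ w, (if len w ≤ n then ENNReal.ofReal (Real.exp (-(l (x, w)))) *
      sQ ρ 𝒬 (shiftSeq^[len w] x) (n - len w) (t - δ (x, w)) else 0) ∂ν ≤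
    ENNReal.ofReal C * sQ ρ 𝒬 x n t

variable {ρ : S × T → ℝ} {𝒬 : Measure (ℕ → T)} [IsProbabilityMeasure 𝒬] {C : ℝ}
  {ν : Measure U} [IsProbabilityMeasure ν] {len : U → ℕ} {δ l : (ℕ → S) × U → ℝ}

lemma measurable_first {f : (ℕ → S) × U → ℝ} (hf : Measurable f) :
    Measurable fun p : (ℕ → S) × (ℕ → U) => f (p.1, p.2 0) :=
  hf.comp (measurable_fst.prodMk ((measurable_pi_apply 0).comp measurable_snd))

lemma measurable_bsN (hlen : Measurable len) (N : ℕ) :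
    Measurable (birkhoffSum (skew (X := ℕ → S) shiftSeq len) (fun p => len (p.2 0)) N) := by
  have : birkhoffSum (skew (X := ℕ → S) shiftSeq len) (fun p => len (p.2 0)) N =
      fun p => ∑ k ∈ Finset.range N, len (((skew (X := ℕ → S) shiftSeq len)^[k] p).2 0) := rfl
  rw [this]
  refine Finset.measurable_sum _ fun k _ => ?_
  have hk : Measurable ((skew (X := ℕ → S) shiftSeq len)^[k]) :=
    (measurable_skew measurable_shiftSeq hlen).iterate k
  exact hlen.comp ((measurable_pi_apply 0).comp (measurable_snd.comp hk))

/-- The exponential moment restricted to the event. -/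
def keyJ (ν : Measure U) [IsProbabilityMeasure ν] (len : U → ℕ) (δ l : (ℕ → S) × U → ℝ) (N : ℕ)
    (x : ℕ → S) (n : ℕ) (t : ℝ) : ℝ≥0∞ :=
  ∫⁻ u, (if birkhoffSum (skew shiftSeq len) (fun p => len (p.2 0)) N (x, u) = n ∧
      birkhoffSum (skew shiftSeq len) (fun p => δ (p.1, p.2 0)) N (x, u) ≤ t then
    ENNReal.ofReal (Real.exp (-(birkhoffSum (skew shiftSeq len) (fun p => l (p.1, p.2 0)) N (x, u))))
    else 0) ∂(Measure.infinitePi (fun _ : ℕ => ν))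

lemma key_ind (hlen : Measurable len) (hδ : Measurable δ) (hl : Measurable l) (N : ℕ) :
    ∀ x : ℕ → S, (∀ k, StepOK ρ 𝒬 C ν len δ l (shiftSeq^[k] x)) → ∀ n t,
      keyJ ν len δ l N x n t ≤ ENNReal.ofReal C ^ N * sQ ρ 𝒬 x n t := by
  induction N with
  | zero =>
    intro x hx n t
    simp only [keyJ, birkhoffSum_zero, pow_zero, one_mul, neg_zero, Real.exp_zero, ENNReal.ofReal_one]
    by_cases h : 0 = n ∧ 0 ≤ t
    · obtain ⟨rfl, ht⟩ := h
      simp [ht, sQ, sdist]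
    · simp [h]
  | succ N ih =>
    intro x hx n t
    set F := skew (X := ℕ → S) shiftSeq len with hF
    set η := Measure.infinitePi (fun _ : ℕ => ν) with hη
    set h : U × (ℕ → U) → ℝ≥0∞ := fun q =>
      if len q.1 + birkhoffSum F (fun p => len (p.2 0)) N (shiftSeq^[len q.1] x, q.2) = n ∧
        δ (x, q.1) + birkhoffSum F (fun p => δ (p.1, p.2 0)) N (shiftSeq^[len q.1] x, q.2) ≤ t then
        ENNReal.ofReal (Real.exp (-(l (x, q.1) +
          birkhoffSum F (fun p => l (p.1, p.2 0)) N (shiftSeq^[len q.1] x, q.2)))) else 0 with hh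
    have hFm : Measurable F := measurable_skew measurable_shiftSeq hlen
    have hqm : Measurable fun q : U × (ℕ → U) => (shiftSeq^[len q.1] x, q.2) := by
      refine Measurable.prodMk ?_ measurable_snd
      exact (measurable_iter measurable_shiftSeq hlen).comp (measurable_const.prodMk measurable_fst)
    have hxm : Measurable fun q : U × (ℕ → U) => (x, q.1) := measurable_const.prodMk measurable_fst
    have hhm : Measurable h := by
      have m1 : Measurable fun q : U × (ℕ → U) => len q.1 +
          birkhoffSum F (fun p => len (p.2 0)) N (shiftSeq^[len q.1] x, q.2) :=
        (hlen.comp measurable_fst).add ((measurable_bsN hlen N).comp hqm)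
      have m2 : Measurable fun q : U × (ℕ → U) => δ (x, q.1) +
          birkhoffSum F (fun p => δ (p.1, p.2 0)) N (shiftSeq^[len q.1] x, q.2) :=
        (hδ.comp hxm).add ((measurable_birkhoffSum' hFm (measurable_first hδ) N).comp hqm)
      have m3 : Measurable fun q : U × (ℕ → U) => l (x, q.1) +
          birkhoffSum F (fun p => l (p.1, p.2 0)) N (shiftSeq^[len q.1] x, q.2) :=
        (hl.comp hxm).add ((measurable_birkhoffSum' hFm (measurable_first hl) N).comp hqm)
      refine Measurable.ite ?_ m3.neg.exp.ennreal_ofReal measurable_const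
      exact (m1 (measurableSet_singleton n)).inter (measurableSet_le m2 measurable_const)
    have e1 : keyJ ν len δ l (N + 1) x n t = ∫⁻ u, h (u 0, shiftSeq u) ∂η := by
      refine lintegral_congr fun u => ?_
      simp only [birkhoffSum_succ', hh]
      rfl
    rw [e1, lintegral_cons ν hhm]
    have e2 : ∀ w, ∫⁻ u, h (w, u) ∂η ≤ ENNReal.ofReal C ^ N * (if len w ≤ n then
        ENNReal.ofReal (Real.exp (-(l (x, w)))) *
        sQ ρ 𝒬 (shiftSeq^[len w] x) (n - len w) (t - δ (x, w)) else 0) := by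
      intro w
      by_cases hw : len w ≤ n
      · rw [if_pos hw]
        have e3 : ∫⁻ u, h (w, u) ∂η = ENNReal.ofReal (Real.exp (-(l (x, w)))) *
            keyJ ν len δ l N (shiftSeq^[len w] x) (n - len w) (t - δ (x, w)) := by
          rw [keyJ, ← lintegral_const_mul' _ _ ENNReal.ofReal_ne_top]
          refine lintegral_congr fun u => ?_
          simp only [hh]
          rw [mul_ite, mul_zero, ← ENNReal.ofReal_mul (Real.exp_pos _).le, ← Real.exp_add, neg_add]
          refine if_congr (and_congr ?_ ?_) rfl rfl
          · constructor
            · intro hq; exact (Nat.sub_eq_of_eq_add' hq.symm).symm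
            · intro hq
              have := Nat.add_sub_cancel' hw
              rw [← this]; exact congrArg _ hq
          · constructor <;> intro _ <;> linarith
        rw [e3]
        refine (mul_le_mul_right (ih (shiftSeq^[len w] x) (fun k => by
          rw [← Function.iterate_add_apply]; exact hx _) (n - len w) (t - δ (x, w))) _).trans
          (le_of_eq ?_)
        ring
      · rw [if_neg hw, mul_zero]
        have : ∀ u, h (w, u) = 0 := by
          intro u
          simp only [hh]
          rw [if_neg]
          rintro ⟨h1, _⟩
          omega
        simp [this]
    refine (lintegral_mono e2).trans ?_
    rw [lintegral_const_mul' _ _ (ENNReal.pow_ne_top ENNReal.ofReal_ne_top)]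
    refine (mul_le_mul_right (hx 0 n t) _).trans (le_of_eq ?_)
    rw [pow_succ, mul_assoc]; rfl

lemma bs_len_bounds {m : ℕ} (h1 : ∀ w, 1 ≤ len w) (hm : ∀ w, len w ≤ m) (N : ℕ)
    (p : (ℕ → S) × (ℕ → U)) :
    N ≤ birkhoffSum (skew shiftSeq len) (fun p => len (p.2 0)) N p ∧
    birkhoffSum (skew shiftSeq len) (fun p => len (p.2 0)) N p ≤ N * m := by
  constructor
  · calc N = ∑ k ∈ Finset.range N, 1 := by simp
      _ ≤ _ := Finset.sum_le_sum fun k _ => h1 _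
  · calc _ ≤ ∑ k ∈ Finset.range N, m := Finset.sum_le_sum fun k _ => hm _
      _ = N * m := by simp

theorem upper_gen {Psrc : Measure (ℕ → S)} [IsProbabilityMeasure Psrc] (hErg : Ergodic shiftSeq Psrc)
    (hC : 1 ≤ C) (hlen : Measurable len) (hδ : Measurable δ) (hl : Measurable l)
    (hν1 : ν {w | len w = 1} ≠ 0) {m : ℕ} (h1 : ∀ w, 1 ≤ len w) (hm : ∀ w, len w ≤ m)
    (hstep : ∀ᵐ x ∂Psrc, StepOK ρ 𝒬 C ν len δ l x) (D r : ℝ)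
    (hZi : Integrable (fun p => δ p - len p.2 * D) (Psrc.prod ν))
    (hZ : ∫ p, (δ p - len p.2 * D) ∂(Psrc.prod ν) ≤ 0)
    (hVi : Integrable (fun p => l p + Real.log C - len p.2 * r) (Psrc.prod ν))
    (hV : ∫ p, (l p + Real.log C - len p.2 * r) ∂(Psrc.prod ν) < 0) :
    ∀ᵐ x ∂Psrc, ∃ᶠ n : ℕ in atTop, ENNReal.ofReal (Real.exp (-(r * n))) ≤ sQ ρ 𝒬 x n (n * D) := by
  set η := Measure.infinitePi (fun _ : ℕ => ν) with hη
  set F := skew (X := ℕ → S) shiftSeq len with hF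
  have hFe : Ergodic F (Psrc.prod η) := skew_ergodic ν hErg hlen hν1
  have hFm : Measurable F := hFe.measurable
  have hev : MeasurePreserving (fun p : (ℕ → S) × (ℕ → U) => (p.1, p.2 0)) (Psrc.prod η) (Psrc.prod ν) := by
    have h0 : MeasurePreserving (fun u : ℕ → U => u 0) η ν :=
      ⟨measurable_pi_apply 0, Measure.infinitePi_map_eval (fun _ : ℕ => ν) 0⟩
    exact (MeasurePreserving.id Psrc).prod h0
  have hlenR : Measurable fun p : (ℕ → S) × U => (len p.2 : ℝ) :=
    (measurable_from_top (f := fun n : ℕ => (n : ℝ))).comp (hlen.comp measurable_snd)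
  have hZm : Measurable fun p : (ℕ → S) × U => δ p - len p.2 * D := hδ.sub (hlenR.mul_const D)
  have hVm : Measurable fun p : (ℕ → S) × U => l p + Real.log C - len p.2 * r :=
    (hl.add_const _).sub (hlenR.mul_const r)
  have hIntg : ∀ f : (ℕ → S) × U → ℝ, Measurable f →
      ∫ p : (ℕ → S) × (ℕ → U), f (p.1, p.2 0) ∂(Psrc.prod η) = ∫ p, f p ∂(Psrc.prod ν) := by
    intro f hf
    have hfs : AEStronglyMeasurable f ((Psrc.prod η).map fun p => (p.1, p.2 0)) := hf.aestronglyMeasurable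
    have := integral_map hev.measurable.aemeasurable hfs
    rw [hev.map_eq] at this
    exact this.symm
  have hfreq := ae_frequently_birkhoffSum hFe (measurable_first hZm)
    (hev.integrable_comp_of_integrable hZi) (by rw [hIntg _ hZm]; exact hZ)
  obtain ⟨c, hc, hev2⟩ := ae_eventually_birkhoffSum hFe (measurable_first hVm)
    (hev.integrable_comp_of_integrable hVi) (by rw [hIntg _ hVm]; exact hV)
  have hfreq' := Measure.ae_ae_of_ae_prod hfreq
  have hev2' := Measure.ae_ae_of_ae_prod hev2
  have hstep' : ∀ᵐ x ∂Psrc, ∀ k, StepOK ρ 𝒬 C ν len δ l (shiftSeq^[k] x) := by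
    rw [ae_all_iff]
    intro k
    exact (hErg.toMeasurePreserving.iterate k).quasiMeasurePreserving.ae hstep
  filter_upwards [hfreq', hev2', hstep'] with x hx1 hx2 hx3
  by_contra hcon
  rw [not_frequently] at hcon
  obtain ⟨n0, hn0⟩ := eventually_atTop.1 hcon
  -- birkhoff sum decompositions
  set τ : ℕ → (ℕ → U) → ℕ := fun N u => birkhoffSum F (fun p => len (p.2 0)) N (x, u) with hτ
  set sd : ℕ → (ℕ → U) → ℝ := fun N u => birkhoffSum F (fun p => δ (p.1, p.2 0)) N (x, u) with hsd
  set sl : ℕ → (ℕ → U) → ℝ := fun N u => birkhoffSum F (fun p => l (p.1, p.2 0)) N (x, u) with hsl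
  have dZ : ∀ N u, birkhoffSum F (fun p => δ (p.1, p.2 0) - len (p.2 0) * D) N (x, u) =
      sd N u - τ N u * D := by
    intro N u
    simp only [hsd, hτ, birkhoffSum, Finset.sum_sub_distrib, ← Finset.sum_mul]
    push_cast; rfl
  have dV : ∀ N u, birkhoffSum F (fun p => l (p.1, p.2 0) + Real.log C - len (p.2 0) * r) N (x, u) =
      sl N u + N * Real.log C - τ N u * r := by
    intro N u
    simp only [hsl, hτ, birkhoffSum, Finset.sum_sub_distrib, Finset.sum_add_distrib, ← Finset.sum_mul,
      Finset.sum_const, Finset.card_range, nsmul_eq_mul]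
    push_cast; rfl
  have msec : Measurable fun u : ℕ → U => (x, u) := measurable_prodMk_left
  have mτ : ∀ N, Measurable (τ N) := fun N => (measurable_bsN hlen N).comp msec
  have msd : ∀ N, Measurable (sd N) := fun N =>
    (measurable_birkhoffSum' hFm (measurable_first hδ) N).comp msec
  have msl : ∀ N, Measurable (sl N) := fun N =>
    (measurable_birkhoffSum' hFm (measurable_first hl) N).comp msec
  set E : ℕ → Set (ℕ → U) := fun N =>
    {u | sd N u - τ N u * D ≤ 0 ∧ sl N u + N * Real.log C - τ N u * r ≤ -c * N} with hE
  have hEN : ∀ N, n0 ≤ N → η (E N) ≤ ENNReal.ofReal ((N * m + 1) * Real.exp (-(c * N))) := by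
    intro N hN
    have hsub : E N ⊆ ⋃ n ∈ Finset.Icc N (N * m),
        {u | ENNReal.ofReal (Real.exp (N * Real.log C + c * N - r * n)) ≤
          (if τ N u = n ∧ sd N u ≤ n * D then ENNReal.ofReal (Real.exp (-(sl N u))) else 0)} := by
      intro u hu
      have hb := bs_len_bounds h1 hm N (x, u)
      simp only [mem_iUnion]
      refine ⟨τ N u, Finset.mem_Icc.2 hb, ?_⟩
      have hu1 := hu.1
      have hu2 := hu.2
      rw [mem_ofPred_eq]
      rw [if_pos ⟨rfl, by linarith⟩]
      refine ENNReal.ofReal_le_ofReal (Real.exp_le_exp.2 ?_)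
      linarith
    have hone : ∀ n ∈ Finset.Icc N (N * m),
        η {u | ENNReal.ofReal (Real.exp (N * Real.log C + c * N - r * n)) ≤
          (if τ N u = n ∧ sd N u ≤ n * D then ENNReal.ofReal (Real.exp (-(sl N u))) else 0)} ≤
          ENNReal.ofReal (Real.exp (-(c * N))) := by
      intro n hn
      have hn' := (Finset.mem_Icc.1 hn).1
      have hmeas : Measurable fun u =>
          (if τ N u = n ∧ sd N u ≤ n * D then ENNReal.ofReal (Real.exp (-(sl N u))) else 0) := by
        refine Measurable.ite ?_ (msl N).neg.exp.ennreal_ofReal measurable_const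
        exact (mτ N (measurableSet_singleton n)).inter (measurableSet_le (msd N) measurable_const)
      have hpos : ENNReal.ofReal (Real.exp (N * Real.log C + c * N - r * n)) ≠ 0 := by
        simpa using Real.exp_pos _
      refine (meas_ge_le_lintegral_div hmeas.aemeasurable hpos ENNReal.ofReal_ne_top).trans ?_
      refine ENNReal.div_le_of_le_mul ?_
      have hk := key_ind (ρ := ρ) (𝒬 := 𝒬) (C := C) (ν := ν) hlen hδ hl N x hx3 n (n * D)
      refine (show _ ≤ keyJ ν len δ l N x n (n * D) from le_rfl).trans (hk.trans ?_)
      have hq : sQ ρ 𝒬 x n (n * D) ≤ ENNReal.ofReal (Real.exp (-(r * n))) :=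
        (not_le.1 (hn0 n (hN.trans hn'))).le
      refine (mul_le_mul_right hq _).trans (le_of_eq ?_)
      have hC0 : 0 < C := by linarith
      rw [← ENNReal.ofReal_pow hC0.le, ← ENNReal.ofReal_mul (by positivity),
        ← ENNReal.ofReal_mul (by positivity), ← Real.exp_add]
      congr 1
      rw [show C ^ N = Real.exp (N * Real.log C) by rw [mul_comm, Real.exp_mul, Real.exp_log hC0,
        Real.rpow_natCast], ← Real.exp_add]
      congr 1; ring
    refine (measure_mono hsub).trans ((measure_biUnion_finset_le _ _).trans
      ((Finset.sum_le_sum hone).trans ?_))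
    rw [Finset.sum_const, nsmul_eq_mul, ENNReal.ofReal_mul (by positivity)]
    refine mul_le_mul_left ?_ _
    rw [show ((N : ℝ) * m + 1) = ((N * m + 1 : ℕ) : ℝ) by push_cast; ring, ENNReal.ofReal_natCast]
    norm_cast
    simp
  have hsum : ∑' N, η (E (N + n0)) ≠ ∞ := by
    have hs : Summable fun N : ℕ => ((N : ℝ) * m + 1) * Real.exp (-(c * N)) := by
      have s1 := (Real.summable_pow_mul_exp_neg_nat_mul 1 hc).mul_left (m : ℝ)
      have s0 := Real.summable_pow_mul_exp_neg_nat_mul 0 hc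
      refine (s1.add s0).congr fun N => ?_
      rw [neg_mul]; ring
    have hs' := (summable_nat_add_iff n0).2 hs
    refine ne_top_of_le_ne_top hs'.tsum_ofReal_ne_top (ENNReal.tsum_le_tsum fun N => ?_)
    exact hEN (N + n0) (by omega)
  have hbc := ae_eventually_notMem hsum
  have hfalse : ∀ᵐ u ∂η, False := by
    filter_upwards [hbc, hx1, hx2] with u hu1 hu2 hu3
    have h3 : ∃ᶠ N : ℕ in atTop, u ∈ E N := by
      refine (hu2.and_eventually hu3).mono fun N hN => ?_
      refine ⟨?_, ?_⟩
      · rw [← dZ]; exact hN.1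
      · rw [← dV]; exact hN.2
    have h4 : ∀ᶠ N : ℕ in atTop, u ∉ E N := by
      obtain ⟨a, ha⟩ := eventually_atTop.1 hu1
      refine eventually_atTop.2 ⟨a + n0, fun N hN => ?_⟩
      have := ha (N - n0) (by omega)
      rwa [Nat.sub_add_cancel (by omega)] at this
    exact h3 h4
  exact hfalse.exists.elim fun _ h => h

end gen

section up
variable {S T : Type*} [MeasurableSpace S] [MeasurableSpace T]
  {ρ : S × T → ℝ} {𝒬 : Measure (ℕ → T)} [IsProbabilityMeasure 𝒬] {C : ℝ}

lemma sQ_mono (x : ℕ → S) (n : ℕ) : Monotone (sQ ρ 𝒬 x n) := fun _ _ h =>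
  measure_mono fun _ hy => le_trans hy h

lemma mix_ball (hρm : Measurable ρ) (hC : 1 ≤ C) (hQ : MeasurePreserving shiftSeq 𝒬 𝒬)
    (hmix : Mixing 𝒬 C) (k j : ℕ) (x : ℕ → S) (t : ℝ) :
    ∫⁻ y, sQ ρ 𝒬 (shiftSeq^[k] x) j (t - fdist ρ k (rst k x) y) ∂(margN 𝒬 k) ≤
      ENNReal.ofReal C * sQ ρ 𝒬 x (k + j) t := by
  have hθ := (hQ.iterate k).measurable
  have hpm : Measurable fun y : ℕ → T => (rst k y, shiftSeq^[k] y) := (measurable_rst k).prodMk hθ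
  have hd : Measurable fun y : Fin k → T => fdist ρ k (rst k x) y :=
    (measurable_fdist hρm k).comp measurable_prodMk_left
  have he : Measurable fun y : ℕ → T => sdist ρ j (shiftSeq^[k] x) y :=
    measurable_sdist_right hρm j _
  have hC0 : ENNReal.ofReal C ≠ 0 := by simp; linarith
  haveI : IsFiniteMeasure (ENNReal.ofReal C • 𝒬.map fun y : ℕ → T => (rst k y, shiftSeq^[k] y)) :=
    Measure.smul_finite _ ENNReal.ofReal_ne_top
  have hr := rect_le (μ := (margN 𝒬 k).prod 𝒬)
    (ν := ENNReal.ofReal C • 𝒬.map fun y : ℕ → T => (rst k y, shiftSeq^[k] y)) (by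
      intro A B hA hB
      rw [Measure.prod_prod, Measure.smul_apply, Measure.map_apply hpm (hA.prod hB), margN_eq,
        Measure.map_apply (measurable_rst k) hA, smul_eq_mul]
      have := (mix_rect hQ hmix k hA hB).1
      rw [ENNReal.inv_mul_le_iff hC0 ENNReal.ofReal_ne_top] at this
      exact this) hd he t
  have hset : MeasurableSet {z : (Fin k → T) × (ℕ → T) |
      fdist ρ k (rst k x) z.1 + sdist ρ j (shiftSeq^[k] x) z.2 ≤ t} :=
    measurableSet_le ((hd.comp measurable_fst).add (he.comp measurable_snd)) measurable_const
  rw [Measure.prod_apply hset, Measure.smul_apply, Measure.map_apply hpm hset, smul_eq_mul] at hr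
  refine le_trans (le_of_eq (lintegral_congr fun y => ?_)) (hr.trans (le_of_eq ?_))
  · rw [sQ]
    congr 1
    ext z
    simp only [mem_ofPred_eq, mem_preimage]
    constructor <;> intro _ <;> linarith
  · rw [sQ]
    congr 2
    ext y
    simp only [mem_ofPred_eq, mem_preimage, fdist_rst, sdist_add]

/-- The randomisation law: a fair coin and a uniform variable. -/
def coinU : Measure (Bool × unitInterval) :=
  (2⁻¹ : ℝ≥0∞) • (volume : Measure unitInterval).map (Prod.mk true) +
    (2⁻¹ : ℝ≥0∞) • (volume : Measure unitInterval).map (Prod.mk false)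

lemma map_mk_prob (b : Bool) :
    IsProbabilityMeasure ((volume : Measure unitInterval).map (Prod.mk b)) :=
  Measure.isProbabilityMeasure_map measurable_prodMk_left.aemeasurable

instance : IsProbabilityMeasure coinU := ⟨by
  haveI := map_mk_prob true
  haveI := map_mk_prob false
  simp only [coinU, Measure.add_apply, Measure.smul_apply, measure_univ, smul_eq_mul, mul_one]
  exact ENNReal.inv_two_add_inv_two⟩

lemma prod_coinU (P : Measure (ℕ → S)) [IsProbabilityMeasure P] :
    P.prod coinU = (2⁻¹ : ℝ≥0∞) • (P.prod volume).map (fun p => (p.1, (true, p.2))) +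
      (2⁻¹ : ℝ≥0∞) • (P.prod volume).map (fun p => (p.1, (false, p.2))) := by
  have h : ∀ b : Bool, P.prod ((volume : Measure unitInterval).map (Prod.mk b)) =
      (P.prod volume).map (fun p => (p.1, (b, p.2))) := by
    intro b
    have := Measure.map_prod_map (μa := P) (μc := (volume : Measure unitInterval)) (f := id)
      (g := Prod.mk b) measurable_id measurable_prodMk_left
    rw [Measure.map_id] at this
    exact this
  haveI := map_mk_prob true
  haveI := map_mk_prob false
  rw [coinU, Measure.prod_add, Measure.prod_smul_right, Measure.prod_smul_right, h, h]

variable {nb : Bool → ℕ} (G : ∀ b, (Fin (nb b) → S) → unitInterval → (Fin (nb b) → T))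

/-- Lift a family of block functions. -/
def liftB {R : Type*} (φ : ∀ b, (Fin (nb b) → S) × (Fin (nb b) → T) → R)
    (p : (ℕ → S) × (Bool × unitInterval)) : R :=
  φ p.2.1 (rst _ p.1, G p.2.1 (rst _ p.1) p.2.2)

variable {G}

lemma measurable_blk (hG : ∀ b, Measurable (Function.uncurry (G b))) (b : Bool) :
    Measurable fun p : (ℕ → S) × unitInterval => (rst (nb b) p.1, G b (rst _ p.1) p.2) := by
  have h1 : Measurable fun p : (ℕ → S) × unitInterval => (rst (nb b) p.1, p.2) :=
    ((measurable_rst _).comp measurable_fst).prodMk measurable_snd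
  exact ((measurable_rst _).comp measurable_fst).prodMk ((hG b).comp h1)

lemma measurable_liftB (hG : ∀ b, Measurable (Function.uncurry (G b)))
    {φ : ∀ b, (Fin (nb b) → S) × (Fin (nb b) → T) → ℝ} (hφ : ∀ b, Measurable (φ b)) :
    Measurable (liftB G φ) := by
  have h : Measurable fun q : Bool × ((ℕ → S) × unitInterval) =>
      φ q.1 (rst _ q.2.1, G q.1 (rst _ q.2.1) q.2.2) :=
    measurable_from_prod_countable_right fun b => (hφ b).comp (measurable_blk hG b)
  exact h.comp ((measurable_fst.comp measurable_snd).prodMk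
    (measurable_fst.prodMk (measurable_snd.comp measurable_snd)))

lemma map_blk {Psrc : Measure (ℕ → S)} [IsProbabilityMeasure Psrc]
    (hG : ∀ b, Measurable (Function.uncurry (G b)))
    {W : ∀ b, Measure ((Fin (nb b) → S) × (Fin (nb b) → T))}
    (hGW : ∀ b, ((margN Psrc (nb b)).prod volume).map (fun p => (p.1, G b p.1 p.2)) = W b) (b : Bool) :
    (Psrc.prod volume).map (fun p => (rst (nb b) p.1, G b (rst _ p.1) p.2)) = W b := by
  rw [← hGW b]
  have := Measure.map_prod_map (μa := Psrc) (μc := (volume : Measure unitInterval)) (f := rst (nb b))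
      (g := id) (measurable_rst _) measurable_id
  rw [Measure.map_id, ← margN_eq] at this
  have hm : Measurable fun p : (Fin (nb b) → S) × unitInterval => (p.1, G b p.1 p.2) :=
    measurable_fst.prodMk (hG b)
  have hm2 : Measurable (Prod.map (rst (nb b) : (ℕ → S) → _) (id : unitInterval → _)) :=
    (measurable_rst _).prodMap measurable_id
  rw [this, Measure.map_map hm hm2]
  rfl

lemma integral_liftB {Psrc : Measure (ℕ → S)} [IsProbabilityMeasure Psrc]
    (hG : ∀ b, Measurable (Function.uncurry (G b)))
    {W : ∀ b, Measure ((Fin (nb b) → S) × (Fin (nb b) → T))}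
    (hGW : ∀ b, ((margN Psrc (nb b)).prod volume).map (fun p => (p.1, G b p.1 p.2)) = W b)
    {φ : ∀ b, (Fin (nb b) → S) × (Fin (nb b) → T) → ℝ} (hφ : ∀ b, Measurable (φ b))
    (hi : ∀ b, Integrable (φ b) (W b)) :
    Integrable (liftB G φ) (Psrc.prod coinU) ∧
    ∫ p, liftB G φ p ∂(Psrc.prod coinU) =
      2⁻¹ * (∫ z, φ true z ∂(W true)) + 2⁻¹ * ∫ z, φ false z ∂(W false) := by
  have hm := measurable_liftB hG hφ
  have hι : ∀ b : Bool, Measurable fun p : (ℕ → S) × unitInterval => (p.1, (b, p.2)) := fun b =>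
    measurable_fst.prodMk (measurable_const.prodMk measurable_snd)
  have hmap := map_blk hG hGW
  have hIntg : ∀ b : Bool, Integrable (liftB G φ) ((Psrc.prod volume).map fun p => (p.1, (b, p.2))) := by
    intro b
    rw [integrable_map_measure hm.aestronglyMeasurable (hι b).aemeasurable]
    have := hi b
    rw [← hmap b, integrable_map_measure (hφ b).aestronglyMeasurable
      (measurable_blk hG b).aemeasurable] at this
    exact this
  have hval : ∀ b : Bool, ∫ p, liftB G φ p ∂((Psrc.prod volume).map fun p => (p.1, (b, p.2))) =
      ∫ z, φ b z ∂(W b) := by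
    intro b
    rw [integral_map (hι b).aemeasurable hm.aestronglyMeasurable, ← hmap b,
      integral_map (measurable_blk hG b).aemeasurable (hφ b).aestronglyMeasurable]
    rfl
  have h2 : (2⁻¹ : ℝ≥0∞) ≠ ∞ := by simp
  rw [prod_coinU]
  have i1 := (hIntg true).smul_measure h2
  have i2 := (hIntg false).smul_measure h2
  refine ⟨i1.add_measure i2, ?_⟩
  rw [integral_add_measure i1 i2, integral_smul_measure, integral_smul_measure, hval, hval]
  simp

lemma relEnt_fin {α : Type*} [MeasurableSpace α] {μ ν : Measure α} (h : relEnt μ ν ≠ ∞) :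
    μ ≪ ν ∧ Integrable (llr μ ν) μ ∧ ∫ x, llr μ ν x ∂μ ≤ (relEnt μ ν).toReal := by
  unfold relEnt at h ⊢
  split_ifs at h ⊢ with hh
  · refine ⟨hh.1, hh.2, ?_⟩
    rw [ENNReal.toReal_ofReal']
    exact le_max_left _ _
  · exact absurd rfl h

theorem upper_bool [StandardBorelSpace T] {Psrc : Measure (ℕ → S)} [IsProbabilityMeasure Psrc]
    (hErg : Ergodic shiftSeq Psrc) (hρm : Measurable ρ) (hρ0 : ∀ z, 0 ≤ ρ z)
    (hC : 1 ≤ C) (hQ : MeasurePreserving shiftSeq 𝒬 𝒬) (hmix : Mixing 𝒬 C) (D r : ℝ)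
    (h1 : nb true = 1) (hpos : ∀ b, 1 ≤ nb b)
    (W : ∀ b, Measure ((Fin (nb b) → S) × (Fin (nb b) → T)))
    (hW : ∀ b, W b ∈ distSetN ρ (nb b) (margN Psrc (nb b)) D)
    (hfin : ∀ b, relEnt (W b) ((margN Psrc (nb b)).prod (margN 𝒬 (nb b))) ≠ ∞)
    (hr : (relEnt (W true) ((margN Psrc (nb true)).prod (margN 𝒬 (nb true)))).toReal +
      (relEnt (W false) ((margN Psrc (nb false)).prod (margN 𝒬 (nb false)))).toReal +
      2 * Real.log C < r * (nb true + nb false)) :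
    ∀ᵐ x ∂Psrc, ∃ᶠ n : ℕ in atTop, ENNReal.ofReal (Real.exp (-(r * n))) ≤ sQ ρ 𝒬 x n (n * D) := by
  haveI hWp : ∀ b, IsProbabilityMeasure (W b) := fun b => (hW b).1
  haveI : Nonempty T := by
    obtain ⟨y⟩ := (inferInstance : NeZero 𝒬).out |> fun h => Measure.nonempty_of_neZero 𝒬
    exact ⟨y 0⟩
  have hrep := fun b => coupling_rep (margN Psrc (nb b)) (margN 𝒬 (nb b)) (W b) (hW b).2.1
    (relEnt_fin (hfin b)).1
  choose G hG hGW hGK using hrep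
  set φd : ∀ b, (Fin (nb b) → S) × (Fin (nb b) → T) → ℝ := fun b z => fdist ρ (nb b) z.1 z.2 with hφd
  set φl : ∀ b, (Fin (nb b) → S) × (Fin (nb b) → T) → ℝ := fun b =>
    llr (W b) ((margN Psrc (nb b)).prod (margN 𝒬 (nb b))) with hφl
  have mφd : ∀ b, Measurable (φd b) := fun b => measurable_fdist hρm (nb b)
  have mφl : ∀ b, Measurable (φl b) := fun b => measurable_llr _ _
  have hφd0 : ∀ b z, 0 ≤ φd b z := fun b z => Finset.sum_nonneg fun _ _ => hρ0 _
  have hid : ∀ b, Integrable (φd b) (W b) ∧ ∫ z, φd b z ∂(W b) ≤ nb b * D := by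
    intro b
    have hn : (0 : ℝ) < nb b := by exact_mod_cast hpos b
    have hD := (hW b).2.2
    have hlt : ∫⁻ z, ENNReal.ofReal (rhoFin ρ (nb b) z.1 z.2) ∂(W b) ≠ ∞ := by
      intro h
      rw [h] at hD
      exact absurd hD (by simp)
    have hrm : Measurable fun z : (Fin (nb b) → S) × (Fin (nb b) → T) => rhoFin ρ (nb b) z.1 z.2 :=
      (mφd b).const_mul ((nb b : ℝ)⁻¹)
    have hr0 : ∀ z : (Fin (nb b) → S) × (Fin (nb b) → T), 0 ≤ rhoFin ρ (nb b) z.1 z.2 := fun z =>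
      mul_nonneg (by positivity) (hφd0 b z)
    have hri : Integrable (fun z : (Fin (nb b) → S) × (Fin (nb b) → T) => rhoFin ρ (nb b) z.1 z.2) (W b) := by
      refine ⟨hrm.aestronglyMeasurable, ?_⟩
      rw [hasFiniteIntegral_iff_ofReal (ae_of_all _ hr0)]
      exact lt_top_iff_ne_top.2 hlt
    have hrI : ∫ z, rhoFin ρ (nb b) z.1 z.2 ∂(W b) ≤ D := by
      rw [integral_eq_lintegral_of_nonneg_ae (ae_of_all _ hr0) hrm.aestronglyMeasurable]
      rw [← EReal.coe_le_coe_iff, EReal.coe_ennreal_toReal hlt]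
      exact hD
    have heq : ∀ z, φd b z = nb b * rhoFin ρ (nb b) z.1 z.2 := by
      intro z
      simp only [rhoFin]
      rw [mul_inv_cancel_left₀ hn.ne']; rfl
    have hfe : φd b = fun z => nb b * rhoFin ρ (nb b) z.1 z.2 := funext heq
    rw [hfe]
    refine ⟨hri.const_mul _, ?_⟩
    rw [integral_const_mul]
    exact mul_le_mul_of_nonneg_left hrI hn.le
  have hil := fun b => (relEnt_fin (hfin b)).2
  -- apply the generic theorem
  set len : Bool × unitInterval → ℕ := fun w => nb w.1 with hlen
  have mlen : Measurable len := (measurable_of_countable nb).comp measurable_fst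
  have ZI := integral_liftB hG hGW (φ := fun b z => φd b z - nb b * D)
    (fun b => (mφd b).sub_const _) (fun b => (hid b).1.sub (integrable_const _))
  have VI := integral_liftB hG hGW (φ := fun b z => φl b z + Real.log C - nb b * r)
    (fun b => ((mφl b).add_const _).sub_const _)
    (fun b => ((hil b).1.add (integrable_const _)).sub (integrable_const _))
  refine upper_gen (ν := coinU) (len := len) (δ := liftB G φd) (l := liftB G φl) (m := max (nb true) (nb false)) hErg hC mlen
    (measurable_liftB hG mφd) (measurable_liftB hG mφl) ?_ (fun w => hpos w.1) ?_ ?_ D r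
    ZI.1 ?_ VI.1 ?_
  · -- positivity
    have : (2⁻¹ : ℝ≥0∞) ≤ coinU {w | len w = 1} := by
      have hms : MeasurableSet {w | len w = 1} := mlen (measurableSet_singleton 1)
      rw [coinU, Measure.add_apply, Measure.smul_apply, Measure.map_apply measurable_prodMk_left hms]
      have : Prod.mk true ⁻¹' {w : Bool × unitInterval | len w = 1} = univ := by
        ext v; simp [hlen, h1]
      rw [this]
      simp
    intro h0
    rw [h0] at this
    simp at this
  · rintro ⟨b, v⟩
    cases b
    · exact le_max_right _ _
    · exact le_max_left _ _
  · -- one-step domination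
    have hK : ∀ᵐ x ∂Psrc, ∀ b, ∀ g : (Fin (nb b) → T) → ℝ≥0∞, Measurable g →
        ∫⁻ v, ENNReal.ofReal (Real.exp (-(φl b (rst (nb b) x, G b (rst (nb b) x) v)))) *
          g (G b (rst (nb b) x) v) ≤ ∫⁻ y, g y ∂(margN 𝒬 (nb b)) := by
      rw [ae_all_iff]
      intro b
      have := hGK b
      rw [margN_eq Psrc] at this
      exact ae_of_ae_map (measurable_rst _).aemeasurable this
    filter_upwards [hK] with x hx n t
    have hb : ∀ b : Bool, ∫⁻ w, (if len w ≤ n then ENNReal.ofReal (Real.exp (-(liftB G φl (x, w)))) *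
        sQ ρ 𝒬 (shiftSeq^[len w] x) (n - len w) (t - liftB G φd (x, w)) else 0)
          ∂((volume : Measure unitInterval).map (Prod.mk b)) ≤ ENNReal.ofReal C * sQ ρ 𝒬 x n t := by
      intro b
      refine (lintegral_map_le _ _).trans ?_
      by_cases hbn : nb b ≤ n
      · have hd : Measurable fun y : Fin (nb b) → T => fdist ρ (nb b) (rst (nb b) x) y :=
          (measurable_fdist hρm (nb b)).comp measurable_prodMk_left
        have hg : Measurable fun y : Fin (nb b) → T =>
            sQ ρ 𝒬 (shiftSeq^[nb b] x) (n - nb b) (t - fdist ρ (nb b) (rst (nb b) x) y) :=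
          (sQ_mono (ρ := ρ) (𝒬 := 𝒬) (shiftSeq^[nb b] x) (n - nb b)).measurable.comp (hd.const_sub t)
        have h2 := mix_ball hρm hC hQ hmix (nb b) (n - nb b) x t
        rw [Nat.add_sub_cancel' hbn] at h2
        refine le_trans (le_of_eq (lintegral_congr fun v => ?_)) ((hx b _ hg).trans h2)
        simp only [hlen, liftB]
        rw [if_pos hbn]
      · refine le_trans (le_of_eq ?_) zero_le
        simp only [hlen]
        simp [hbn]
    have h2 := add_le_add (mul_le_mul_right (hb true) 2⁻¹) (mul_le_mul_right (hb false) 2⁻¹)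
    rw [← add_mul, ENNReal.inv_two_add_inv_two, one_mul] at h2
    refine le_trans (le_of_eq ?_) h2
    rw [coinU, lintegral_add_measure, lintegral_smul_measure, lintegral_smul_measure]
    rfl
  · have : ∀ b, ∫ z, (φd b z - nb b * D) ∂(W b) ≤ 0 := by
      intro b
      rw [integral_sub (hid b).1 (integrable_const _)]
      have := (hid b).2
      simp
      linarith
    refine le_trans (le_of_eq ZI.2) ?_
    have a1 := this true
    have a2 := this false
    linarith
  · have : ∀ b, ∫ z, (φl b z + Real.log C - nb b * r) ∂(W b) = (∫ z, φl b z ∂(W b)) + Real.log C - nb b * r := by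
      intro b
      have i1 : Integrable (fun z => φl b z + Real.log C) (W b) := (hil b).1.add (integrable_const _)
      rw [integral_sub i1 (integrable_const _), integral_add (hil b).1 (integrable_const _),
        integral_const, integral_const]
      simp only [probReal_univ, one_smul]
      rfl
    refine lt_of_eq_of_lt VI.2 ?_
    rw [this, this]
    have a1 := (hil true).2
    have a2 := (hil false).2
    simp only [hφl]
    linarith

end up

section fin
variable {S T : Type*} [MeasurableSpace S] [MeasurableSpace T]
  {ρ : S × T → ℝ} {𝒬 : Measure (ℕ → T)} [IsProbabilityMeasure 𝒬] {C : ℝ}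

lemma liminf_le_of_freq (hρm : Measurable ρ) {D r : ℝ} {x : ℕ → S}
    (h : ∃ᶠ n : ℕ in atTop, ENNReal.ofReal (Real.exp (-(r * n))) ≤ sQ ρ 𝒬 x n (n * D)) :
    liminf (fun n => LnMem ρ 𝒬 D n x) atTop ≤ ENNReal.ofReal r := by
  refine liminf_le_of_frequently_le' ?_
  refine (h.and_eventually (eventually_ge_atTop 1)).mono fun n hn => ?_
  obtain ⟨hq, hn1⟩ := hn
  rw [LnMem_eq hρm D hn1 x]
  set q := sQ ρ 𝒬 x n (n * D)
  have hqt : q ≠ ∞ := measure_ne_top _ _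
  have hqpos : 0 < q := lt_of_lt_of_le (ENNReal.ofReal_pos.2 (Real.exp_pos _)) hq
  have hn0 : (n : ℝ≥0∞) ≠ 0 := by exact_mod_cast (by omega : n ≠ 0)
  rw [negLog, if_neg hqpos.ne', ENNReal.inv_mul_le_iff hn0 (ENNReal.natCast_ne_top n)]
  have h1 : Real.exp (-(r * n)) ≤ q.toReal := by
    rwa [ENNReal.ofReal_le_iff_le_toReal hqt] at hq
  have h2 := Real.log_le_log (Real.exp_pos _) h1
  rw [Real.log_exp] at h2
  calc ENNReal.ofReal (-Real.log q.toReal) ≤ ENNReal.ofReal (n * r) :=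
        ENNReal.ofReal_le_ofReal (by linarith)
    _ = n * ENNReal.ofReal r := by
        rw [ENNReal.ofReal_mul (by positivity), ENNReal.ofReal_natCast]

lemma relEnt_eq_klDiv {α : Type*} [MeasurableSpace α] (μ ν : Measure α) [IsProbabilityMeasure μ]
    [IsProbabilityMeasure ν] : relEnt μ ν = InformationTheory.klDiv μ ν := by
  rw [InformationTheory.klDiv_def]
  simp [relEnt]

lemma margN_map_coord {α : Type*} [MeasurableSpace α] {μ : Measure (ℕ → α)} (hμ : MeasurePreserving shiftSeq μ μ)
    {m : ℕ} (k : Fin m) :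
    (margN μ m).map (fun (x : Fin m → α) (_ : Fin 1) => x k) = margN μ 1 := by
  have hm : Measurable fun (x : Fin m → α) (_ : Fin 1) => x k :=
    measurable_pi_lambda _ fun _ => measurable_pi_apply k
  rw [margN_eq, margN_eq, Measure.map_map hm (measurable_rst m)]
  conv_rhs => rw [← (hμ.iterate (k : ℕ)).map_eq]
  rw [Measure.map_map (measurable_rst 1) (hμ.iterate (k : ℕ)).measurable]
  congr 1
  funext x i
  have : (i : ℕ) = 0 := by omega
  simp [rst, shiftSeq_iter, this]

lemma exists_one {Psrc : Measure (ℕ → S)} [IsProbabilityMeasure Psrc]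
    (hP : MeasurePreserving shiftSeq Psrc Psrc) (hQ : MeasurePreserving shiftSeq 𝒬 𝒬)
    (hρm : Measurable ρ) (hρ0 : ∀ z, 0 ≤ ρ z) {D : ℝ} {m : ℕ} (hm : 1 ≤ m)
    {W : Measure ((Fin m → S) × (Fin m → T))} (hW : W ∈ distSetN ρ m (margN Psrc m) D)
    (hfin : relEnt W ((margN Psrc m).prod (margN 𝒬 m)) ≠ ∞) :
    ∃ W1 ∈ distSetN ρ 1 (margN Psrc 1) D, relEnt W1 ((margN Psrc 1).prod (margN 𝒬 1)) ≠ ∞ := by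
  haveI : IsProbabilityMeasure W := hW.1
  have hmk : ∀ k : Fin m, Measurable fun z : (Fin m → S) × (Fin m → T) => ρ (z.1 k, z.2 k) := fun k =>
    hρm.comp (((measurable_pi_apply k).comp measurable_fst).prodMk
      ((measurable_pi_apply k).comp measurable_snd))
  have hD0 : 0 ≤ D := by
    have h0 : (0 : EReal) ≤ (D : EReal) := le_trans (EReal.coe_ennreal_nonneg _) hW.2.2
    exact_mod_cast h0
  have hcoe : ∀ q : ℝ≥0∞, (q : EReal) ≤ (D : EReal) ↔ q ≤ ENNReal.ofReal D := by
    intro q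
    rw [← EReal.coe_ennreal_le_coe_ennreal_iff, EReal.coe_ennreal_ofReal, max_eq_left hD0]
  have hk : ∃ k : Fin m, ∫⁻ z, ENNReal.ofReal (ρ (z.1 k, z.2 k)) ∂W ≤ ENNReal.ofReal D := by
    by_contra hcon
    push Not at hcon
    have hle := (hcoe _).1 hW.2.2
    have hsum : ∫⁻ z, ENNReal.ofReal (rhoFin ρ m z.1 z.2) ∂W =
        (m : ℝ≥0∞)⁻¹ * ∑ k : Fin m, ∫⁻ z, ENNReal.ofReal (ρ (z.1 k, z.2 k)) ∂W := by
      rw [← lintegral_finsetSum _ fun k _ => (hmk k).ennreal_ofReal,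
        ← lintegral_const_mul' _ _ (by simp; omega)]
      refine lintegral_congr fun z => ?_
      have hm0 : (0 : ℝ) < m := by exact_mod_cast hm
      rw [rhoFin, ENNReal.ofReal_mul (by positivity), ENNReal.ofReal_sum_of_nonneg fun k _ => hρ0 _,
        ENNReal.ofReal_inv_of_pos hm0, ENNReal.ofReal_natCast]
    have hm0 : (m : ℝ≥0∞) ≠ 0 := by exact_mod_cast (by omega : m ≠ 0)
    rw [hsum, ENNReal.inv_mul_le_iff hm0 (ENNReal.natCast_ne_top m)] at hle
    haveI : Nonempty (Fin m) := ⟨⟨0, hm⟩⟩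
    have := ENNReal.sum_lt_sum_of_nonempty (s := (Finset.univ : Finset (Fin m))) Finset.univ_nonempty
      (fun k _ => hcon k)
    rw [Finset.sum_const, Finset.card_univ, Fintype.card_fin, nsmul_eq_mul] at this
    exact absurd hle (not_le.2 this)
  obtain ⟨k, hk⟩ := hk
  have ms : Measurable fun (x : Fin m → S) (_ : Fin 1) => x k :=
    measurable_pi_lambda _ fun _ => measurable_pi_apply k
  have mt : Measurable fun (x : Fin m → T) (_ : Fin 1) => x k :=
    measurable_pi_lambda _ fun _ => measurable_pi_apply k
  set g := Prod.map (fun (x : Fin m → S) (_ : Fin 1) => x k) (fun (x : Fin m → T) (_ : Fin 1) => x k)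
  have hg : Measurable g := ms.prodMap mt
  haveI : IsProbabilityMeasure (W.map g) := Measure.isProbabilityMeasure_map hg.aemeasurable
  refine ⟨W.map g, ⟨inferInstance, ?_, ?_⟩, ?_⟩
  · rw [Measure.map_map measurable_fst hg, ← margN_map_coord hP k, ← hW.2.1,
      Measure.map_map ms measurable_fst]
    rfl
  · rw [hcoe]
    have hr1 : Measurable fun z : (Fin 1 → S) × (Fin 1 → T) => ENNReal.ofReal (rhoFin ρ 1 z.1 z.2) :=
      ((measurable_fdist hρm 1).const_mul (((1 : ℕ) : ℝ)⁻¹)).ennreal_ofReal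
    rw [lintegral_map hr1 hg]
    refine le_trans (le_of_eq (lintegral_congr fun z => ?_)) hk
    simp [rhoFin, g]
  · have hmp : ((margN Psrc m).prod (margN 𝒬 m)).map g = (margN Psrc 1).prod (margN 𝒬 1) := by
      rw [← Measure.map_prod_map _ _ ms mt, margN_map_coord hP k, margN_map_coord hQ k]
    rw [relEnt_eq_klDiv] at hfin ⊢
    rw [← hmp]
    exact ne_top_of_le_ne_top hfin (InformationTheory.klDiv_map_le _ _ hg)

theorem upper_final [StandardBorelSpace T] {Psrc : Measure (ℕ → S)} [IsProbabilityMeasure Psrc]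
    (hErg : Ergodic shiftSeq Psrc) (hρm : Measurable ρ) (hρ0 : ∀ z, 0 ≤ ρ z)
    (hC : 1 ≤ C) (hQ : MeasurePreserving shiftSeq 𝒬 𝒬) (hmix : Mixing 𝒬 C) (D r : ℝ)
    (hr : liminf (fun n => RnMem ρ n (margN Psrc n) (margN 𝒬 n) D) atTop < ENNReal.ofReal r) :
    ∀ᵐ x ∂Psrc, liminf (fun n => LnMem ρ 𝒬 D n x) atTop ≤ ENNReal.ofReal r := by
  obtain ⟨s', hs1, hs2⟩ := exists_between hr
  set s := s'.toReal with hs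
  have hs't : s' ≠ ∞ := hs2.ne_top
  have hsr : s < r := by
    have := ENNReal.toReal_lt_of_lt_ofReal hs2
    exact this
  have hfreq : ∃ᶠ n : ℕ in atTop, RnMem ρ n (margN Psrc n) (margN 𝒬 n) D < s' :=
    frequently_lt_of_liminf_lt (by isBoundedDefault) hs1
  have hW : ∀ m : ℕ, 1 ≤ m → RnMem ρ m (margN Psrc m) (margN 𝒬 m) D < s' →
      ∃ W ∈ distSetN ρ m (margN Psrc m) D,
        relEnt W ((margN Psrc m).prod (margN 𝒬 m)) < m * s' := by
    intro m hm h
    rw [RnMem] at h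
    have hm0 : (m : ℝ≥0∞) ≠ 0 := by exact_mod_cast (by omega : m ≠ 0)
    rw [mul_comm, ← div_eq_mul_inv, ENNReal.div_lt_iff (Or.inl hm0) (Or.inl (ENNReal.natCast_ne_top m))] at h
    simp only [iInf_lt_iff] at h
    obtain ⟨W, hW, h⟩ := h
    exact ⟨W, hW, by rwa [mul_comm]⟩
  obtain ⟨m0, hm0, hm1⟩ := (hfreq.and_eventually (eventually_ge_atTop 1)).exists
  obtain ⟨W0, hW0, hW0'⟩ := hW m0 hm1 hm0
  obtain ⟨W1, hW1, hW1f⟩ := exists_one hErg.toMeasurePreserving hQ hρm hρ0 hm1 hW0 hW0'.ne_top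
  set H1 := (relEnt W1 ((margN Psrc 1).prod (margN 𝒬 1))).toReal
  obtain ⟨K, hK⟩ := exists_nat_ge ((H1 + 2 * Real.log C + |r|) / (r - s))
  obtain ⟨m, hm, hmK⟩ := (hfreq.and_eventually (eventually_ge_atTop (K + 1))).exists
  obtain ⟨Wm, hWm, hWm'⟩ := hW m (by omega) hm
  have hWmr : (relEnt Wm ((margN Psrc m).prod (margN 𝒬 m))).toReal ≤ m * s := by
    have := ENNReal.toReal_mono (ENNReal.mul_ne_top (ENNReal.natCast_ne_top m) hs't) hWm'.le
    rwa [ENNReal.toReal_mul, ENNReal.toReal_natCast] at this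
  have hlt : H1 + (relEnt Wm ((margN Psrc m).prod (margN 𝒬 m))).toReal + 2 * Real.log C <
      r * ((1 : ℕ) + m) := by
    have hmK' : (K : ℝ) + 1 ≤ m := by exact_mod_cast hmK
    rw [div_le_iff₀ (by linarith)] at hK
    have h3 : (K : ℝ) * (r - s) + (r - s) ≤ m * (r - s) := by nlinarith
    have := neg_abs_le r
    push_cast
    nlinarith
  let nb : Bool → ℕ := fun b => Bool.rec m 1 b
  have hmm : 1 ≤ m := by omega
  let W : ∀ b, Measure ((Fin (nb b) → S) × (Fin (nb b) → T)) := fun b => Bool.rec Wm W1 b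
  have := upper_bool (nb := nb) hErg hρm hρ0 hC hQ hmix D r rfl
    (fun b => by cases b; exact hmm; exact le_rfl) W
    (fun b => by cases b; exact hWm; exact hW1)
    (fun b => by cases b; exact hWm'.ne_top; exact hW1f) hlt
  filter_upwards [this] with x hx
  exact liminf_le_of_freq hρm hx

theorem lower_final [StandardBorelSpace S] [StandardBorelSpace T] {Psrc : Measure (ℕ → S)} [IsProbabilityMeasure Psrc]
    (hErg : Ergodic shiftSeq Psrc) (hρm : Measurable ρ) (hρ0 : ∀ z, 0 ≤ ρ z)
    (hC : 1 ≤ C) (hQ : MeasurePreserving shiftSeq 𝒬 𝒬) (hmix : Mixing 𝒬 C) (D r : ℝ) (hr0 : 0 ≤ r)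
    (hr : ENNReal.ofReal r < limsup (fun n => RnMem ρ n (margN Psrc n) (margN 𝒬 n) D) atTop) :
    ∀ᵐ x ∂Psrc, ENNReal.ofReal r ≤ liminf (fun n => LnMem ρ 𝒬 D n x) atTop := by
  have hfreq : ∃ᶠ n : ℕ in atTop, ENNReal.ofReal r < RnMem ρ n (margN Psrc n) (margN 𝒬 n) D :=
    frequently_lt_of_lt_limsup (by isBoundedDefault) hr
  have hstep : ∀ m : ℕ, 1 ≤ m → ENNReal.ofReal r < RnMem ρ m (margN Psrc m) (margN 𝒬 m) D →
      ∀ᵐ x ∂Psrc, ENNReal.ofReal (r - Real.log C / m) ≤ liminf (fun n => LnMem ρ 𝒬 D n x) atTop := by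
    intro m hm h
    have hm0 : (m : ℝ≥0∞) ≠ 0 := by exact_mod_cast (by omega : m ≠ 0)
    have hmR : (0 : ℝ) < m := by exact_mod_cast hm
    rw [RnMem, mul_comm, ← div_eq_mul_inv, ENNReal.lt_div_iff_mul_lt (Or.inl hm0)
      (Or.inl (ENNReal.natCast_ne_top m))] at h
    have hM : ENNReal.ofReal (r * m) < ⨅ W ∈ distSetN ρ m (margN Psrc m) D,
        relEnt W ((margN Psrc m).prod (margN 𝒬 m)) := by
      rwa [ENNReal.ofReal_mul hr0, ENNReal.ofReal_natCast]
    have := lower_bound hErg hρm hρ0 hC hQ hmix D hm (r * m) hM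
    have e : (r * m - Real.log C) / m = r - Real.log C / m := by field_simp
    rwa [e] at this
  have hall : ∀ᵐ x ∂Psrc, ∀ m : ℕ, 1 ≤ m → ENNReal.ofReal r < RnMem ρ m (margN Psrc m) (margN 𝒬 m) D →
      ENNReal.ofReal (r - Real.log C / m) ≤ liminf (fun n => LnMem ρ 𝒬 D n x) atTop := by
    rw [ae_all_iff]
    intro m
    by_cases hm : 1 ≤ m
    · by_cases h : ENNReal.ofReal r < RnMem ρ m (margN Psrc m) (margN 𝒬 m) D
      · filter_upwards [hstep m hm h] with x hx _ _
        exact hx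
      · exact ae_of_all _ fun x _ h' => absurd h' h
    · exact ae_of_all _ fun x h' => absurd h' hm
  filter_upwards [hall] with x hx
  have hl : Tendsto (fun m : ℕ => ENNReal.ofReal (r - Real.log C / m)) atTop (𝓝 (ENNReal.ofReal r)) := by
    have h1 : Tendsto (fun m : ℕ => r - Real.log C / m) atTop (𝓝 (r - 0)) :=
      tendsto_const_nhds.sub (tendsto_const_div_atTop_nhds_zero_nat _)
    rw [sub_zero] at h1
    exact (ENNReal.continuous_ofReal.tendsto _).comp h1
  by_contra hcon
  push Not at hcon
  have h2 := (hfreq.and_eventually ((eventually_ge_atTop 1).and (hl.eventually (lt_mem_nhds hcon)))).exists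
  obtain ⟨m, h3, h4, h5⟩ := h2
  exact absurd (hx m h4 h3) (not_le.2 h5)

end fin

theorem stmt12' {S T : Type*} [MeasurableSpace S] [StandardBorelSpace S]
    [MeasurableSpace T] [StandardBorelSpace T]
    (ρ : S × T → ℝ) (hρm : Measurable ρ) (hρ0 : ∀ z, 0 ≤ ρ z)
    (Psrc : Measure (ℕ → S)) [IsProbabilityMeasure Psrc] (hErg : Ergodic shiftSeq Psrc)
    (𝒬 : Measure (ℕ → T)) [IsProbabilityMeasure 𝒬]
    (hQstat : MeasurePreserving shiftSeq 𝒬 𝒬)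
    (C : ℝ) (hC : 1 ≤ C) (hmix : Mixing 𝒬 C) (D : ℝ) :
    ∃ r : ℝ≥0∞, Tendsto (fun n => RnMem ρ n (margN Psrc n) (margN 𝒬 n) D) atTop (𝓝 r) ∧
      ∀ᵐ x ∂Psrc, liminf (fun n => LnMem ρ 𝒬 D n x) atTop = r := by
  set R : ℕ → ℝ≥0∞ := fun n => RnMem ρ n (margN Psrc n) (margN 𝒬 n) D with hR
  have hlow : ∀ᵐ x ∂Psrc, limsup R atTop ≤ liminf (fun n => LnMem ρ 𝒬 D n x) atTop := by
    have : ∀ᵐ x ∂Psrc, ∀ q : ℚ≥0, ENNReal.ofReal (q : ℝ) < limsup R atTop →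
        ENNReal.ofReal (q : ℝ) ≤ liminf (fun n => LnMem ρ 𝒬 D n x) atTop := by
      rw [ae_all_iff]
      intro q
      by_cases hq : ENNReal.ofReal (q : ℝ) < limsup R atTop
      · filter_upwards [lower_final hErg hρm hρ0 hC hQstat hmix D q (by positivity) hq] with x hx _
        exact hx
      · exact ae_of_all _ fun x h => absurd h hq
    filter_upwards [this] with x hx
    by_contra hcon
    push Not at hcon
    obtain ⟨q, hq0, h1, h2⟩ := ENNReal.lt_iff_exists_rat_btwn.1 hcon
    lift q to ℚ≥0 using hq0
    exact absurd (hx q h2) (not_le.2 h1)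
  have hup : ∀ᵐ x ∂Psrc, liminf (fun n => LnMem ρ 𝒬 D n x) atTop ≤ liminf R atTop := by
    have : ∀ᵐ x ∂Psrc, ∀ q : ℚ≥0, liminf R atTop < ENNReal.ofReal (q : ℝ) →
        liminf (fun n => LnMem ρ 𝒬 D n x) atTop ≤ ENNReal.ofReal (q : ℝ) := by
      rw [ae_all_iff]
      intro q
      by_cases hq : liminf R atTop < ENNReal.ofReal (q : ℝ)
      · filter_upwards [upper_final hErg hρm hρ0 hC hQstat hmix D q hq] with x hx _
        exact hx
      · exact ae_of_all _ fun x h => absurd h hq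
    filter_upwards [this] with x hx
    by_contra hcon
    push Not at hcon
    obtain ⟨q, hq0, h1, h2⟩ := ENNReal.lt_iff_exists_rat_btwn.1 hcon
    lift q to ℚ≥0 using hq0
    exact absurd (hx q h1) (not_le.2 h2)
  obtain ⟨x, hx1, hx2⟩ := (hlow.and hup).exists
  have hle : limsup R atTop ≤ liminf R atTop := hx1.trans hx2
  have heq : limsup R atTop = liminf R atTop := le_antisymm hle (liminf_le_limsup)
  refine ⟨liminf R atTop, tendsto_of_liminf_eq_limsup rfl heq, ?_⟩
  filter_upwards [hlow, hup] with x h1 h2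
  exact le_antisymm h2 (heq ▸ h1)

/-- for a stationary ergodic source and a stationary codebook
process satisfying the strong mixing condition, the limit
`R_∞(ℙ,𝒬,D) = lim_n R_n(P_n,Q_n,D)` exists and, almost surely,
`liminf_n L_n(X_1^n,Q_n,D) = R_∞(ℙ,𝒬,D)`. -/
theorem stmt12 {S T : Type*} [MeasurableSpace S] [StandardBorelSpace S]
    [MeasurableSpace T] [StandardBorelSpace T]
    (ρ : S × T → ℝ) (hρm : Measurable ρ) (hρ0 : ∀ z, 0 ≤ ρ z)
    (Psrc : Measure (ℕ → S)) [IsProbabilityMeasure Psrc] (hErg : Ergodic shiftSeq Psrc)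
    (𝒬 : Measure (ℕ → T)) [IsProbabilityMeasure 𝒬]
    (hQstat : MeasurePreserving shiftSeq 𝒬 𝒬)
    (C : ℝ) (hC : 1 ≤ C) (hmix : Mixing 𝒬 C) (D : ℝ) :
    ∃ r : ℝ≥0∞, Tendsto (fun n => RnMem ρ n (margN Psrc n) (margN 𝒬 n) D) atTop (𝓝 r) ∧
      ∀ᵐ x ∂Psrc, liminf (fun n => LnMem ρ 𝒬 D n x) atTop = r := by
  exact stmt12' ρ hρm hρ0 Psrc hErg 𝒬 hQstat C hC hmix D

end
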